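/- Let Ω ⊂ ℝ² be a Jordan domain with analytic boundary and let f⁽⁰⁾ : Ω̄ → ℝ be a C^{2+1/2} function with f⁽⁰⁾_xx·f⁽⁰⁾_yy − (f⁽⁰⁾_xy)² ≠ 0 at every point of Ω̄ and with vanishing normalized mean curvature: (1+(f⁽⁰⁾_y)²)·f⁽⁰⁾_xx − 2·f⁽⁰⁾_x·f⁽⁰⁾_y·f⁽⁰⁾_xy + (1+(f⁽⁰⁾_x)²)·f⁽⁰⁾_yy = 0 on Ω̄. Define C^{2+1/2} functions f⁽ᵐ⁾ : Ω̄ → ℝ (m ≥ 1) recursively as the unique solutions vanishing on ∂Ω of H₀(f⁽ᵐ⁾) = −Σ_{r=1}^{m−1} C(m, r)·H_r(f⁽ᵐ⁻ʳ⁾) + [ −m·K⁽ᵐ⁻¹⁾ − (4/(m+1))·Σ_{r=2}^{m−1} C(m+1, r)·H⁽ʳ⁾·H⁽ᵐ⁻ʳ⁺¹⁾ ] / ( 2^{1−δ_{m1}}·√(−K⁽⁰⁾) ). Then there exists a constant C > 0, depending only on Ω and f⁽⁰⁾, such that for every m ≥ 1, with ‖·‖ the C^{2+1/2} norm: ‖f⁽ᵐ⁾‖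 ≤ C·( Σ_{p₁+p₂+p₃ = m, 0 ≤ pᵢ < m} (m!/(p₁!p₂!p₃!))·‖f⁽ᵖ¹⁾‖·‖f⁽ᵖ²⁾‖·‖f⁽ᵖ³⁾‖ + m·Σ_{q₁+q₂+q₃+q₄ = m−1, qᵢ ≥ 0} ((m−1)!/(q₁!q₂!q₃!q₄!))·∏_{i=1}^{4}‖f⁽qᵢ⁾‖ + (1/(m+1))·Σ_{r₁+⋯+r₆ = m+1, 0 ≤ rᵢ < m} ((m+1)!/(r₁!⋯r₆!))·∏_{i=1}^{6}‖f⁽rᵢ⁾‖ ). -/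

import Mathlib

open Set Filter
open scoped BigOperators Topology

noncomputable section

def pdx (f : ℝ × ℝ → ℝ) (p : ℝ × ℝ) : ℝ := deriv (fun s : ℝ => f (s, p.2)) p.1

def pdy (f : ℝ × ℝ → ℝ) (p : ℝ × ℝ) : ℝ := deriv (fun s : ℝ => f (p.1, s)) p.2

def fxx (f : ℝ × ℝ → ℝ) : ℝ × ℝ → ℝ := pdx (pdx f)
def fxy (f : ℝ × ℝ → ℝ) : ℝ × ℝ → ℝ := pdy (pdx f)
def fyy (f : ℝ × ℝ → ℝ) : ℝ × ℝ → ℝ := pdy (pdy f)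

def IsAnalyticJordanCurve {E : Type*} [NormedAddCommGroup E] [NormedSpace ℝ E]
    (Γ : Set E) : Prop :=
  ∃ (γ : ℝ → E) (T : ℝ), 0 < T ∧
    AnalyticOnNhd ℝ γ univ ∧
    (∀ s, γ (s + T) = γ s) ∧
    InjOn γ (Ico 0 T) ∧
    (∀ s, deriv γ s ≠ 0) ∧
    Γ = range γ

def IsAnalyticJordanDomain (Ω : Set (ℝ × ℝ)) : Prop :=
  IsOpen Ω ∧ Bornology.IsBounded Ω ∧ IsConnected Ω ∧ IsAnalyticJordanCurve (frontier Ω)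

def AnalyticOnClosed {E : Type*} [NormedAddCommGroup E] [NormedSpace ℝ E]
    (f : E → ℝ) (s : Set E) : Prop :=
  ∃ (U : Set E) (g : E → ℝ), IsOpen U ∧ s ⊆ U ∧ AnalyticOnNhd ℝ g U ∧ EqOn f g s

def IsotropicCRPCAt (t : ℝ) (f : ℝ × ℝ → ℝ) (p : ℝ × ℝ) : Prop :=
  fxx f p + fyy f p = t * Real.sqrt ((fxy f p) ^ 2 - fxx f p * fyy f p)

def EuclideanCRPCAt (t : ℝ) (f : ℝ × ℝ → ℝ) (p : ℝ × ℝ) : Prop :=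
  (1 + (pdy f p) ^ 2) * fxx f p - 2 * pdx f p * pdy f p * fxy f p
      + (1 + (pdx f p) ^ 2) * fyy f p
    = t * Real.sqrt ((1 + (pdx f p) ^ 2 + (pdy f p) ^ 2)
        * ((fxy f p) ^ 2 - fxx f p * fyy f p))

def HolderHalfOn (g : ℝ × ℝ → ℝ) (s : Set (ℝ × ℝ)) : Prop :=
  ∃ C : ℝ, ∀ u ∈ s, ∀ v ∈ s, |g u - g v| ≤ C * ‖u - v‖ ^ ((1 : ℝ) / 2)

def C0norm (g : ℝ × ℝ → ℝ) (s : Set (ℝ × ℝ)) : ℝ := sSup ((fun p => |g p|) '' s)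

def holderSemi (g : ℝ × ℝ → ℝ) (s : Set (ℝ × ℝ)) : ℝ :=
  sSup {r : ℝ | ∃ u ∈ s, ∃ v ∈ s, u ≠ v ∧ r = |g u - g v| / ‖u - v‖ ^ ((1 : ℝ) / 2)}

def ChalfNorm (g : ℝ × ℝ → ℝ) (s : Set (ℝ × ℝ)) : ℝ := C0norm g s + holderSemi g s

def C2norm (f : ℝ × ℝ → ℝ) (s : Set (ℝ × ℝ)) : ℝ :=
  C0norm f s + max (C0norm (pdx f) s) (C0norm (pdy f) s)
    + max (C0norm (fxx f) s) (max (C0norm (fxy f) s) (C0norm (fyy f) s))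

def C2halfNorm (f : ℝ × ℝ → ℝ) (s : Set (ℝ × ℝ)) : ℝ :=
  C2norm f s + max (holderSemi (fxx f) s) (max (holderSemi (fxy f) s) (holderSemi (fyy f) s))

def IsCHalf (g : ℝ × ℝ → ℝ) (Ω : Set (ℝ × ℝ)) : Prop :=
  ContinuousOn g (closure Ω) ∧ HolderHalfOn g Ω

def IsC2Half (f : ℝ × ℝ → ℝ) (Ω : Set (ℝ × ℝ)) : Prop :=
  ContDiffOn ℝ 2 f Ω ∧
  ContinuousOn f (closure Ω) ∧ ContinuousOn (pdx f) (closure Ω) ∧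
  ContinuousOn (pdy f) (closure Ω) ∧ ContinuousOn (fxx f) (closure Ω) ∧
  ContinuousOn (fxy f) (closure Ω) ∧ ContinuousOn (fyy f) (closure Ω) ∧
  HolderHalfOn (fxx f) Ω ∧ HolderHalfOn (fxy f) Ω ∧ HolderHalfOn (fyy f) Ω

def IsCInftyClosed (f : ℝ × ℝ → ℝ) (Ω : Set (ℝ × ℝ)) : Prop :=
  ContDiffOn ℝ (⊤ : ℕ∞) f Ω ∧ ∀ i j : ℕ, ContinuousOn (pdx^[i] (pdy^[j] f)) (closure Ω)

def poissonRHS (f : ℕ → ℝ × ℝ → ℝ) (m : ℕ) (p : ℝ × ℝ) : ℝ :=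
  ((m : ℝ) * ∑ r ∈ Finset.range m, ((m - 1).choose r : ℝ) *
      (fxy (f r) p * fxy (f (m - r - 1)) p - fxx (f r) p * fyy (f (m - r - 1)) p)
    - (1 / ((m : ℝ) + 1)) * ∑ r ∈ Finset.Icc 2 (m - 1), ((m + 1).choose r : ℝ) *
      (fxx (f r) p + fyy (f r) p) * (fxx (f (m - r + 1)) p + fyy (f (m - r + 1)) p))
  / ((2 : ℝ) ^ (1 - (if m = 1 then 1 else 0) : ℕ) *
      Real.sqrt ((fxy (f 0) p) ^ 2 - fxx (f 0) p * fyy (f 0) p))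

def C2ConvergesTo (f : ℕ → ℝ × ℝ → ℝ) (Ω : Set (ℝ × ℝ)) (t : ℝ) (F : ℝ × ℝ → ℝ) : Prop :=
  TendstoUniformlyOn
    (fun n p => ∑ m ∈ Finset.range n, f m p * t ^ m / (m.factorial : ℝ)) F atTop Ω ∧
  TendstoUniformlyOn
    (fun n p => ∑ m ∈ Finset.range n, pdx (f m) p * t ^ m / (m.factorial : ℝ)) (pdx F) atTop Ω ∧
  TendstoUniformlyOn
    (fun n p => ∑ m ∈ Finset.range n, pdy (f m) p * t ^ m / (m.factorial : ℝ)) (pdy F) atTop Ω ∧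
  TendstoUniformlyOn
    (fun n p => ∑ m ∈ Finset.range n, fxx (f m) p * t ^ m / (m.factorial : ℝ)) (fxx F) atTop Ω ∧
  TendstoUniformlyOn
    (fun n p => ∑ m ∈ Finset.range n, fxy (f m) p * t ^ m / (m.factorial : ℝ)) (fxy F) atTop Ω ∧
  TendstoUniformlyOn
    (fun n p => ∑ m ∈ Finset.range n, fyy (f m) p * t ^ m / (m.factorial : ℝ)) (fyy F) atTop Ω

def fy2r (f : ℕ → ℝ × ℝ → ℝ) (r : ℕ) (p : ℝ × ℝ) : ℝ :=
  (if r = 0 then 1 else 0) +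
    ∑ i ∈ Finset.range (r + 1), (r.choose i : ℝ) * pdy (f i) p * pdy (f (r - i)) p

def fxfyr (f : ℕ → ℝ × ℝ → ℝ) (r : ℕ) (p : ℝ × ℝ) : ℝ :=
  ∑ i ∈ Finset.range (r + 1), (r.choose i : ℝ) * pdx (f i) p * pdy (f (r - i)) p

def fx2r (f : ℕ → ℝ × ℝ → ℝ) (r : ℕ) (p : ℝ × ℝ) : ℝ :=
  (if r = 0 then 1 else 0) +
    ∑ i ∈ Finset.range (r + 1), (r.choose i : ℝ) * pdx (f i) p * pdx (f (r - i)) p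

def Hseq (f : ℕ → ℝ × ℝ → ℝ) (n : ℕ) (p : ℝ × ℝ) : ℝ :=
  (1 / 2) * ∑ r ∈ Finset.range (n + 1), (n.choose r : ℝ) *
    (fy2r f r p * fxx (f (n - r)) p - 2 * fxfyr f r p * fxy (f (n - r)) p
      + fx2r f r p * fyy (f (n - r)) p)

def gradSqr (f : ℕ → ℝ × ℝ → ℝ) (r : ℕ) (p : ℝ × ℝ) : ℝ :=
  (if r = 0 then 1 else 0) +
    ∑ i ∈ Finset.range (r + 1), (r.choose i : ℝ) *
      (pdx (f i) p * pdx (f (r - i)) p + pdy (f i) p * pdy (f (r - i)) p)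

def hessDiscr (f : ℕ → ℝ × ℝ → ℝ) (s : ℕ) (p : ℝ × ℝ) : ℝ :=
  ∑ i ∈ Finset.range (s + 1), (s.choose i : ℝ) *
    (fxy (f i) p * fxy (f (s - i)) p - fxx (f i) p * fyy (f (s - i)) p)

def Kseq (f : ℕ → ℝ × ℝ → ℝ) (n : ℕ) (p : ℝ × ℝ) : ℝ :=
  -∑ r ∈ Finset.range (n + 1), (n.choose r : ℝ) * gradSqr f r p * hessDiscr f (n - r) p

def Hop (f : ℕ → ℝ × ℝ → ℝ) (r : ℕ) (u : ℝ × ℝ → ℝ) (p : ℝ × ℝ) : ℝ :=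
  fy2r f r p * fxx u p - 2 * fxfyr f r p * fxy u p + fx2r f r p * fyy u p
  + (2 : ℝ) ^ ((if r = 0 then 1 else 0) : ℕ) *
      (fyy (f 0) p * pdx (f r) p - fxy (f 0) p * pdy (f r) p) * pdx u p
  + (2 : ℝ) ^ ((if r = 0 then 1 else 0) : ℕ) *
      (fxx (f 0) p * pdy (f r) p - fxy (f 0) p * pdx (f r) p) * pdy u p

def ellipticRHS (f : ℕ → ℝ × ℝ → ℝ) (m : ℕ) (p : ℝ × ℝ) : ℝ :=
  -∑ r ∈ Finset.Icc 1 (m - 1), (m.choose r : ℝ) * Hop f r (f (m - r)) p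
  + (-(m : ℝ) * Kseq f (m - 1) p
      - 4 / ((m : ℝ) + 1) * ∑ r ∈ Finset.Icc 2 (m - 1), ((m + 1).choose r : ℝ) *
          Hseq f r p * Hseq f (m - r + 1) p)
    / ((2 : ℝ) ^ (1 - (if m = 1 then 1 else 0) : ℕ) * Real.sqrt (-Kseq f 0 p))

def multinom3Sum (b : ℕ → ℝ) (m : ℕ) : ℝ :=
  ∑ p ∈ (Finset.range m ×ˢ Finset.range m ×ˢ Finset.range m).filter
      (fun p => p.1 + p.2.1 + p.2.2 = m),
    ((m.factorial : ℝ) /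
        ((p.1.factorial : ℝ) * (p.2.1.factorial : ℝ) * (p.2.2.factorial : ℝ))) *
      (b p.1 * b p.2.1 * b p.2.2)

def multinom4Sum (b : ℕ → ℝ) (m : ℕ) : ℝ :=
  ∑ q ∈ (Finset.range m ×ˢ Finset.range m ×ˢ Finset.range m ×ˢ Finset.range m).filter
      (fun q => q.1 + q.2.1 + q.2.2.1 + q.2.2.2 = m - 1),
    (((m - 1).factorial : ℝ) /
        ((q.1.factorial : ℝ) * (q.2.1.factorial : ℝ) * (q.2.2.1.factorial : ℝ) *
          (q.2.2.2.factorial : ℝ))) *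
      (b q.1 * b q.2.1 * b q.2.2.1 * b q.2.2.2)

def multinom6Sum (b : ℕ → ℝ) (m : ℕ) : ℝ :=
  ∑ r ∈ (Finset.range m ×ˢ Finset.range m ×ˢ Finset.range m ×ˢ Finset.range m ×ˢ
      Finset.range m ×ˢ Finset.range m).filter
      (fun r => r.1 + r.2.1 + r.2.2.1 + r.2.2.2.1 + r.2.2.2.2.1 + r.2.2.2.2.2 = m + 1),
    (((m + 1).factorial : ℝ) /
        ((r.1.factorial : ℝ) * (r.2.1.factorial : ℝ) * (r.2.2.1.factorial : ℝ) *
          (r.2.2.2.1.factorial : ℝ) * (r.2.2.2.2.1.factorial : ℝ) *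
          (r.2.2.2.2.2.factorial : ℝ))) *
      (b r.1 * b r.2.1 * b r.2.2.1 * b r.2.2.2.1 * b r.2.2.2.2.1 * b r.2.2.2.2.2)

lemma sd_liouville {G g : ℂ → ℂ} (hG : ∀ z, HasDerivAt G (g z) z)
    (hb : ∀ z, ‖g z‖ ≤ √‖z‖) (z : ℂ) : g z = 0 := by
  have hGd : Differentiable ℂ G := fun z => (hG z).differentiableAt
  have hg : g = deriv G := by ext z; exact (hG z).deriv.symm
  have hgd : Differentiable ℂ g := by
    rw [hg]
    exact fun z => (hGd.analyticAt z).deriv.differentiableAt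
  have hd : ∀ z, deriv g z = 0 := by
    intro z
    by_contra hne
    have hpos : 0 < ‖deriv g z‖ := norm_pos_iff.2 hne
    set c := ‖deriv g z‖
    have key : ∀ R : ℝ, 0 < R → c ≤ √(‖z‖ + R) / R := by
      intro R hR
      apply Complex.norm_deriv_le_of_forall_mem_sphere_norm_le hR hgd.diffContOnCl
      intro w hw
      refine (hb w).trans (Real.sqrt_le_sqrt ?_)
      have : ‖w - z‖ = R := by simpa [dist_eq_norm] using hw
      calc ‖w‖ = ‖z + (w - z)‖ := by ring_nf
        _ ≤ _ := by rw [← this]; exact norm_add_le _ _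
    have h1 := key (‖z‖ + 4 / c ^ 2 + 1) (by positivity)
    set R := ‖z‖ + 4 / c ^ 2 + 1 with hR
    have hR0 : 0 < R := by positivity
    rw [le_div_iff₀ hR0] at h1
    have h2 : (c * R) ^ 2 ≤ ‖z‖ + R := by
      rw [← Real.sq_sqrt (show 0 ≤ ‖z‖ + R by positivity)]
      gcongr
    have h3 : ‖z‖ + R ≤ 2 * R := by
      have : 0 ≤ 4 / c ^ 2 := by positivity
      linarith
    have h4 : 4 / c ^ 2 < R := by
      have : 0 ≤ ‖z‖ := norm_nonneg _
      linarith
    rw [div_lt_iff₀ (by positivity)] at h4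
    nlinarith
  have := is_const_of_deriv_eq_zero hgd hd z 0
  rw [this]
  simpa using hb 0

abbrev sdUp : Set ℂ := {z : ℂ | 0 ≤ z.im}

lemma sd_liouville_half {F d : ℂ → ℂ} (hF : ∀ z ∈ sdUp, HasDerivWithinAt F (d z) sdUp z)
    (hre : ∀ z : ℂ, z.im = 0 → (F z).re = 0)
    (hb : ∀ z ∈ sdUp, ‖d z‖ ≤ √‖z‖) (z : ℂ) (hz : z ∈ sdUp) : d z = 0 := by
  classical
  set G : ℂ → ℂ := fun z => if 0 ≤ z.im then F z else -star (F (star z)) with hGdef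
  set g : ℂ → ℂ := fun z => if 0 ≤ z.im then d z else -star (d (star z)) with hgdef
  have hpos : ∀ z : ℂ, 0 < z.im → HasDerivAt F (d z) z := fun z hz =>
    (hF z hz.le).hasDerivAt (by
      filter_upwards [(isOpen_lt continuous_const Complex.continuous_im).mem_nhds hz] with w hw
      exact le_of_lt hw)
  have hG : ∀ z, HasDerivAt G (g z) z := by
    intro z
    rcases lt_trichotomy z.im 0 with h | h | h
    · have h1 : HasDerivAt F (d (star z)) (star z) := hpos _ (by simpa using h)
      have h2 := h1.conj_conj.neg
      have h3 : g z = -star (d (star z)) := by simp [hgdef, not_le.2 h]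
      rw [h3]
      have h4 : HasDerivAt (fun z => -star (F (star z))) (-star (d (star z))) z := by
        have e : (starRingEnd ℂ) (star z) = z := by simp
        rw [e] at h2
        exact h2
      apply h4.congr_of_eventuallyEq
      filter_upwards [(isOpen_lt Complex.continuous_im continuous_const).mem_nhds h] with w hw
      simp [hGdef, not_le.2 (show w.im < 0 from hw)]
    · have hzU : z ∈ sdUp := h.ge
      have hzs : star z = z := by
        apply Complex.ext <;> simp [h]
      have hgz : g z = d z := by simp [hgdef, h]
      have hU := hF z hzU
      have him : (d z).re = 0 := by
        have h1 : HasDerivWithinAt (fun t : ℝ => (F (z + t)).re) (d z).re univ 0 := by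
          have h2 : HasDerivWithinAt (fun t : ℝ => F (z + t)) (d z * 1) univ 0 := by
            have h3 : HasDerivWithinAt (fun t : ℝ => z + (t : ℂ)) 1 univ 0 := by
              have := (Complex.ofRealCLM.hasDerivAt (x := (0:ℝ))).const_add z
              exact hasDerivWithinAt_univ.2 (by simpa using this)
            have h5 : HasDerivWithinAt F (d z) sdUp (z + ((0:ℝ):ℂ)) := by simpa using hU
            exact HasDerivWithinAt.comp (𝕜 := ℝ) (𝕜' := ℂ) (h₂ := F) (s' := sdUp)
              (h := fun t : ℝ => z + (t : ℂ)) (0:ℝ) h5 h3 (by intro t _; simp [sdUp, h])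
          rw [mul_one] at h2
          have := Complex.reCLM.hasFDerivAt.comp_hasDerivWithinAt (x := (0:ℝ)) h2
          exact this
        have h2 : (fun t : ℝ => (F (z + t)).re) = fun _ => 0 := by
          ext t; apply hre; simp [h]
        rw [h2, hasDerivWithinAt_univ] at h1
        exact h1.unique (hasDerivAt_const _ _)
      have hst : -star (d z) = d z := by
        apply Complex.ext <;> simp [him]
      have hst0 : -star (F z) = F z := by
        apply Complex.ext <;> simp [hre z h]
      have hA : HasDerivWithinAt G (d z) sdUp z :=
        hU.congr (fun w hw => by simp [hGdef, show 0 ≤ w.im from hw]) (by simp [hGdef, h])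
      have hB : HasDerivWithinAt G (d z) {w : ℂ | w.im ≤ 0} z := by
        have h1 : HasDerivWithinAt (fun w => -star (F (star w))) (-star (d z)) {w : ℂ | w.im ≤ 0} z := by
          rw [hasDerivWithinAt_iff_tendsto] at hU ⊢
          have ht : Tendsto (fun w : ℂ => star w) (𝓝[{w : ℂ | w.im ≤ 0}] z) (𝓝[sdUp] z) := by
            apply tendsto_nhdsWithin_of_tendsto_nhds_of_eventually_within
            · have : Tendsto (fun w : ℂ => star w) (𝓝 z) (𝓝 (star z)) :=
                (continuous_star).tendsto z
              rw [hzs] at this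
              exact this.mono_left nhdsWithin_le_nhds
            · filter_upwards [self_mem_nhdsWithin] with w hw
              simpa [sdUp] using hw
          have := hU.comp ht
          refine this.congr (fun w => ?_)
          simp only [Function.comp]
          have e1 : ‖star w - z‖ = ‖w - z‖ := by
            rw [← norm_star (w - z), star_sub, hzs]
          rw [e1]
          congr 1
          rw [← norm_star, ← norm_neg]
          congr 1
          simp only [star_sub, smul_eq_mul, star_mul', star_star, hzs]
          ring
        rw [hst] at h1
        refine h1.congr (fun w hw => ?_) ?_
        · rcases (show w.im ≤ 0 from hw).lt_or_eq with h' | h'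
          · simp [hGdef, not_le.2 h']
          · have hws : star w = w := by apply Complex.ext <;> simp [h']
            have : -star (F w) = F w := by apply Complex.ext <;> simp [hre w h']
            simp only [hGdef, h', le_refl, if_true, hws, this]
        · simp only [hGdef, h, le_refl, if_true, hzs, hst0]
      rw [hgz, ← hasDerivWithinAt_univ]
      have := hA.union hB
      refine this.mono (fun w _ => ?_)
      exact le_total 0 w.im
    · have hgz : g z = d z := by simp [hgdef, h.le]
      rw [hgz]
      apply (hpos z h).congr_of_eventuallyEq
      filter_upwards [(isOpen_lt continuous_const Complex.continuous_im).mem_nhds h] with w hw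
      simp [hGdef, (show 0 < w.im from hw).le]
  have hgb : ∀ z, ‖g z‖ ≤ √‖z‖ := by
    intro z
    by_cases h : 0 ≤ z.im
    · simpa [hgdef, h] using hb z h
    · have h1 := hb (star z) (by simp [sdUp]; linarith)
      simpa [hgdef, h] using h1
  have := sd_liouville hG hgb z
  simpa [hgdef, show 0 ≤ z.im from hz] using this

def sdL (A B : ℂ) : ℂ →L[ℝ] ℂ := Complex.reCLM.smulRight A + Complex.imCLM.smulRight B

lemma sdL_apply (A B h : ℂ) : sdL A B h = h.re * A + h.im * B := by
  simp [sdL]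

lemma sdL_norm (A B : ℂ) : ‖sdL A B‖ ≤ ‖A‖ + ‖B‖ := by
  apply ContinuousLinearMap.opNorm_le_bound _ (by positivity)
  intro h
  rw [sdL_apply]
  have h1 := Complex.abs_re_le_norm h
  have h2 := Complex.abs_im_le_norm h
  calc ‖(h.re : ℂ) * A + h.im * B‖ ≤ |h.re| * ‖A‖ + |h.im| * ‖B‖ := by
        refine (norm_add_le _ _).trans ?_
        simp
    _ ≤ ‖h‖ * ‖A‖ + ‖h‖ * ‖B‖ := by gcongr
    _ = _ := by ring

lemma sdL_sub (A B A' B' : ℂ) : sdL A B - sdL A' B' = sdL (A - A') (B - B') := by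
  ext <;> simp [sdL_apply] <;> ring

lemma sd_ulim {X : Type*} [PseudoMetricSpace X] [ProperSpace X] (U : Ultrafilter ℕ) (x : ℕ → X)
    (x0 : X) (C : ℝ) (h : ∀ᶠ k in (U : Filter ℕ), dist (x k) x0 ≤ C) :
    ∃ l, Tendsto x U (𝓝 l) := by
  have := (isCompact_closedBall x0 C).ultrafilter_le_nhds (U.map x) (by
    rw [le_principal_iff]; exact h)
  obtain ⟨l, -, hl⟩ := this
  exact ⟨l, hl⟩

lemma sd_key (S : Set ℂ) (hS : S = univ ∨ S = sdUp) (c M : ℝ) (hc : 0 < c) :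
    ∃ R : ℝ, 0 < R ∧ M < R ∧ ∃ ε : ℝ, 0 < ε ∧ ∀ F A B : ℂ → ℂ,
      (∀ z ∈ S, ‖z‖ < R → HasFDerivWithinAt F (sdL (A z) (B z)) S z) →
      F 0 = 0 → A 0 = 0 → B 0 = 0 →
      (∀ z ∈ S, ∀ w ∈ S, ‖z‖ < R → ‖w‖ < R → ‖A z - A w‖ ≤ √‖z - w‖) →
      (∀ z ∈ S, ∀ w ∈ S, ‖z‖ < R → ‖w‖ < R → ‖B z - B w‖ ≤ √‖z - w‖) →
      (∀ z ∈ S, ‖z‖ < R → ‖B z - Complex.I * A z‖ ≤ ε) →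
      (S = sdUp → ∀ z : ℂ, z.im = 0 → ‖z‖ < R → (F z).re = 0) →
      ∀ z ∈ S, ‖z‖ ≤ M → ‖A z‖ ≤ c := by
  have h0S : (0 : ℂ) ∈ S := by rcases hS with h | h <;> simp [h, sdUp]
  have hcS : IsClosed S := by
    rcases hS with h | h
    · rw [h]; exact isClosed_univ
    · rw [h]; exact isClosed_le continuous_const Complex.continuous_im
  have hvS : Convex ℝ S := by
    rcases hS with h | h
    · rw [h]; exact convex_univ
    · rw [h]; exact convex_halfSpace_im_ge 0
  by_contra hcon
  push Not at hcon
  have hk : ∀ k : ℕ, 0 < |M| + k + 1 := fun k => by positivity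
  have hM : ∀ k : ℕ, M < |M| + k + 1 := fun k => by
    have := le_abs_self M
    have : (0:ℝ) ≤ k := by positivity
    linarith
  choose F A B hF hF0 hA0 hB0 hA hB hCR hre z hzS hzM hz using
    fun k : ℕ => hcon (|M| + k + 1) (hk k) (hM k) (1 / (k + 1 : ℝ)) (by positivity)
  let U : Ultrafilter ℕ := hyperfilter ℕ
  have hU : (U : Filter ℕ) ≤ atTop := Nat.hyperfilter_le_atTop
  have hev : ∀ w : ℂ, ∀ᶠ k : ℕ in (U : Filter ℕ), ‖w‖ < |M| + k + 1 := by
    intro w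
    apply hU
    filter_upwards [eventually_ge_atTop ⌈‖w‖⌉₊] with k hk
    have h1 := Nat.ceil_le.1 hk
    have h2 := abs_nonneg M
    linarith
  have htaylor : ∀ k : ℕ, ∀ z ∈ S, ∀ w ∈ S, ‖z‖ < |M| + k + 1 → ‖w‖ < |M| + k + 1 →
      ‖F k w - F k z - sdL (A k z) (B k z) (w - z)‖ ≤ 2 * √‖w - z‖ * ‖w - z‖ := by
    intro k z hz w hw hzk hwk
    set T : Set ℂ := (S ∩ Metric.ball 0 (|M| + k + 1)) ∩ Metric.closedBall z ‖w - z‖ with hT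
    have hTc : Convex ℝ T := (hvS.inter (convex_ball _ _)).inter (convex_closedBall _ _)
    have hzT : z ∈ T := ⟨⟨hz, by simpa using hzk⟩, by simp⟩
    have hwT : w ∈ T := ⟨⟨hw, by simpa using hwk⟩, by simp [dist_eq_norm]⟩
    refine hTc.norm_image_sub_le_of_norm_hasFDerivWithin_le'
      (f' := fun v => sdL (A k v) (B k v)) (fun v hv => ?_) (fun v hv => ?_) hzT hwT
    · exact (hF k v hv.1.1 (by simpa using hv.1.2)).mono (fun _ h => h.1.1)
    · rw [sdL_sub]
      have hvk : ‖v‖ < |M| + k + 1 := by simpa using hv.1.2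
      have h1 := hA k v hv.1.1 z hz hvk hzk
      have h2 := hB k v hv.1.1 z hz hvk hzk
      have h3 : √‖v - z‖ ≤ √‖w - z‖ := Real.sqrt_le_sqrt (by simpa [dist_eq_norm] using hv.2)
      linarith [sdL_norm (A k v - A k z) (B k v - B k z)]
  have hlimA : ∀ w ∈ S, ∃ l, Tendsto (fun k => A k w) U (𝓝 l) := by
    intro w hw
    apply sd_ulim U _ 0 (√‖w‖)
    filter_upwards [hev w] with k hk'
    simpa [hA0 k] using hA k w hw 0 h0S hk' (by simpa using hk k)
  have hlimF : ∀ w ∈ S, ∃ l, Tendsto (fun k => F k w) U (𝓝 l) := by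
    intro w hw
    apply sd_ulim U _ 0 (2 * √‖w‖ * ‖w‖)
    filter_upwards [hev w] with k hk'
    have := htaylor k 0 h0S w hw (by simpa using hk k) hk'
    simpa [hA0 k, hB0 k, hF0 k, sdL_apply] using this
  have hE : ∀ (P : ℂ → ℂ → Prop), (∀ w ∈ S, ∃ l, P w l) → ∃ L : ℂ → ℂ, ∀ w ∈ S, P w (L w) := by
    intro P hP
    choose! L hL using hP
    exact ⟨L, hL⟩
  obtain ⟨d, hd⟩ := hE _ hlimA
  obtain ⟨G, hG⟩ := hE _ hlimF
  have hone : Tendsto (fun k : ℕ => 1 / ((k:ℝ) + 1)) U (𝓝 0) :=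
    (tendsto_one_div_add_atTop_nhds_zero_nat).mono_left hU
  have hdB : ∀ w ∈ S, Tendsto (fun k => B k w) U (𝓝 (Complex.I * d w)) := by
    intro w hw
    have h1 : Tendsto (fun k => B k w - Complex.I * A k w) U (𝓝 0) := by
      apply squeeze_zero_norm' _ hone
      filter_upwards [hev w] with k hk'
      exact hCR k w hw hk'
    have h2 := h1.add ((hd w hw).const_mul Complex.I)
    simpa using h2
  have hTay : ∀ z ∈ S, ∀ w ∈ S, ‖G w - G z - (w - z) * d z‖ ≤ 2 * √‖w - z‖ * ‖w - z‖ := by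
    intro z hz w hw
    have h1 : Tendsto (fun k => ‖F k w - F k z - sdL (A k z) (B k z) (w - z)‖) U
        (𝓝 ‖G w - G z - (w - z) * d z‖) := by
      apply Tendsto.norm
      refine ((hG w hw).sub (hG z hz)).sub ?_
      simp only [sdL_apply]
      have := ((hd z hz).const_mul ((w - z).re : ℂ)).add ((hdB z hz).const_mul ((w - z).im : ℂ))
      convert this using 2
      conv_lhs => rw [← Complex.re_add_im (w - z)]
      ring
    apply le_of_tendsto h1
    filter_upwards [hev w, hev z] with k h2 h3
    exact htaylor k z hz w hw h3 h2
  have hder : ∀ z ∈ S, HasDerivWithinAt G (d z) S z := by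
    intro z hz
    rw [hasDerivWithinAt_iff_isLittleO, Asymptotics.isLittleO_iff]
    intro e he
    have h1 : Tendsto (fun w : ℂ => 2 * √‖w - z‖) (𝓝 z) (𝓝 0) := by
      have : Continuous (fun w : ℂ => 2 * √‖w - z‖) := by fun_prop
      simpa using this.tendsto z
    filter_upwards [self_mem_nhdsWithin, nhdsWithin_le_nhds (h1.eventually (gt_mem_nhds he))]
      with w hw h2
    have h3 := hTay z hz w hw
    rw [smul_eq_mul]
    exact h3.trans (by gcongr)
  have hdb : ∀ w ∈ S, ‖d w‖ ≤ √‖w‖ := by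
    intro w hw
    apply le_of_tendsto (hd w hw).norm
    filter_upwards [hev w] with k hk'
    simpa [hA0 k] using hA k w hw 0 h0S hk' (by simpa using hk k)
  have hd0 : ∀ w ∈ S, d w = 0 := by
    rcases hS with h | h
    · subst h
      intro w _
      exact sd_liouville (fun z => by simpa using hder z (mem_univ z))
        (fun z => hdb z (mem_univ z)) w
    · subst h
      intro w hw
      refine sd_liouville_half hder (fun z hz => ?_) hdb w hw
      have h1 : Tendsto (fun k => (F k z).re) U (𝓝 (G z).re) :=
        (Complex.continuous_re.tendsto _).comp (hG z hz.ge)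
      refine tendsto_nhds_unique h1 (tendsto_const_nhds.congr' ?_)
      filter_upwards [hev z] with k hk'
      exact (hre k rfl z hz hk').symm
  obtain ⟨w, hw⟩ := sd_ulim U z 0 M (Eventually.of_forall fun k => by simpa using hzM k)
  have hwS : w ∈ S := hcS.mem_of_tendsto hw (Eventually.of_forall hzS)
  have h1 : Tendsto (fun k => ‖A k w‖ + √‖z k - w‖) U (𝓝 0) := by
    have ha := (hd w hwS).norm
    rw [hd0 w hwS] at ha
    have hb : Tendsto (fun k => √‖z k - w‖) U (𝓝 0) := by
      have : Tendsto (fun v : ℂ => √‖v - w‖) (𝓝 w) (𝓝 0) := by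
        have : Continuous (fun v : ℂ => √‖v - w‖) := by fun_prop
        simpa using this.tendsto w
      exact this.comp hw
    simpa using ha.add hb
  have h2 : ∀ᶠ k in (U : Filter ℕ), c ≤ ‖A k w‖ + √‖z k - w‖ := by
    filter_upwards [hev w] with k hk'
    have h3 := hA k (z k) (hzS k) w hwS ((hzM k).trans_lt (hM k)) hk'
    have h4 := norm_sub_norm_le (A k (z k)) (A k w)
    linarith [hz k]
  have := ge_of_tendsto h1 h2
  linarith

lemma sd_key' (S : Set ℂ) (hS : S = univ ∨ S = sdUp) (c M : ℝ) (hc : 0 < c) :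
    ∃ R : ℝ, 0 < R ∧ M < R ∧ ∃ ε : ℝ, 0 < ε ∧ ∀ (F A B : ℂ → ℂ) (ρ N : ℝ), 0 < ρ → 0 < N →
      (∀ z ∈ S, ‖z‖ < R * ρ → HasFDerivWithinAt F (sdL (A z) (B z)) S z) →
      (∀ z ∈ S, ∀ w ∈ S, ‖z‖ < R * ρ → ‖w‖ < R * ρ → ‖A z - A w‖ ≤ N * √‖z - w‖) →
      (∀ z ∈ S, ∀ w ∈ S, ‖z‖ < R * ρ → ‖w‖ < R * ρ → ‖B z - B w‖ ≤ N * √‖z - w‖) →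
      (∀ z ∈ S, ‖z‖ < R * ρ → ‖(B z - B 0) - Complex.I * (A z - A 0)‖ ≤ ε * N * √ρ) →
      (S = sdUp → ∀ z : ℂ, z.im = 0 → ‖z‖ < R * ρ → (F z).re = 0) →
      ∀ z ∈ S, ‖z‖ ≤ M * ρ → ‖A z - A 0‖ ≤ c * N * √ρ := by
  obtain ⟨R, hR, hMR, ε, hε, key⟩ := sd_key S hS c M hc
  refine ⟨R, hR, hMR, ε, hε, ?_⟩
  intro F A B ρ N hρ hN hF hA hB hCR hre z hz hzM
  have hsc : ∀ z : ℂ, z ∈ S → (ρ : ℂ) * z ∈ S := by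
    intro z hz
    rcases hS with h | h
    · simp [h]
    · subst h; change 0 ≤ z.im at hz; simp [sdUp]; positivity
  have hnsc : ∀ z : ℂ, ‖(ρ:ℂ) * z‖ = ρ * ‖z‖ := by intro z; simp [abs_of_pos hρ]
  have hnR : ∀ z : ℂ, ‖z‖ < R → ‖(ρ:ℂ) * z‖ < R * ρ := by
    intro z hz; rw [hnsc, mul_comm]; gcongr
  have hsq : 0 < √ρ := Real.sqrt_pos.2 hρ
  have h0S : (0 : ℂ) ∈ S := by rcases hS with h | h <;> simp [h, sdUp]
  set θ : ℝ := 1 / (N * √ρ) with hθ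
  have hθ0 : 0 < θ := by positivity
  have hHol : ∀ X : ℂ → ℂ,
      (∀ z ∈ S, ∀ w ∈ S, ‖z‖ < R * ρ → ‖w‖ < R * ρ → ‖X z - X w‖ ≤ N * √‖z - w‖) →
      ∀ z ∈ S, ∀ w ∈ S, ‖z‖ < R → ‖w‖ < R →
       ‖(θ:ℂ) * (X (ρ * z) - X 0) - θ * (X (ρ * w) - X 0)‖ ≤ √‖z - w‖ := by
    intro X hX z hz w hw hzR hwR
    have h1 := hX _ (hsc z hz) _ (hsc w hw) (hnR z hzR) (hnR w hwR)
    rw [← mul_sub (ρ:ℂ), hnsc, Real.sqrt_mul hρ.le] at h1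
    have : (θ:ℂ) * (X (ρ * z) - X 0) - θ * (X (ρ * w) - X 0) = θ * (X (ρ * z) - X (ρ * w)) := by
      ring
    rw [this, norm_mul, Complex.norm_real, Real.norm_of_nonneg hθ0.le, hθ, one_div,
      inv_mul_le_iff₀ (by positivity)]
    linarith
  have := key (fun z => (θ / ρ : ℝ) * (F (ρ * z) - F 0 - ρ * sdL (A 0) (B 0) z))
    (fun z => θ * (A (ρ * z) - A 0)) (fun z => θ * (B (ρ * z) - B 0)) ?_ ?_ ?_ ?_
    (hHol A hA) (hHol B hB) ?_ ?_ ((ρ⁻¹ : ℝ) * z) ?_ ?_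
  · have e : (ρ:ℂ) * (((ρ⁻¹ : ℝ) : ℂ) * z) = z := by
      rw [← mul_assoc, ← Complex.ofReal_mul, mul_inv_cancel₀ hρ.ne']; simp
    rw [e, norm_mul, Complex.norm_real, Real.norm_of_nonneg hθ0.le, hθ, one_div,
      inv_mul_le_iff₀ (by positivity)] at this
    linarith
  · intro z hz hzR
    have h1 := hF _ (hsc z hz) (hnR z hzR)
    have h2 : HasFDerivWithinAt (fun z : ℂ => (ρ:ℂ) * z) (ρ • ContinuousLinearMap.id ℝ ℂ) S z := by
      have := ((hasFDerivAt_id (𝕜 := ℝ) z).const_smul ρ).hasFDerivWithinAt (s := S)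
      refine (this.congr (fun w _ => ?_) ?_) <;> simp
    have h3 := h1.comp z h2 (fun w hw => hsc w hw)
    have h4 := (((h3.sub_const (F 0)).sub
      (((sdL (A 0) (B 0)).hasFDerivWithinAt (s := S) (x := z)).const_smul ρ))).const_smul (θ / ρ)
    have h5 : (θ / ρ) • ((sdL (A (↑ρ * z)) (B (↑ρ * z))).comp (ρ • ContinuousLinearMap.id ℝ ℂ)
        - ρ • sdL (A 0) (B 0)) = sdL (θ * (A (ρ * z) - A 0)) (θ * (B (ρ * z) - B 0)) := by
      have : ρ ≠ 0 := hρ.ne'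
      have h' : (ρ:ℂ) ≠ 0 := by exact_mod_cast this
      ext h <;> simp [sdL_apply] <;> field_simp <;> ring
    rw [h5] at h4
    refine h4.congr (fun w _ => ?_) ?_ <;> simp
  · simp
  · simp
  · simp
  · intro z hz hzR
    have h1 := hCR _ (hsc z hz) (hnR z hzR)
    have : (θ:ℂ) * (B (ρ * z) - B 0) - Complex.I * (θ * (A (ρ * z) - A 0))
      = θ * ((B (ρ * z) - B 0) - Complex.I * (A (ρ * z) - A 0)) := by ring
    rw [this, norm_mul, Complex.norm_real, Real.norm_of_nonneg hθ0.le, hθ, one_div,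
      inv_mul_le_iff₀ (by positivity)]
    linarith
  · intro hSU z hz hzR
    have h1 : ∀ w : ℂ, w.im = 0 → ‖w‖ < R * ρ → (F w).re = 0 := hre hSU
    have h0 := h1 0 (by simp) (by simp; positivity)
    have h2 := h1 (ρ * z) (by simp [hz]) (hnR z hzR)
    have hA0 : (A 0).re = 0 := by
      have h3 := hF 0 h0S (by simp; positivity)
      have h4 : HasDerivAt (fun t : ℝ => (F (t : ℂ)).re) ((A 0).re) 0 := by
        have h5 : HasDerivWithinAt (fun t : ℝ => (t : ℂ)) 1 univ 0 :=
          hasDerivWithinAt_univ.2 Complex.ofRealCLM.hasDerivAt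
        have h3' : HasFDerivWithinAt F (sdL (A 0) (B 0)) S ((fun t : ℝ => (t : ℂ)) 0) := by
          simpa using h3
        have h6 := h3'.comp_hasDerivWithinAt (0:ℝ) h5 (by
          intro t _; subst hSU; simp [sdUp])
        have h7 := Complex.reCLM.hasFDerivAt.comp_hasDerivWithinAt (x := (0:ℝ)) h6
        rw [hasDerivWithinAt_univ] at h7
        have e : (sdL (A 0) (B 0)) 1 = A 0 := by simp [sdL_apply]
        rw [e] at h7
        exact h7
      have h8 : HasDerivAt (fun t : ℝ => (F (t : ℂ)).re) 0 0 := by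
        apply (hasDerivAt_const (0:ℝ) (0:ℝ)).congr_of_eventuallyEq
        filter_upwards [Metric.ball_mem_nhds (0:ℝ) (show 0 < R * ρ by positivity)] with t ht
        apply h1
        · simp
        · simpa using ht
      exact h4.unique h8
    simp [sdL_apply, h0, h2, hz, hA0]
  · rcases hS with h | h
    · simp [h]
    · subst h; change 0 ≤ z.im at hz; simp [sdUp]; positivity
  · rw [norm_mul, Complex.norm_real, Real.norm_of_nonneg (by positivity), inv_mul_le_iff₀ hρ]
    linarith

lemma sd_closure_int (S : Set ℂ) (hS : S = univ ∨ S = sdUp) :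
    closure (interior S) = S ∧ Convex ℝ S := by
  rcases hS with h | h
  · subst h; simp [convex_univ]
  · have h1 : Convex ℝ S := by rw [h]; exact convex_halfSpace_im_ge 0
    have h2 : IsClosed S := by rw [h]; exact isClosed_le continuous_const Complex.continuous_im
    refine ⟨?_, h1⟩
    have h3 : (interior S).Nonempty := by
      refine ⟨Complex.I, ?_⟩
      rw [mem_interior_iff_mem_nhds]
      filter_upwards [(isOpen_lt continuous_const Complex.continuous_im).mem_nhds
        (show (0:ℝ) < Complex.I.im by simp)] with w hw
      rw [h]; exact le_of_lt hw
    rw [h1.closure_interior_eq_closure_of_nonempty_interior h3, h2.closure_eq]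

lemma sd_extend {X : Type*} [NormedAddCommGroup X] [NormedSpace ℝ X] (S : Set ℂ)
    (hS : S = univ ∨ S = sdUp) {f : ℂ → X} {f' : ℂ → ℂ →L[ℝ] X} {r : ℝ}
    (hd : ∀ z ∈ interior S, ‖z‖ < r → HasFDerivAt f (f' z) z)
    (hc : ContinuousOn f (S ∩ Metric.ball 0 r)) (hc' : ContinuousOn f' (S ∩ Metric.ball 0 r))
    (z : ℂ) (hz : z ∈ S) (hzr : ‖z‖ < r) : HasFDerivWithinAt f (f' z) S z := by
  obtain ⟨hcl, hconv⟩ := sd_closure_int S hS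
  obtain ⟨r1, h1, h2⟩ := exists_between hzr
  set T := interior S ∩ Metric.ball 0 r1 with hT
  have hTr : ∀ w ∈ T, ‖w‖ < r := fun w hw => (by simpa using hw.2 : ‖w‖ < r1).trans h2
  have hTsub : T ⊆ S ∩ Metric.ball 0 r := fun w hw =>
    ⟨interior_subset hw.1, by simpa using hTr w hw⟩
  have hclT : closure T ⊆ S ∩ Metric.ball 0 r := by
    intro w hw
    have ha : w ∈ closure (interior S) := closure_mono inter_subset_left hw
    have hb : w ∈ closure (Metric.ball (0:ℂ) r1) := closure_mono inter_subset_right hw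
    have hb' := Metric.closure_ball_subset_closedBall hb
    rw [hcl] at ha
    refine ⟨ha, ?_⟩
    simp at hb' ⊢
    linarith
  have hzT : z ∈ closure T := by
    have : z ∈ Metric.ball (0:ℂ) r1 ∩ closure (interior S) :=
      ⟨by simpa using h1, by rw [hcl]; exact hz⟩
    have := Metric.isOpen_ball.inter_closure this
    rwa [inter_comm] at this
  have key : HasFDerivWithinAt f (f' z) (closure T) z := by
    apply hasFDerivWithinAt_closure_of_tendsto_fderiv (s := T)
    · intro w hw
      exact (hd w hw.1 (hTr w hw)).differentiableAt.differentiableWithinAt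
    · exact hconv.interior.inter (convex_ball _ _)
    · exact isOpen_interior.inter Metric.isOpen_ball
    · intro w hw
      exact (hc w (hclT hw)).mono hTsub
    · have h3 : Tendsto f' (𝓝[T] z) (𝓝 (f' z)) :=
        (hc' z ⟨hz, by simpa using hzr⟩).mono hTsub
      refine h3.congr' ?_
      filter_upwards [self_mem_nhdsWithin] with w hw
      exact (hd w hw.1 (hTr w hw)).fderiv.symm
  refine key.mono_of_mem_nhdsWithin ?_
  have : Metric.ball (0:ℂ) r1 ∈ 𝓝 z := Metric.isOpen_ball.mem_nhds (by simpa using h1)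
  filter_upwards [self_mem_nhdsWithin, nhdsWithin_le_nhds this] with w hw hw'
  have h4 : w ∈ Metric.ball (0:ℂ) r1 ∩ closure (interior S) := ⟨hw', by rw [hcl]; exact hw⟩
  have := Metric.isOpen_ball.inter_closure h4
  rwa [inter_comm] at this

def HB {X : Type*} [PseudoMetricSpace X] (T : Set X) (g : X → ℝ) (c : ℝ) : Prop :=
  ∃ α β : ℝ, 0 ≤ α ∧ 0 ≤ β ∧ α + β ≤ c ∧ (∀ x ∈ T, |g x| ≤ α) ∧
    ∀ x ∈ T, ∀ y ∈ T, |g x - g y| ≤ β * √(dist x y)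

namespace HB
variable {X : Type*} [PseudoMetricSpace X] {T : Set X} {g h : X → ℝ} {c d : ℝ}

lemma nonneg (hg : HB T g c) : 0 ≤ c := by
  obtain ⟨α, β, h1, h2, h3, -⟩ := hg; linarith

lemma bd (hg : HB T g c) {x : X} (hx : x ∈ T) : |g x| ≤ c := by
  obtain ⟨α, β, h1, h2, h3, h4, -⟩ := hg; linarith [h4 x hx]

lemma hol (hg : HB T g c) {x y : X} (hx : x ∈ T) (hy : y ∈ T) :
    |g x - g y| ≤ c * √(dist x y) := by
  obtain ⟨α, β, h1, h2, h3, -, h5⟩ := hg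
  exact (h5 x hx y hy).trans (by gcongr; linarith)

lemma mono (hg : HB T g c) (hcd : c ≤ d) : HB T g d := by
  obtain ⟨α, β, h1, h2, h3, h4, h5⟩ := hg
  exact ⟨α, β, h1, h2, h3.trans hcd, h4, h5⟩

lemma subset {T' : Set X} (hg : HB T g c) (hT : T' ⊆ T) : HB T' g c := by
  obtain ⟨α, β, h1, h2, h3, h4, h5⟩ := hg
  exact ⟨α, β, h1, h2, h3, fun x hx => h4 x (hT hx), fun x hx y hy => h5 x (hT hx) y (hT hy)⟩

lemma congr (hg : HB T g c) (he : ∀ x ∈ T, h x = g x) : HB T h c := by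
  obtain ⟨α, β, h1, h2, h3, h4, h5⟩ := hg
  refine ⟨α, β, h1, h2, h3, fun x hx => ?_, fun x hx y hy => ?_⟩
  · rw [he x hx]; exact h4 x hx
  · rw [he x hx, he y hy]; exact h5 x hx y hy

lemma of_bounds (h0 : 0 ≤ c) (h1 : ∀ x ∈ T, |g x| ≤ c)
    (hd : 0 ≤ d) (h2 : ∀ x ∈ T, ∀ y ∈ T, |g x - g y| ≤ d * √(dist x y)) : HB T g (c + d) :=
  ⟨c, d, h0, hd, le_refl _, h1, h2⟩

lemma const (a : ℝ) : HB T (fun _ => a) |a| :=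
  ⟨|a|, 0, abs_nonneg _, le_refl _, by simp, fun _ _ => le_refl _, fun _ _ _ _ => by simp⟩

lemma add (hg : HB T g c) (hh : HB T h d) : HB T (fun x => g x + h x) (c + d) := by
  obtain ⟨α, β, h1, h2, h3, h4, h5⟩ := hg
  obtain ⟨α', β', h1', h2', h3', h4', h5'⟩ := hh
  refine ⟨α + α', β + β', by linarith, by linarith, by linarith, fun x hx => ?_,
    fun x hx y hy => ?_⟩
  · exact (abs_add_le _ _).trans (add_le_add (h4 x hx) (h4' x hx))
  · have : g x + h x - (g y + h y) = (g x - g y) + (h x - h y) := by ring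
    rw [this, add_mul]
    exact (abs_add_le _ _).trans (add_le_add (h5 x hx y hy) (h5' x hx y hy))

lemma neg (hg : HB T g c) : HB T (fun x => -g x) c := by
  obtain ⟨α, β, h1, h2, h3, h4, h5⟩ := hg
  refine ⟨α, β, h1, h2, h3, fun x hx => by simpa using h4 x hx, fun x hx y hy => ?_⟩
  have : -g x - -g y = -(g x - g y) := by ring
  rw [this, abs_neg]; exact h5 x hx y hy

lemma sub (hg : HB T g c) (hh : HB T h d) : HB T (fun x => g x - h x) (c + d) := by
  simpa [sub_eq_add_neg] using hg.add hh.neg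

lemma mul (hg : HB T g c) (hh : HB T h d) : HB T (fun x => g x * h x) (c * d) := by
  obtain ⟨α, β, h1, h2, h3, h4, h5⟩ := hg
  obtain ⟨α', β', h1', h2', h3', h4', h5'⟩ := hh
  refine ⟨α * α', α * β' + β * α', by positivity, by positivity, ?_, fun x hx => ?_,
    fun x hx y hy => ?_⟩
  · calc α * α' + (α * β' + β * α') ≤ (α + β) * (α' + β') := by nlinarith [mul_nonneg h2 h2']
      _ ≤ c * d := by gcongr; linarith
  · rw [abs_mul]; exact mul_le_mul (h4 x hx) (h4' x hx) (abs_nonneg _) h1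
  · have : g x * h x - g y * h y = g x * (h x - h y) + (g x - g y) * h y := by ring
    rw [this]
    refine (abs_add_le _ _).trans ?_
    rw [abs_mul, abs_mul]
    calc _ ≤ α * (β' * √(dist x y)) + (β * √(dist x y)) * α' := by
          gcongr
          · exact h4 x hx
          · exact h5' x hx y hy
          · exact h5 x hx y hy
          · exact h4' y hy
      _ = _ := by ring

lemma comp {Y : Type*} [PseudoMetricSpace Y] {T' : Set Y} {Ψ : Y → X} {L : ℝ} (hg : HB T g c)
    (hT : ∀ y ∈ T', Ψ y ∈ T) (hL : 1 ≤ L)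
    (hΨ : ∀ y ∈ T', ∀ y' ∈ T', dist (Ψ y) (Ψ y') ≤ L * dist y y') :
    HB T' (fun y => g (Ψ y)) (L * c) := by
  obtain ⟨α, β, h1, h2, h3, h4, h5⟩ := hg
  refine ⟨α, L * β, h1, by positivity, ?_, fun x hx => h4 _ (hT x hx), fun x hx y hy => ?_⟩
  · nlinarith
  · refine (h5 _ (hT x hx) _ (hT y hy)).trans ?_
    have : √(dist (Ψ x) (Ψ y)) ≤ L * √(dist x y) := by
      rw [Real.sqrt_le_left (by positivity), mul_pow, Real.sq_sqrt dist_nonneg]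
      refine (hΨ x hx y hy).trans ?_
      gcongr
      nlinarith
    calc _ ≤ β * (L * √(dist x y)) := by gcongr
      _ = _ := by ring

lemma cont (hg : HB T g c) : ContinuousOn g T := by
  intro x hx
  rw [ContinuousWithinAt, tendsto_iff_dist_tendsto_zero]
  have h1 : Tendsto (fun y => c * √(dist y x)) (𝓝[T] x) (𝓝 0) := by
    have : Continuous (fun y => c * √(dist y x)) := by fun_prop
    simpa using (this.tendsto x).mono_left nhdsWithin_le_nhds
  refine squeeze_zero' (Eventually.of_forall fun _ => dist_nonneg) ?_ h1
  filter_upwards [self_mem_nhdsWithin] with y hy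
  exact hg.hol hy hx

lemma sum {ι : Type*} (s : Finset ι) {g : ι → X → ℝ} {c : ι → ℝ}
    (hg : ∀ i ∈ s, HB T (g i) (c i)) : HB T (fun x => ∑ i ∈ s, g i x) (∑ i ∈ s, c i) := by
  classical
  induction s using Finset.induction_on with
  | empty => simpa using HB.const (T := T) 0
  | insert a s ha ih =>
    simp only [Finset.sum_insert ha]
    exact (hg a (by simp)).add (ih fun i hi => hg i (by simp [hi]))
end HB

def sdR (X Y : ℝ) : ℂ →L[ℝ] ℝ := X • Complex.reCLM + Y • Complex.imCLM
lemma sdR_apply (X Y : ℝ) (h : ℂ) : sdR X Y h = X * h.re + Y * h.im := by simp [sdR]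

def sdE (r s : ℝ) : ℝ × ℝ →L[ℝ] ℝ :=
  r • ContinuousLinearMap.fst ℝ ℝ ℝ + s • ContinuousLinearMap.snd ℝ ℝ ℝ
lemma sdE_apply (r s : ℝ) (h : ℝ × ℝ) : sdE r s h = r * h.1 + s * h.2 := by simp [sdE]

structure SDat (Ω : Set (ℝ × ℝ)) (u p q r s t : ℝ × ℝ → ℝ) : Prop where
  cu : ContinuousOn u (closure Ω)
  cp : ContinuousOn p (closure Ω)
  cq : ContinuousOn q (closure Ω)
  cr : ContinuousOn r (closure Ω)
  cs : ContinuousOn s (closure Ω)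
  ct : ContinuousOn t (closure Ω)
  du : ∀ x ∈ Ω, HasFDerivAt u (sdE (p x) (q x)) x
  dp : ∀ x ∈ Ω, HasFDerivAt p (sdE (r x) (s x)) x
  dq : ∀ x ∈ Ω, HasFDerivAt q (sdE (s x) (t x)) x
  bu : ∀ x ∈ frontier Ω, u x = 0

structure SCoef (Ω : Set (ℝ × ℝ)) (a b c b1 b2 : ℝ × ℝ → ℝ) (Λ : ℝ) : Prop where
  ha : HB (closure Ω) a Λ
  hb : HB (closure Ω) b Λ
  hc : HB (closure Ω) c Λ
  hb1 : HB (closure Ω) b1 Λ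
  hb2 : HB (closure Ω) b2 Λ
  ell : ∀ x ∈ closure Ω, ∀ v w : ℝ, v ^ 2 + w ^ 2 ≤ a x * v ^ 2 + 2 * b x * v * w + c x * w ^ 2
  det : ∀ x ∈ closure Ω, 1 ≤ a x * c x - b x ^ 2

structure SBd (Ω : Set (ℝ × ℝ)) (p q r s t g : ℝ × ℝ → ℝ) (B H G : ℝ) : Prop where
  B0 : 0 < B
  H0 : 0 ≤ H
  hp : HB (closure Ω) p B
  hq : HB (closure Ω) q B
  br : ∀ x ∈ closure Ω, |r x| ≤ B
  bs : ∀ x ∈ closure Ω, |s x| ≤ B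
  bt : ∀ x ∈ closure Ω, |t x| ≤ B
  hr : ∀ x ∈ closure Ω, ∀ y ∈ closure Ω, |r x - r y| ≤ H * √(dist x y)
  hs : ∀ x ∈ closure Ω, ∀ y ∈ closure Ω, |s x - s y| ≤ H * √(dist x y)
  ht : ∀ x ∈ closure Ω, ∀ y ∈ closure Ω, |t x - t y| ≤ H * √(dist x y)
  hg : HB (closure Ω) g G

def sdPsi (γ : ℝ → ℝ × ℝ) (n : ℝ × ℝ) (β κ : ℝ) (z : ℂ) : ℝ × ℝ :=
  γ (z.re + β * z.im) + (κ * z.im) • n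

lemma sd_lin (β : ℝ) (z : ℂ) : HasFDerivAt (fun z : ℂ => z.re + β * z.im) (sdR 1 β) z := by
  have := (sdR 1 β).hasFDerivAt (x := z)
  refine this.congr_of_eventuallyEq (Eventually.of_forall fun w => ?_)
  simp [sdR_apply]

lemma sd_curve_comp {c : ℝ → ℝ} {c' : ℝ} {β : ℝ} {z : ℂ}
    (hc : HasDerivAt c c' (z.re + β * z.im)) :
    HasFDerivAt (fun z : ℂ => c (z.re + β * z.im)) (sdR c' (β * c')) z := by
  have h1 : HasFDerivAt (fun z : ℂ => c (z.re + β * z.im)) _ z :=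
    HasFDerivAt.comp z hc.hasFDerivAt (sd_lin β z)
  refine h1.congr_fderiv ?_
  ext <;> simp [sdR_apply]; ring

def sdBil (r s t v1 v2 w1 w2 : ℝ) : ℝ := r * v1 * w1 + s * (v1 * w2 + v2 * w1) + t * v2 * w2

lemma sdBil_HB {X : Type*} [PseudoMetricSpace X] {T : Set X} {r s t v1 v2 w1 w2 : X → ℝ}
    {c d e : ℝ} (hr : HB T r c) (hs : HB T s c) (ht : HB T t c) (h1 : HB T v1 d)
    (h2 : HB T v2 d) (h3 : HB T w1 e) (h4 : HB T w2 e) :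
    HB T (fun x => sdBil (r x) (s x) (t x) (v1 x) (v2 x) (w1 x) (w2 x)) (4 * c * d * e) := by
  have := (((hr.mul h1).mul h3).add (hs.mul ((h1.mul h4).add (h2.mul h3)))).add
    ((ht.mul h2).mul h4)
  exact this.mono (le_of_eq (by ring))

lemma sdBil_abs {r s t v1 v2 w1 w2 c d e : ℝ} (hr : |r| ≤ c) (hs : |s| ≤ c) (ht : |t| ≤ c)
    (h1 : |v1| ≤ d) (h2 : |v2| ≤ d) (h3 : |w1| ≤ e) (h4 : |w2| ≤ e) :
    |sdBil r s t v1 v2 w1 w2| ≤ 4 * c * d * e := by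
  have hc : 0 ≤ c := (abs_nonneg _).trans hr
  have hd : 0 ≤ d := (abs_nonneg _).trans h1
  have aux : ∀ x y z : ℝ, |x| ≤ c → |y| ≤ d → |z| ≤ e → |x * y * z| ≤ c * d * e := by
    intro x y z hx hy hz
    rw [abs_mul, abs_mul]
    gcongr
  have e1 := aux r v1 w1 hr h1 h3
  have e2 := aux s v1 w2 hs h1 h4
  have e3 := aux s v2 w1 hs h2 h3
  have e4 := aux t v2 w2 ht h2 h4
  unfold sdBil
  rw [abs_le] at *
  constructor <;> nlinarith

lemma sd_cplx {S : Set ℂ} {P Q : ℂ → ℝ} {a b c d : ℝ} {z : ℂ}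
    (hP : HasFDerivWithinAt P (sdR a b) S z) (hQ : HasFDerivWithinAt Q (sdR c d) S z) :
    HasFDerivWithinAt (fun z => (P z : ℂ) - Complex.I * (Q z : ℂ))
      (sdL ((a : ℂ) - Complex.I * c) ((b : ℂ) - Complex.I * d)) S z := by
  have h1 := (Complex.ofRealCLM.hasFDerivAt (x := P z)).comp_hasFDerivWithinAt z hP
  have h2 := (Complex.ofRealCLM.hasFDerivAt (x := Q z)).comp_hasFDerivWithinAt z hQ
  have h3 := h1.sub (h2.const_mul Complex.I)
  refine h3.congr_fderiv ?_
  ext <;> simp [sdR_apply, sdL_apply]; ring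

lemma sdR_cont {T : Set ℂ} {a b : ℂ → ℝ} (ha : ContinuousOn a T) (hb : ContinuousOn b T) :
    ContinuousOn (fun z => sdR (a z) (b z)) T := by
  unfold sdR
  exact (ha.smul continuousOn_const).add (hb.smul continuousOn_const)

lemma sd_c1 {T : Set ℂ} {p q v w : ℂ → ℝ} (h1 : ContinuousOn p T) (h2 : ContinuousOn q T)
    (h3 : ContinuousOn v T) (h4 : ContinuousOn w T) :
    ContinuousOn (fun z => p z * v z + q z * w z) T := by fun_prop

lemma sdBil_cont {T : Set ℂ} {r s t v1 v2 w1 w2 : ℂ → ℝ} (hr : ContinuousOn r T)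
    (hs : ContinuousOn s T) (ht : ContinuousOn t T) (h1 : ContinuousOn v1 T)
    (h2 : ContinuousOn v2 T) (h3 : ContinuousOn w1 T) (h4 : ContinuousOn w2 T) :
    ContinuousOn (fun x => sdBil (r x) (s x) (t x) (v1 x) (v2 x) (w1 x) (w2 x)) T := by
  unfold sdBil; fun_prop

structure SFr (Ω : Set (ℝ × ℝ)) (S : Set ℂ) (Ψ : ℂ → ℝ × ℝ) (v1 v2 k1 k2 : ℂ → ℝ)
    (β m1 m2 E R : ℝ) : Prop where
  E1 : 1 ≤ E
  dΨ : ∀ z ∈ S, ‖z‖ < R → HasFDerivAt Ψ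
    ((sdR (v1 z) (β * v1 z + m1)).prod (sdR (v2 z) (β * v2 z + m2))) z
  dv1 : ∀ z ∈ S, ‖z‖ < R → HasFDerivAt v1 (sdR (k1 z) (β * k1 z)) z
  dv2 : ∀ z ∈ S, ‖z‖ < R → HasFDerivAt v2 (sdR (k2 z) (β * k2 z)) z
  hv1 : HB (S ∩ Metric.ball 0 R) v1 E
  hv2 : HB (S ∩ Metric.ball 0 R) v2 E
  hk1 : HB (S ∩ Metric.ball 0 R) k1 E
  hk2 : HB (S ∩ Metric.ball 0 R) k2 E
  hβ : |β| ≤ E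
  hm1 : |m1| ≤ E
  hm2 : |m2| ≤ E
  he1 : |β * v1 0 + m1| ≤ E
  he2 : |β * v2 0 + m2| ≤ E
  hL : ∀ z ∈ S ∩ Metric.ball 0 R, ∀ w ∈ S ∩ Metric.ball 0 R, dist (Ψ z) (Ψ w) ≤ E * dist z w
  mc : ∀ z ∈ S ∩ Metric.ball 0 R, Ψ z ∈ closure Ω
  mi : ∀ z ∈ interior S ∩ Metric.ball 0 R, Ψ z ∈ Ω
  mf : S = sdUp → ∀ z : ℂ, z.im = 0 → ‖z‖ < R → Ψ z ∈ frontier Ω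

section
variable {Ω : Set (ℝ × ℝ)} {S : Set ℂ} {Ψ : ℂ → ℝ × ℝ} {v1 v2 k1 k2 : ℂ → ℝ}
    {β m1 m2 E R : ℝ} {u p q r s t : ℝ × ℝ → ℝ}

lemma sd_fr_comp (hF : SFr Ω S Ψ v1 v2 k1 k2 β m1 m2 E R) {f : ℝ × ℝ → ℝ} {a b : ℝ} {z : ℂ}
    (hz : z ∈ S) (hzR : ‖z‖ < R) (hf : HasFDerivAt f (sdE a b) (Ψ z)) :
    HasFDerivAt (fun z => f (Ψ z))
      (sdR (a * v1 z + b * v2 z) (a * (β * v1 z + m1) + b * (β * v2 z + m2))) z := by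
  have h3 := hf.comp z (hF.dΨ z hz hzR)
  refine h3.congr_fderiv ?_
  ext <;> simp [sdR_apply, sdE_apply]; ring

lemma sd_fr_cont (hF : SFr Ω S Ψ v1 v2 k1 k2 β m1 m2 E R) {f : ℝ × ℝ → ℝ}
    (hf : ContinuousOn f (closure Ω)) :
    ContinuousOn (fun z => f (Ψ z)) (S ∩ Metric.ball 0 R) := by
  have : ContinuousOn Ψ (S ∩ Metric.ball 0 R) := fun z hz =>
    (hF.dΨ z hz.1 (by simpa using hz.2)).continuousAt.continuousWithinAt
  exact hf.comp this hF.mc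

lemma sd_fr_der (hS : S = univ ∨ S = sdUp) (hF : SFr Ω S Ψ v1 v2 k1 k2 β m1 m2 E R)
    (hu : SDat Ω u p q r s t) (z : ℂ) (hz : z ∈ S) (hzR : ‖z‖ < R) :
    HasFDerivWithinAt (fun z => ((p (Ψ z) * v1 z + q (Ψ z) * v2 z : ℝ) : ℂ) - Complex.I *
      ((p (Ψ z) * (β * v1 0 + m1) + q (Ψ z) * (β * v2 0 + m2) : ℝ) : ℂ))
      (sdL (((sdBil (r (Ψ z)) (s (Ψ z)) (t (Ψ z)) (v1 z) (v2 z) (v1 z) (v2 z) +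
              (p (Ψ z) * k1 z + q (Ψ z) * k2 z) : ℝ) : ℂ) - Complex.I *
            ((sdBil (r (Ψ z)) (s (Ψ z)) (t (Ψ z)) (v1 z) (v2 z)
              (β * v1 0 + m1) (β * v2 0 + m2) : ℝ) : ℂ))
           (((sdBil (r (Ψ z)) (s (Ψ z)) (t (Ψ z)) (β * v1 z + m1) (β * v2 z + m2) (v1 z) (v2 z) +
              β * (p (Ψ z) * k1 z + q (Ψ z) * k2 z) : ℝ) : ℂ) - Complex.I *
            ((sdBil (r (Ψ z)) (s (Ψ z)) (t (Ψ z)) (β * v1 z + m1) (β * v2 z + m2)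
              (β * v1 0 + m1) (β * v2 0 + m2) : ℝ) : ℂ))) S z := by
  have cp := sd_fr_cont hF hu.cp
  have cq := sd_fr_cont hF hu.cq
  have cr := sd_fr_cont hF hu.cr
  have cs := sd_fr_cont hF hu.cs
  have ct := sd_fr_cont hF hu.ct
  have c1 := hF.hv1.cont
  have c2 := hF.hv2.cont
  have c3 := hF.hk1.cont
  have c4 := hF.hk2.cont
  have d1 : ContinuousOn (fun z => β * v1 z + m1) (S ∩ Metric.ball 0 R) := by fun_prop
  have d2 : ContinuousOn (fun z => β * v2 z + m2) (S ∩ Metric.ball 0 R) := by fun_prop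
  have f1 : ContinuousOn (fun _ : ℂ => β * v1 0 + m1) (S ∩ Metric.ball 0 R) := continuousOn_const
  have f2 : ContinuousOn (fun _ : ℂ => β * v2 0 + m2) (S ∩ Metric.ball 0 R) := continuousOn_const
  apply sd_cplx
  · refine sd_extend S hS (f' := fun z => sdR (sdBil (r (Ψ z)) (s (Ψ z)) (t (Ψ z)) (v1 z) (v2 z)
        (v1 z) (v2 z) + (p (Ψ z) * k1 z + q (Ψ z) * k2 z)) (sdBil (r (Ψ z)) (s (Ψ z)) (t (Ψ z))
        (β * v1 z + m1) (β * v2 z + m2) (v1 z) (v2 z) +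
              β * (p (Ψ z) * k1 z + q (Ψ z) * k2 z))) ?_ ?_ ?_ z hz hzR
    · intro w hw hwR
      have hwS := interior_subset hw
      have hΩ := hF.mi w ⟨hw, by simpa using hwR⟩
      have h1 := (sd_fr_comp hF hwS hwR (hu.dp _ hΩ)).mul (hF.dv1 w hwS hwR)
      have h2 := (sd_fr_comp hF hwS hwR (hu.dq _ hΩ)).mul (hF.dv2 w hwS hwR)
      refine (h1.add h2).congr_fderiv ?_
      ext <;> simp [sdR_apply, sdBil]; ring
    · exact sd_c1 cp cq c1 c2
    · apply sdR_cont
      · exact (sdBil_cont cr cs ct c1 c2 c1 c2).add (sd_c1 cp cq c3 c4)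
      · exact (sdBil_cont cr cs ct d1 d2 c1 c2).add (continuousOn_const.mul (sd_c1 cp cq c3 c4))
  · refine sd_extend S hS (f' := fun z => sdR (sdBil (r (Ψ z)) (s (Ψ z)) (t (Ψ z)) (v1 z) (v2 z)
        (β * v1 0 + m1) (β * v2 0 + m2)) (sdBil (r (Ψ z)) (s (Ψ z)) (t (Ψ z))
        (β * v1 z + m1) (β * v2 z + m2) (β * v1 0 + m1) (β * v2 0 + m2))) ?_ ?_ ?_ z hz hzR
    · intro w hw hwR
      have hwS := interior_subset hw
      have hΩ := hF.mi w ⟨hw, by simpa using hwR⟩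
      have h1 := (sd_fr_comp hF hwS hwR (hu.dp _ hΩ)).mul_const (β * v1 0 + m1)
      have h2 := (sd_fr_comp hF hwS hwR (hu.dq _ hΩ)).mul_const (β * v2 0 + m2)
      refine (h1.add h2).congr_fderiv ?_
      ext <;> simp [sdR_apply, sdBil]; ring
    · exact sd_c1 cp cq f1 f2
    · apply sdR_cont
      · exact sdBil_cont cr cs ct c1 c2 f1 f2
      · exact sdBil_cont cr cs ct d1 d2 f1 f2

lemma sd_fr_axis (hF : SFr Ω S Ψ v1 v2 k1 k2 β m1 m2 E R)
    (hu : SDat Ω u p q r s t) (hS : S = sdUp) (z : ℂ) (hz : z.im = 0) (hzR : ‖z‖ < R) :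
    p (Ψ z) * v1 z + q (Ψ z) * v2 z = 0 := by
  have cp := sd_fr_cont hF hu.cp
  have cq := sd_fr_cont hF hu.cq
  have c1 := hF.hv1.cont
  have c2 := hF.hv2.cont
  have hzS : z ∈ S := by rw [hS]; exact hz.ge
  have key : HasFDerivWithinAt (fun z => u (Ψ z)) (sdR (p (Ψ z) * v1 z + q (Ψ z) * v2 z)
      (p (Ψ z) * (β * v1 z + m1) + q (Ψ z) * (β * v2 z + m2))) S z := by
    refine sd_extend S (Or.inr hS) (f' := fun z => sdR (p (Ψ z) * v1 z + q (Ψ z) * v2 z)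
      (p (Ψ z) * (β * v1 z + m1) + q (Ψ z) * (β * v2 z + m2))) ?_ (sd_fr_cont hF hu.cu) ?_
      z hzS hzR
    · intro w hw hwR
      exact sd_fr_comp hF (interior_subset hw) hwR
        (hu.du _ (hF.mi w ⟨hw, by simpa using hwR⟩))
    · apply sdR_cont
      · exact sd_c1 cp cq c1 c2
      · exact sd_c1 (v := fun z => β * v1 z + m1) (w := fun z => β * v2 z + m2) cp cq
          (by fun_prop) (by fun_prop)
  have hline : HasDerivWithinAt (fun x : ℝ => (x : ℂ)) 1 univ z.re :=
    (Complex.ofRealCLM.hasDerivAt (x := z.re)).hasDerivWithinAt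
  have hze : z = ((z.re : ℝ) : ℂ) := by apply Complex.ext <;> simp [hz]
  rw [hze] at key
  have h2 := key.comp_hasDerivWithinAt z.re hline (fun x _ => by rw [hS]; simp [sdUp])
  rw [hasDerivWithinAt_univ] at h2
  have h3 : HasDerivAt (fun x : ℝ => u (Ψ (x : ℂ))) 0 z.re := by
    refine (hasDerivAt_const z.re (0:ℝ)).congr_of_eventuallyEq ?_
    have : ∀ᶠ x : ℝ in 𝓝 z.re, ‖((x : ℝ) : ℂ)‖ < R := by
      have hc : Continuous (fun x : ℝ => ‖((x : ℝ) : ℂ)‖) := by fun_prop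
      exact hc.continuousAt.eventually_lt continuousAt_const (by rw [← hze]; exact hzR)
    filter_upwards [this] with x hx
    exact hu.bu _ (hF.mf hS _ (by simp) hx)
  have h4 := h2.unique h3
  rw [← hze] at h4
  simpa [sdR_apply] using h4
end

section
variable {Ω : Set (ℝ × ℝ)} {S : Set ℂ} {Ψ : ℂ → ℝ × ℝ} {v1 v2 k1 k2 : ℂ → ℝ}
    {β m1 m2 E R : ℝ} {u p q r s t a b c b1 b2 g : ℝ × ℝ → ℝ} {B H G μ : ℝ}

set_option maxHeartbeats 1000000 in
lemma sd_fr_est (hF : SFr Ω S Ψ v1 v2 k1 k2 β m1 m2 E R)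
    (hC : SCoef Ω a b c b1 b2 E) (hB : SBd Ω p q r s t g B H G)
    (hg : ∀ x ∈ closure Ω, g x = a x * r x + 2 * b x * s x + c x * t x + b1 x * p x + b2 x * q x)
    (hμ : |μ| ≤ E) (e21 e22 : ℝ) (he21 : e21 = β * v1 0 + m1) (he22 : e22 = β * v2 0 + m2)
    (hf1 : v1 0 ^ 2 + e21 ^ 2 = μ * a (Ψ 0)) (hf2 : v1 0 * v2 0 + e21 * e22 = μ * b (Ψ 0))
    (hf3 : v2 0 ^ 2 + e22 ^ 2 = μ * c (Ψ 0)) (h0 : (0:ℂ) ∈ S ∩ Metric.ball 0 R)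
    (z : ℂ) (hz : z ∈ S ∩ Metric.ball 0 R) (rz sz tz r0 s0 t0 D D0 W : ℝ)
    (hrz : rz = r (Ψ z)) (hsz : sz = s (Ψ z)) (htz : tz = t (Ψ z))
    (hr0 : r0 = r (Ψ 0)) (hs0 : s0 = s (Ψ 0)) (ht0 : t0 = t (Ψ 0))
    (hD : D = p (Ψ z) * k1 z + q (Ψ z) * k2 z) (hD0 : D0 = p (Ψ 0) * k1 0 + q (Ψ 0) * k2 0)
    (hW : W = 20 * E ^ 4 * (B + G) * √‖z‖) :
    |(sdBil rz sz tz (β * v1 z + m1) (β * v2 z + m2) (v1 z) (v2 z) + β * D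
        - sdBil rz sz tz (v1 z) (v2 z) e21 e22)
      - (sdBil r0 s0 t0 e21 e22 (v1 0) (v2 0) + β * D0
        - sdBil r0 s0 t0 (v1 0) (v2 0) e21 e22)| ≤ W ∧
    |(sdBil rz sz tz (β * v1 z + m1) (β * v2 z + m2) e21 e22 +
        (sdBil rz sz tz (v1 z) (v2 z) (v1 z) (v2 z) + D))
      - (sdBil r0 s0 t0 e21 e22 e21 e22 +
        (sdBil r0 s0 t0 (v1 0) (v2 0) (v1 0) (v2 0) + D0))| ≤ W ∧
    |(sdBil rz sz tz (v1 0) (v2 0) (v1 0) (v2 0) - sdBil r0 s0 t0 (v1 0) (v2 0) (v1 0) (v2 0))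
      - ((sdBil rz sz tz (v1 z) (v2 z) (v1 z) (v2 z) + D)
        - (sdBil r0 s0 t0 (v1 0) (v2 0) (v1 0) (v2 0) + D0))| ≤ W ∧
    |(sdBil rz sz tz (v1 0) (v2 0) e21 e22 - sdBil r0 s0 t0 (v1 0) (v2 0) e21 e22)
      - (sdBil rz sz tz (v1 z) (v2 z) e21 e22 - sdBil r0 s0 t0 (v1 0) (v2 0) e21 e22)| ≤ W ∧
    |(sdBil rz sz tz (v1 0) (v2 0) (v1 0) (v2 0) + sdBil rz sz tz e21 e22 e21 e22)
      - (sdBil r0 s0 t0 (v1 0) (v2 0) (v1 0) (v2 0) + sdBil r0 s0 t0 e21 e22 e21 e22)| ≤ W := by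
  have E1 := hF.E1
  have E0 : 0 ≤ E := by linarith
  have B0 := hB.B0.le
  have G0 := hB.hg.nonneg
  have hcz := hF.mc z hz
  have hc0 := hF.mc 0 h0
  set ω := √‖z‖ with hω
  have ω0 : 0 ≤ ω := Real.sqrt_nonneg _
  have hdist : √(dist z 0) = ω := by rw [dist_zero_right]
  have pull : ∀ {f : ℝ × ℝ → ℝ} {k : ℝ}, HB (closure Ω) f k →
      HB (S ∩ Metric.ball 0 R) (fun z => f (Ψ z)) (E * k) := fun hf => hf.comp hF.mc E1 hF.hL
  have hd1 : |v1 z - v1 0| ≤ E * ω := by rw [← hdist]; exact hF.hv1.hol hz h0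
  have hd2 : |v2 z - v2 0| ≤ E * ω := by rw [← hdist]; exact hF.hv2.hol hz h0
  have hDD : |D - D0| ≤ 2 * E ^ 2 * B * ω := by
    rw [hD, hD0]
    refine ((((pull hB.hp).mul hF.hk1).add ((pull hB.hq).mul hF.hk2)).hol hz h0).trans ?_
    rw [hdist]
    exact le_of_eq (by ring)
  have hbr : |rz| ≤ B := by rw [hrz]; exact hB.br _ hcz
  have hbs : |sz| ≤ B := by rw [hsz]; exact hB.bs _ hcz
  have hbt : |tz| ≤ B := by rw [htz]; exact hB.bt _ hcz
  have hv1 := hF.hv1.bd hz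
  have hv2 := hF.hv2.bd hz
  have hv10 := hF.hv1.bd h0
  have hv20 := hF.hv2.bd h0
  have he1 := hF.he1
  have he2 := hF.he2
  rw [← he21] at he1
  rw [← he22] at he2
  have hE : ∀ j k : ℕ, j ≤ k → E ^ j ≤ E ^ k := fun j k h => pow_le_pow_right₀ E1 h
  have x2 := sdBil_abs hbr hbs hbt hd1 hd2 hv1 hv2
  have x1 := sdBil_abs hbr hbs hbt hd1 hd2 hv10 hv20
  have x3 := sdBil_abs hbr hbs hbt hd1 hd2 he1 he2
  have tr : |(sdBil rz sz tz (v1 0) (v2 0) (v1 0) (v2 0) + sdBil rz sz tz e21 e22 e21 e22)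
      - (sdBil r0 s0 t0 (v1 0) (v2 0) (v1 0) (v2 0) + sdBil r0 s0 t0 e21 e22 e21 e22)|
      ≤ E * ((E * G + 2 * E ^ 3 * B) * ω + 4 * E ^ 2 * B * ω) := by
    have i1 := (((pull hB.hg).sub ((pull hC.hb1).mul (pull hB.hp))).sub
      ((pull hC.hb2).mul (pull hB.hq))).hol hz h0
    rw [hdist] at i1
    have ja := (pull hC.ha).hol hz h0
    have jb := (pull hC.hb).hol hz h0
    have jc := (pull hC.hc).hol hz h0
    rw [hdist] at ja jb jc
    have aux : ∀ x y : ℝ, |x| ≤ E * E * ω → |y| ≤ B → |x * y| ≤ E * E * ω * B := by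
      intro x y hx hy
      rw [abs_mul]
      gcongr
    have ka := aux _ _ ja hbr
    have kb := aux _ _ jb hbs
    have kc := aux _ _ jc hbt
    have heq : (sdBil rz sz tz (v1 0) (v2 0) (v1 0) (v2 0) + sdBil rz sz tz e21 e22 e21 e22)
      - (sdBil r0 s0 t0 (v1 0) (v2 0) (v1 0) (v2 0) + sdBil r0 s0 t0 e21 e22 e21 e22)
      = μ * ((g (Ψ z) - b1 (Ψ z) * p (Ψ z) - b2 (Ψ z) * q (Ψ z)
        - (g (Ψ 0) - b1 (Ψ 0) * p (Ψ 0) - b2 (Ψ 0) * q (Ψ 0)))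
        - ((a (Ψ z) - a (Ψ 0)) * rz + 2 * ((b (Ψ z) - b (Ψ 0)) * sz)
          + (c (Ψ z) - c (Ψ 0)) * tz)) := by
      rw [hg _ hcz, hg _ hc0, ← hrz, ← hsz, ← htz, ← hr0, ← hs0, ← ht0]
      unfold sdBil
      linear_combination (rz - r0) * hf1 + 2 * (sz - s0) * hf2 + (tz - t0) * hf3
    rw [heq, abs_mul]
    gcongr
    have l1 := abs_le.mp i1
    have l2 := abs_le.mp ka
    have l3 := abs_le.mp kb
    have l4 := abs_le.mp kc
    have nn : (E * G + E * E * (E * B) + E * E * (E * B)) * ω = (E * G + 2 * E ^ 3 * B) * ω := by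
      ring
    have nm : E * E * ω * B = E ^ 2 * B * ω := by ring
    rw [nm] at l2 l3 l4
    rw [nn] at l1
    refine abs_le.mpr ⟨?_, ?_⟩
    · linarith [l1.1, l1.2, l2.1, l2.2, l3.1, l3.2, l4.1, l4.2]
    · linarith [l1.1, l1.2, l2.1, l2.2, l3.1, l3.2, l4.1, l4.2]
  have hω' : 0 ≤ B * ω := by positivity
  have hGω : 0 ≤ G * ω := by positivity
  have hWx : ∀ j : ℕ, j ≤ 4 → E ^ j * (B * ω) ≤ E ^ 4 * (B * ω) := fun j hj =>
    mul_le_mul_of_nonneg_right (hE j 4 hj) hω'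
  have w2 := hWx 2 (by norm_num)
  have w3 := hWx 3 (by norm_num)
  have wG : E ^ 2 * (G * ω) ≤ E ^ 4 * (G * ω) :=
    mul_le_mul_of_nonneg_right (hE 2 4 (by norm_num)) hGω
  have wB : 0 ≤ E ^ 4 * (B * ω) := by positivity
  have wG' : 0 ≤ E ^ 4 * (G * ω) := by positivity
  have bb : ∀ x y : ℝ, |x| ≤ y → |β * x| ≤ E * y := by
    intro x y hx
    rw [abs_mul]
    exact mul_le_mul hF.hβ hx (abs_nonneg _) E0
  have y2 := bb _ _ x2
  have y3 := bb _ _ x3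
  have yD := bb _ _ hDD
  have hW' : W = 20 * (E ^ 4 * (B * ω)) + 20 * (E ^ 4 * (G * ω)) := by rw [hW]; ring
  have hm1 : m1 = e21 - β * v1 0 := by rw [he21]; ring
  have hm2 : m2 = e22 - β * v2 0 := by rw [he22]; ring
  clear_value ω
  refine ⟨?_, ?_, ?_, ?_, ?_⟩
  · have : (sdBil rz sz tz (β * v1 z + m1) (β * v2 z + m2) (v1 z) (v2 z) + β * D
        - sdBil rz sz tz (v1 z) (v2 z) e21 e22)
      - (sdBil r0 s0 t0 e21 e22 (v1 0) (v2 0) + β * D0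
        - sdBil r0 s0 t0 (v1 0) (v2 0) e21 e22)
      = β * sdBil rz sz tz (v1 z - v1 0) (v2 z - v2 0) (v1 z) (v2 z) + β * (D - D0) := by
      rw [hm1, hm2]; unfold sdBil; ring
    rw [this]
    refine (abs_add_le _ _).trans ((add_le_add y2 yD).trans ?_)
    rw [hW']; linarith
  · have : (sdBil rz sz tz (β * v1 z + m1) (β * v2 z + m2) e21 e22 +
        (sdBil rz sz tz (v1 z) (v2 z) (v1 z) (v2 z) + D))
      - (sdBil r0 s0 t0 e21 e22 e21 e22 +
        (sdBil r0 s0 t0 (v1 0) (v2 0) (v1 0) (v2 0) + D0))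
      = β * sdBil rz sz tz (v1 z - v1 0) (v2 z - v2 0) e21 e22
        + sdBil rz sz tz (v1 z - v1 0) (v2 z - v2 0) (v1 z) (v2 z)
        + sdBil rz sz tz (v1 z - v1 0) (v2 z - v2 0) (v1 0) (v2 0) + (D - D0)
        + ((sdBil rz sz tz (v1 0) (v2 0) (v1 0) (v2 0) + sdBil rz sz tz e21 e22 e21 e22)
      - (sdBil r0 s0 t0 (v1 0) (v2 0) (v1 0) (v2 0) + sdBil r0 s0 t0 e21 e22 e21 e22)) := by
      rw [hm1, hm2]; unfold sdBil; ring
    rw [this]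
    refine (abs_add_le _ _).trans (((add_le_add ((abs_add_le _ _).trans (add_le_add
      ((abs_add_le _ _).trans (add_le_add ((abs_add_le _ _).trans (add_le_add y3 x2)) x1)) hDD))
      tr)).trans ?_)
    rw [hW']; linarith
  · have : (sdBil rz sz tz (v1 0) (v2 0) (v1 0) (v2 0) -
        sdBil r0 s0 t0 (v1 0) (v2 0) (v1 0) (v2 0))
      - ((sdBil rz sz tz (v1 z) (v2 z) (v1 z) (v2 z) + D)
        - (sdBil r0 s0 t0 (v1 0) (v2 0) (v1 0) (v2 0) + D0))
      = -(sdBil rz sz tz (v1 z - v1 0) (v2 z - v2 0) (v1 z) (v2 z)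
        + sdBil rz sz tz (v1 z - v1 0) (v2 z - v2 0) (v1 0) (v2 0) + (D - D0)) := by
      unfold sdBil; ring
    rw [this, abs_neg]
    refine (abs_add_le _ _).trans ((add_le_add ((abs_add_le _ _).trans
      (add_le_add x2 x1)) hDD).trans ?_)
    rw [hW']; linarith
  · have : (sdBil rz sz tz (v1 0) (v2 0) e21 e22 - sdBil r0 s0 t0 (v1 0) (v2 0) e21 e22)
      - (sdBil rz sz tz (v1 z) (v2 z) e21 e22 - sdBil r0 s0 t0 (v1 0) (v2 0) e21 e22)
      = -sdBil rz sz tz (v1 z - v1 0) (v2 z - v2 0) e21 e22 := by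
      unfold sdBil; ring
    rw [this, abs_neg]
    refine x3.trans ?_
    rw [hW']; linarith
  · refine tr.trans ?_
    rw [hW']; linarith
end

lemma sd_cnorm (x y : ℝ) : ‖(x : ℂ) - Complex.I * (y : ℂ)‖ ≤ |x| + |y| := by
  refine (norm_sub_le _ _).trans ?_
  simp

lemma sd_cnorm1 (x y : ℝ) : |x| ≤ ‖(x : ℂ) - Complex.I * (y : ℂ)‖ := by
  simpa using Complex.abs_re_le_norm ((x : ℂ) - Complex.I * (y : ℂ))

lemma sd_cnorm2 (x y : ℝ) : |y| ≤ ‖(x : ℂ) - Complex.I * (y : ℂ)‖ := by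
  simpa using Complex.abs_im_le_norm ((x : ℂ) - Complex.I * (y : ℂ))

lemma sd_frame_inv {x y z e11 e12 e21 e22 E d0 X : ℝ} (hd0 : 0 < d0)
    (h11 : |e11| ≤ E) (h12 : |e12| ≤ E) (h21 : |e21| ≤ E) (h22 : |e22| ≤ E)
    (hd : d0 ≤ |e11 * e22 - e12 * e21|)
    (h1 : |sdBil x y z e11 e12 e11 e12| ≤ X) (h2 : |sdBil x y z e11 e12 e21 e22| ≤ X)
    (h3 : |sdBil x y z e21 e22 e21 e22| ≤ X) :
    |x| ≤ 4 * E ^ 2 / d0 ^ 2 * X ∧ |y| ≤ 4 * E ^ 2 / d0 ^ 2 * X ∧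
      |z| ≤ 4 * E ^ 2 / d0 ^ 2 * X := by
  have hX : 0 ≤ X := (abs_nonneg _).trans h1
  have key : ∀ w a b c d : ℝ, |a| ≤ E → |b| ≤ E → |c| ≤ E → |d| ≤ E →
      w * (e11 * e22 - e12 * e21) ^ 2 = sdBil (sdBil x y z e11 e12 e11 e12)
        (sdBil x y z e11 e12 e21 e22) (sdBil x y z e21 e22 e21 e22) a b c d →
      |w| ≤ 4 * E ^ 2 / d0 ^ 2 * X := by
    intro w a b c d ha hb hc hd' h
    have h4 := sdBil_abs h1 h2 h3 ha hb hc hd'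
    rw [← h, abs_mul, abs_pow] at h4
    have h5 : |w| * d0 ^ 2 ≤ 4 * X * E * E := by
      refine le_trans ?_ h4
      gcongr
    rw [div_mul_eq_mul_div, le_div_iff₀ (by positivity)]
    linarith
  have n12 : |-e12| ≤ E := by rwa [abs_neg]
  have n21 : |-e21| ≤ E := by rwa [abs_neg]
  refine ⟨key x e22 (-e12) e22 (-e12) h22 n12 h22 n12 ?_,
    key y e22 (-e12) (-e21) e11 h22 n12 n21 h11 ?_,
    key z (-e21) e11 (-e21) e11 n21 h11 n21 h11 ?_⟩ <;> unfold sdBil <;> ring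

set_option maxHeartbeats 1000000 in
lemma sd_blow (S : Set ℂ) (hS : S = univ ∨ S = sdUp) (E d0 M η : ℝ) (hE : 1 ≤ E) (hd0 : 0 < d0)
    (hM : 0 < M) (hη : 0 < η) : ∃ R, 0 < R ∧ M < R ∧ ∃ K, 0 < K ∧
    ∀ (Ω : Set (ℝ × ℝ)) (u p q r s t a b c b1 b2 g : ℝ × ℝ → ℝ) (B H G : ℝ),
    SDat Ω u p q r s t → SCoef Ω a b c b1 b2 E → SBd Ω p q r s t g B H G →
    (∀ x ∈ closure Ω, g x = a x * r x + 2 * b x * s x + c x * t x + b1 x * p x + b2 x * q x) →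
    ∀ (Ψ : ℂ → ℝ × ℝ) (v1 v2 k1 k2 : ℂ → ℝ) (β m1 m2 μ ρ e21 e22 : ℝ), 0 < ρ →
    SFr Ω S Ψ v1 v2 k1 k2 β m1 m2 E (R * ρ) → |μ| ≤ E →
    e21 = β * v1 0 + m1 → e22 = β * v2 0 + m2 →
    v1 0 ^ 2 + e21 ^ 2 = μ * a (Ψ 0) → v1 0 * v2 0 + e21 * e22 = μ * b (Ψ 0) →
    v2 0 ^ 2 + e22 ^ 2 = μ * c (Ψ 0) → d0 ≤ |v1 0 * e22 - v2 0 * e21| →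
    ∀ z ∈ S, ‖z‖ ≤ M * ρ →
      |r (Ψ z) - r (Ψ 0)| ≤ (η * H + K * (B + G)) * √ρ ∧
      |s (Ψ z) - s (Ψ 0)| ≤ (η * H + K * (B + G)) * √ρ ∧
      |t (Ψ z) - t (Ψ 0)| ≤ (η * H + K * (B + G)) * √ρ := by
  have hE0 : 0 < E := by linarith
  obtain ⟨R, hR, hMR, ε, hε, hkey⟩ := sd_key' S hS (η * d0 ^ 2 / (80 * E ^ 6)) M (by positivity)
  set c0 := η * d0 ^ 2 / (80 * E ^ 6) with hc0
  have hc00 : 0 < c0 := by positivity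
  refine ⟨R, hR, hMR, 4 * E ^ 2 / d0 ^ 2 * (c0 * (20 * E ^ 4 + 40 * E ^ 4 * √R / ε) +
    40 * E ^ 4 * √M), by positivity, ?_⟩
  intro Ω u p q r s t a b c b1 b2 g B H G hu hC hB hg Ψ v1 v2 k1 k2 β m1 m2 μ ρ e21 e22 hρ hF hμ
    he21 he22 hf1 hf2 hf3 hdet z hz hzM
  have hB0 := hB.B0
  have hH0 := hB.H0
  have hG0 := hB.hg.nonneg
  have S0 : (0:ℂ) ∈ S := by rcases hS with h | h <;> rw [h] <;> simp [sdUp]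
  have hRρ : 0 < R * ρ := by positivity
  have h0 : (0:ℂ) ∈ S ∩ Metric.ball 0 (R * ρ) := ⟨S0, by simpa using hRρ⟩
  have hmem : ∀ z ∈ S, ‖z‖ < R * ρ → z ∈ S ∩ Metric.ball 0 (R * ρ) := fun z hz h =>
    ⟨hz, by simpa using h⟩
  have est := fun z hz => sd_fr_est hF hC hB hg hμ e21 e22 he21 he22 hf1 hf2 hf3 h0 z hz
    _ _ _ _ _ _ _ _ _ rfl rfl rfl rfl rfl rfl rfl rfl rfl
  have pull : ∀ {f : ℝ × ℝ → ℝ} {k : ℝ}, HB (closure Ω) f k →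
      HB (S ∩ Metric.ball 0 (R * ρ)) (fun z => f (Ψ z)) (E * k) :=
    fun hf => hf.comp hF.mc hE hF.hL
  have hr := pull (HB.of_bounds hB0.le hB.br hH0 hB.hr)
  have hs := pull (HB.of_bounds hB0.le hB.bs hH0 hB.hs)
  have ht := pull (HB.of_bounds hB0.le hB.bt hH0 hB.ht)
  have hp := pull hB.hp
  have hq := pull hB.hq
  have ce1 : HB (S ∩ Metric.ball 0 (R * ρ)) (fun _ => e21) E :=
    (HB.const e21).mono (by rw [he21]; exact hF.he1)
  have ce2 : HB (S ∩ Metric.ball 0 (R * ρ)) (fun _ => e22) E :=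
    (HB.const e22).mono (by rw [he22]; exact hF.he2)
  have cβ : HB (S ∩ Metric.ball 0 (R * ρ)) (fun _ => β) E := (HB.const β).mono hF.hβ
  have cw1 : HB (S ∩ Metric.ball 0 (R * ρ)) (fun z => β * v1 z + m1) (2 * E ^ 2) :=
    ((cβ.mul hF.hv1).add ((HB.const m1).mono hF.hm1)).mono (by nlinarith)
  have cw2 : HB (S ∩ Metric.ball 0 (R * ρ)) (fun z => β * v2 z + m2) (2 * E ^ 2) :=
    ((cβ.mul hF.hv2).add ((HB.const m2).mono hF.hm2)).mono (by nlinarith)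
  have cD := (hp.mul hF.hk1).add (hq.mul hF.hk2)
  have cPs := (sdBil_HB hr hs ht hF.hv1 hF.hv2 hF.hv1 hF.hv2).add cD
  have cPt := (sdBil_HB hr hs ht cw1 cw2 hF.hv1 hF.hv2).add (cβ.mul cD)
  have cQs := sdBil_HB hr hs ht hF.hv1 hF.hv2 ce1 ce2
  have cQt := sdBil_HB hr hs ht cw1 cw2 ce1 ce2
  set N := 20 * E ^ 4 * (B + H) + 40 * E ^ 4 * √R / ε * (B + G) with hN
  have hN0 : 0 < N := by positivity
  have hNV : 20 * E ^ 4 * (B + H) ≤ N := by rw [hN]; linarith [show 0 ≤ 40 * E ^ 4 * √R / ε * (B + G) by positivity]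
  have E34 : E ^ 3 ≤ E ^ 4 := pow_le_pow_right₀ hE (by norm_num)
  have E24 : E ^ 2 ≤ E ^ 4 := pow_le_pow_right₀ hE (by norm_num)
  have V3 : E ^ 3 * (B + H) ≤ E ^ 4 * (B + H) := by gcongr
  have V2 : E ^ 2 * B ≤ E ^ 4 * B := by gcongr
  have V3' : E ^ 3 * B ≤ E ^ 4 * B := by gcongr
  have VB : E ^ 4 * B ≤ E ^ 4 * (B + H) := by gcongr; linarith
  have V0 : 0 ≤ E ^ 4 * (B + H) := by positivity
  have diff : ∀ x y x' y' : ℝ, ((x : ℂ) - Complex.I * (y : ℂ)) - ((x' : ℂ) - Complex.I * (y' : ℂ))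
      = ((x - x' : ℝ) : ℂ) - Complex.I * ((y - y' : ℝ) : ℂ) := by
    intros; push_cast; ring
  have holder : ∀ {f h : ℂ → ℝ} {k l : ℝ}, HB (S ∩ Metric.ball 0 (R * ρ)) f k →
      HB (S ∩ Metric.ball 0 (R * ρ)) h l → k + l ≤ N → ∀ z ∈ S, ∀ w ∈ S, ‖z‖ < R * ρ →
      ‖w‖ < R * ρ → ‖((f z : ℂ) - Complex.I * (h z : ℂ)) - ((f w : ℂ) - Complex.I * (h w : ℂ))‖
        ≤ N * √‖z - w‖ := by
    intro f h k l hf hh hkl z hz w hw hzR hwR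
    rw [diff]
    refine (sd_cnorm _ _).trans ?_
    have h1 := hf.hol (hmem z hz hzR) (hmem w hw hwR)
    have h2 := hh.hol (hmem z hz hzR) (hmem w hw hwR)
    rw [dist_eq_norm] at h1 h2
    calc _ ≤ k * √‖z - w‖ + l * √‖z - w‖ := add_le_add h1 h2
      _ = (k + l) * √‖z - w‖ := by ring
      _ ≤ _ := by gcongr
  have hder := sd_fr_der hS hF hu
  rw [← he21, ← he22] at hder
  have main := hkey _ _ _ ρ N hρ hN0 hder
    (holder cPs cQs (by refine le_trans ?_ hNV; nlinarith))
    (holder cPt cQt (by refine le_trans ?_ hNV; nlinarith)) ?_ ?_ z hz hzM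
  · have hzT := hmem z hz (hzM.trans_lt (by gcongr))
    obtain ⟨-, -, e3, e4, e5⟩ := est z hzT
    rw [diff] at main
    have m1 := (sd_cnorm1 _ _).trans main
    have m2 := (sd_cnorm2 _ _).trans main
    have hω : √‖z‖ ≤ √M * √ρ := by
      rw [← Real.sqrt_mul hM.le]; exact Real.sqrt_le_sqrt hzM
    have hW : 20 * E ^ 4 * (B + G) * √‖z‖ ≤ 20 * E ^ 4 * √M * (B + G) * √ρ := by
      calc _ ≤ 20 * E ^ 4 * (B + G) * (√M * √ρ) := by gcongr
        _ = _ := by ring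
    have bsub : ∀ x y z x' y' z' v1 v2 w1 w2 : ℝ, sdBil (x - x') (y - y') (z - z') v1 v2 w1 w2 =
        sdBil x y z v1 v2 w1 w2 - sdBil x' y' z' v1 v2 w1 w2 := by
      intros; unfold sdBil; ring
    have hsR : 0 ≤ √ρ := Real.sqrt_nonneg _
    have m1' := abs_le.mp m1
    have m2' := abs_le.mp m2
    have e3' := abs_le.mp e3
    have e4' := abs_le.mp e4
    have e5' := abs_le.mp e5
    have hcN : 0 ≤ c0 * N * √ρ := by positivity
    have hWp : 0 ≤ 20 * E ^ 4 * √M * (B + G) * √ρ := by positivity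
    have fin := sd_frame_inv (x := r (Ψ z) - r (Ψ 0)) (y := s (Ψ z) - s (Ψ 0))
      (z := t (Ψ z) - t (Ψ 0)) (X := c0 * N * √ρ + 2 * (20 * E ^ 4 * √M * (B + G) * √ρ)) hd0
      (hF.hv1.bd h0) (hF.hv2.bd h0) (by rw [he21]; exact hF.he1) (by rw [he22]; exact hF.he2) hdet
      (by rw [bsub, abs_le]; constructor <;> linarith [m1'.1, m1'.2, e3'.1, e3'.2])
      (by rw [bsub, abs_le]; constructor <;> linarith [m2'.1, m2'.2, e4'.1, e4'.2])
      (by rw [bsub, abs_le]; constructor <;>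
            linarith [m1'.1, m1'.2, e3'.1, e3'.2, e5'.1, e5'.2])
    have hfin : 4 * E ^ 2 / d0 ^ 2 * (c0 * N * √ρ + 2 * (20 * E ^ 4 * √M * (B + G) * √ρ)) ≤
        (η * H + 4 * E ^ 2 / d0 ^ 2 * (c0 * (20 * E ^ 4 + 40 * E ^ 4 * √R / ε) +
          40 * E ^ 4 * √M) * (B + G)) * √ρ := by
      have i1 : 4 * E ^ 2 / d0 ^ 2 * (c0 * (20 * E ^ 4)) = η := by
        rw [hc0]; field_simp; norm_num
      have i2 : 0 ≤ 4 * E ^ 2 / d0 ^ 2 * (c0 * (20 * E ^ 4)) * G * √ρ := by positivity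
      have i3 : 4 * E ^ 2 / d0 ^ 2 * (c0 * N * √ρ + 2 * (20 * E ^ 4 * √M * (B + G) * √ρ)) =
        ((4 * E ^ 2 / d0 ^ 2 * (c0 * (20 * E ^ 4))) * H + 4 * E ^ 2 / d0 ^ 2 * (c0 * (20 * E ^ 4 + 40 * E ^ 4 * √R / ε) +
          40 * E ^ 4 * √M) * (B + G)) * √ρ - 4 * E ^ 2 / d0 ^ 2 * (c0 * (20 * E ^ 4)) * G * √ρ := by
        rw [hN]; ring
      rw [i3, i1]; rw [i1] at i2; linarith
    exact ⟨fin.1.trans hfin, fin.2.1.trans hfin, fin.2.2.trans hfin⟩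
  · intro w hw hwR
    obtain ⟨e1, e2, -⟩ := est w (hmem w hw hwR)
    have heq : ∀ x y x' y' x0 y0 x0' y0' : ℝ,
      (((x' : ℂ) - Complex.I * y') - ((x0' : ℂ) - Complex.I * y0')) - Complex.I *
        (((x : ℂ) - Complex.I * y) - ((x0 : ℂ) - Complex.I * y0)) =
        (((x' - y) - (x0' - y0) : ℝ) : ℂ) - Complex.I * (((y' + x) - (y0' + x0) : ℝ) : ℂ) := by
      intro x y x' y' x0 y0 x0' y0'
      push_cast
      linear_combination ((y : ℂ) - y0) * Complex.I_sq
    rw [heq]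
    refine (sd_cnorm _ _).trans ?_
    have hω : √‖w‖ ≤ √R * √ρ := by
      rw [← Real.sqrt_mul hR.le]; exact Real.sqrt_le_sqrt hwR.le
    rw [← he21, ← he22]
    refine (add_le_add e1 e2).trans ?_
    have hsR : 0 ≤ √ρ := Real.sqrt_nonneg _
    calc _ ≤ 40 * E ^ 4 * (B + G) * (√R * √ρ) := by
          have : 40 * E ^ 4 * (B + G) * √‖w‖ ≤ 40 * E ^ 4 * (B + G) * (√R * √ρ) := by gcongr
          linarith
      _ = ε * (40 * E ^ 4 * √R / ε * (B + G)) * √ρ := by field_simp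
      _ ≤ ε * N * √ρ := by
          gcongr
          rw [hN]; linarith [show 0 ≤ 20 * E ^ 4 * (B + H) by positivity]
  · intro hS' w hw hwR
    have := sd_fr_axis hF hu hS' w hw hwR
    simp [this]

lemma sd_per_inj {γ : ℝ → ℝ × ℝ} {T : ℝ} (hT : 0 < T) (hp : ∀ s, γ (s + T) = γ s)
    (hi : InjOn γ (Ico 0 T)) {x y : ℝ} (h : γ x = γ y) (hxy : |x - y| < T) : x = y := by
  have hper : Function.Periodic γ T := hp
  have e : ∀ x, γ (toIcoMod hT 0 x) = γ x := fun x => by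
    rw [toIcoMod]; exact hper.sub_zsmul_eq _
  have m : ∀ x, toIcoMod hT 0 x ∈ Ico 0 T := fun x => by
    have := toIcoMod_mem_Ico hT 0 x; simpa using this
  have h1 := hi (m x) (m y) (by rw [e, e, h])
  have hx := self_sub_toIcoDiv_zsmul hT 0 x
  have hy := self_sub_toIcoDiv_zsmul hT 0 y
  set k := toIcoDiv hT 0 x
  set l := toIcoDiv hT 0 y
  have h2 : x - y = ((k - l : ℤ) : ℝ) * T := by
    simp only [zsmul_eq_mul] at hx hy
    push_cast
    linarith
  have h3 : k - l = 0 := by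
    rw [h2, abs_mul, abs_of_pos hT] at hxy
    have h4 : |((k - l : ℤ) : ℝ)| < 1 := by
      by_contra hcon
      push Not at hcon
      nlinarith
    rw [← Int.cast_abs] at h4
    have h5 : |k - l| < 1 := by exact_mod_cast h4
    exact Int.abs_lt_one_iff.mp h5
  rw [h3] at h2
  simp at h2
  linarith

def sdEqv (v : ℝ × ℝ) (hv : v ≠ 0) : (ℝ × ℝ) ≃L[ℝ] (ℝ × ℝ) :=
  ContinuousLinearEquiv.equivOfInverse
    (((ContinuousLinearMap.fst ℝ ℝ ℝ).smulRight v) +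
      (ContinuousLinearMap.snd ℝ ℝ ℝ).smulRight ((-v.2, v.1) : ℝ × ℝ))
    ((sdE (v.1 / (v.1 ^ 2 + v.2 ^ 2)) (v.2 / (v.1 ^ 2 + v.2 ^ 2))).prod
      (sdE (-v.2 / (v.1 ^ 2 + v.2 ^ 2)) (v.1 / (v.1 ^ 2 + v.2 ^ 2))))
    (by
      have h : v.1 ^ 2 + v.2 ^ 2 ≠ 0 := by
        intro h
        apply hv
        have h1 : v.1 = 0 := by nlinarith [sq_nonneg v.1, sq_nonneg v.2]
        have h2 : v.2 = 0 := by nlinarith [sq_nonneg v.1, sq_nonneg v.2]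
        exact Prod.ext h1 h2
      intro x
      ext <;> simp [sdE_apply] <;> field_simp <;> ring)
    (by
      have h : v.1 ^ 2 + v.2 ^ 2 ≠ 0 := by
        intro h
        apply hv
        have h1 : v.1 = 0 := by nlinarith [sq_nonneg v.1, sq_nonneg v.2]
        have h2 : v.2 = 0 := by nlinarith [sq_nonneg v.1, sq_nonneg v.2]
        exact Prod.ext h1 h2
      intro x
      ext <;> simp [sdE_apply] <;> field_simp <;> ring)

lemma sd_loc1 {γ : ℝ → ℝ × ℝ} (hγ : ContDiff ℝ 3 γ) (s0 : ℝ) (hv : deriv γ s0 ≠ 0) :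
    ∃ δ L : ℝ, 0 < δ ∧ 1 ≤ L ∧ (∀ x y : ℝ × ℝ, ‖x‖ < δ → ‖y‖ < δ →
      ‖x - y‖ ≤ L * dist (γ (s0 + x.1) + x.2 • (-(deriv γ s0).2, (deriv γ s0).1))
        (γ (s0 + y.1) + y.2 • (-(deriv γ s0).2, (deriv γ s0).1))) ∧
    ∀ δ', 0 < δ' → ∃ r, 0 < r ∧ ∀ y, dist y (γ s0) < r → ∃ x : ℝ × ℝ, ‖x‖ < δ' ∧
      y = γ (s0 + x.1) + x.2 • (-(deriv γ s0).2, (deriv γ s0).1) := by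
  set n : ℝ × ℝ := (-(deriv γ s0).2, (deriv γ s0).1) with hn
  set Φ : ℝ × ℝ → ℝ × ℝ := fun x => γ (s0 + x.1) + x.2 • n with hΦ
  have hd : HasDerivAt γ (deriv γ s0) (s0 + (0 : ℝ × ℝ).1) := by
    simpa using (hγ.differentiable (by norm_num) s0).hasDerivAt
  have hcd : ContDiff ℝ 3 Φ := by
    rw [hΦ]; fun_prop
  have h1 : HasFDerivAt Φ (sdEqv _ hv : ℝ × ℝ →L[ℝ] ℝ × ℝ) 0 := by
    have a1 : HasFDerivAt (fun x : ℝ × ℝ => s0 + x.1) (ContinuousLinearMap.fst ℝ ℝ ℝ) 0 :=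
      (ContinuousLinearMap.fst ℝ ℝ ℝ).hasFDerivAt.const_add s0
    have a2 := hd.hasFDerivAt.comp (0 : ℝ × ℝ) a1
    have a3 := ((ContinuousLinearMap.snd ℝ ℝ ℝ).smulRight n).hasFDerivAt (x := (0 : ℝ × ℝ))
    refine (a2.add a3).congr_fderiv ?_
    ext <;> simp [sdEqv, hn]
  have h2 : HasStrictFDerivAt Φ (sdEqv _ hv : ℝ × ℝ →L[ℝ] ℝ × ℝ) 0 :=
    hcd.contDiffAt.hasStrictFDerivAt' h1 (by norm_num)
  obtain ⟨s, h0s, hso, happ⟩ := h2.approximates_deriv_on_open_nhds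
  obtain ⟨δ, hδ, hball⟩ := Metric.isOpen_iff.mp hso 0 h0s
  have hanti := happ.antilipschitz (Or.inr (by
    apply NNReal.half_lt_self
    have : ‖((sdEqv _ hv).symm : ℝ × ℝ →L[ℝ] ℝ × ℝ)‖₊ ≠ 0 := by
      rw [nnnorm_ne_zero_iff]
      intro h
      have := congrArg (fun f => (sdEqv _ hv) (f ((1,0) : ℝ × ℝ))) h
      simp at this
    exact inv_ne_zero this))
  set K := (‖((sdEqv _ hv).symm : ℝ × ℝ →L[ℝ] ℝ × ℝ)‖₊⁻¹ -
    ‖((sdEqv _ hv).symm : ℝ × ℝ →L[ℝ] ℝ × ℝ)‖₊⁻¹ / 2)⁻¹ with hK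
  refine ⟨δ, max 1 K, hδ, le_max_left _ _, fun x y hx hy => ?_, fun δ' hδ' => ?_⟩
  · have := hanti.le_mul_dist ⟨x, hball (by simpa using hx)⟩ ⟨y, hball (by simpa using hy)⟩
    rw [← dist_eq_norm]
    refine le_trans this ?_
    have : dist (Φ x) (Φ y) ≥ 0 := dist_nonneg
    exact mul_le_mul_of_nonneg_right (le_max_right _ _) this
  · have hm := h2.map_nhds_eq_of_equiv
    have : Φ '' Metric.ball 0 δ' ∈ 𝓝 (Φ 0) := by
      rw [← hm]; exact image_mem_map (Metric.ball_mem_nhds _ hδ')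
    have hΦ0 : Φ 0 = γ s0 := by simp [hΦ]
    rw [hΦ0] at this
    obtain ⟨r, hr, hrb⟩ := Metric.mem_nhds_iff.mp this
    refine ⟨r, hr, fun y hy => ?_⟩
    obtain ⟨x, hx, rfl⟩ := hrb hy
    exact ⟨x, by simpa using hx, rfl⟩

lemma sd_conn_side {Ω U : Set (ℝ × ℝ)} (hU : IsPreconnected U) (hΩ : IsOpen Ω)
    (hd : ∀ x ∈ U, x ∉ frontier Ω) : (∀ x ∈ U, x ∈ Ω) ∨ ∀ x ∈ U, x ∉ closure Ω := by
  have := hU.subset_or_subset hΩ (isClosed_closure (s := Ω)).isOpen_compl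
    (disjoint_compl_right.mono_left subset_closure |>.mono_right le_rfl) (fun x hx => by
      by_cases h : x ∈ closure Ω
      · rw [closure_eq_self_union_frontier] at h
        rcases h with h | h
        · exact Or.inl h
        · exact absurd h (hd x hx)
      · exact Or.inr h)
  exact this

lemma sd_norm_lt {x : ℝ × ℝ} {δ : ℝ} : ‖x‖ < δ ↔ |x.1| < δ ∧ |x.2| < δ := by
  rw [Prod.norm_def, max_lt_iff]; simp [Real.norm_eq_abs]

lemma sd_loc2 {Ω : Set (ℝ × ℝ)} (hΩ : IsOpen Ω) {γ : ℝ → ℝ × ℝ} {T : ℝ} (hT : 0 < T)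
    (hp : ∀ s, γ (s + T) = γ s) (hi : InjOn γ (Ico 0 T)) (hγ : ContDiff ℝ 3 γ)
    (hfr : frontier Ω = range γ) (s0 : ℝ) (hv : deriv γ s0 ≠ 0) (n : ℝ × ℝ)
    (hn : n = (-(deriv γ s0).2, (deriv γ s0).1)) (δ0 : ℝ) (hδ0 : 0 < δ0) :
    ∃ δ L r : ℝ, 0 < δ ∧ δ ≤ δ0 ∧ 1 ≤ L ∧ 0 < r ∧ (∀ x y : ℝ × ℝ, ‖x‖ < δ → ‖y‖ < δ →
      ‖x - y‖ ≤ L * dist (γ (s0 + x.1) + x.2 • n) (γ (s0 + y.1) + y.2 • n)) ∧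
    (∀ y, dist y (γ s0) < r → ∃ x : ℝ × ℝ, ‖x‖ < δ ∧ y = γ (s0 + x.1) + x.2 • n) ∧
    ((∀ x : ℝ × ℝ, ‖x‖ < δ → 0 < x.2 → γ (s0 + x.1) + x.2 • n ∈ Ω) ∨
      (∀ x : ℝ × ℝ, ‖x‖ < δ → 0 < x.2 → γ (s0 + x.1) + x.2 • n ∉ closure Ω)) ∧
    ((∀ x : ℝ × ℝ, ‖x‖ < δ → x.2 < 0 → γ (s0 + x.1) + x.2 • n ∈ Ω) ∨
      (∀ x : ℝ × ℝ, ‖x‖ < δ → x.2 < 0 → γ (s0 + x.1) + x.2 • n ∉ closure Ω)) := by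
  obtain ⟨δ1, L, hδ1, hL, hinv, hsurj⟩ := sd_loc1 hγ s0 hv
  rw [← hn] at hinv hsurj
  have hcont := hγ.continuous
  set δ2 := min δ1 (T / 2) with hδ2
  have hδ2p : 0 < δ2 := lt_min hδ1 (by linarith)
  set Kc := γ '' (Icc (s0 - T / 2) (s0 + T / 2) \ Ioo (s0 - δ2) (s0 + δ2)) with hKc
  have hKcomp : IsCompact Kc := (isCompact_Icc.diff isOpen_Ioo).image hcont
  have hx0 : γ s0 ∉ Kc := by
    rintro ⟨y, ⟨hy1, hy2⟩, hy3⟩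
    have : y = s0 := sd_per_inj hT hp hi hy3 (by
      rw [abs_lt]; constructor <;> linarith [hy1.1, hy1.2])
    apply hy2
    rw [this]
    exact ⟨by linarith, by linarith⟩
  obtain ⟨ε, hε, hεb⟩ := Metric.isOpen_iff.mp hKcomp.isClosed.isOpen_compl _ hx0
  have hΦc : Continuous (fun x : ℝ × ℝ => γ (s0 + x.1) + x.2 • n) := by fun_prop
  have hnear : ∀ᶠ x : ℝ × ℝ in 𝓝 0, γ (s0 + x.1) + x.2 • n ∈ Metric.ball (γ s0) ε := by
    apply hΦc.continuousAt.eventually_mem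
    apply Metric.isOpen_ball.mem_nhds
    simpa using hε
  obtain ⟨δ3, hδ3, hδ3b⟩ := Metric.eventually_nhds_iff.mp hnear
  set δ := min (min δ2 δ3) δ0 with hδ
  have hδp : 0 < δ := lt_min (lt_min hδ2p hδ3) hδ0
  have l1 : δ ≤ δ1 := (min_le_left _ _).trans ((min_le_left _ _).trans (min_le_left _ _))
  have l3 : δ ≤ δ3 := (min_le_left _ _).trans (min_le_right _ _)
  have hfro : ∀ x : ℝ × ℝ, ‖x‖ < δ → x.2 ≠ 0 → γ (s0 + x.1) + x.2 • n ∉ frontier Ω := by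
    intro x hx hx2 hmem
    have hb := hδ3b (y := x) (by simpa using hx.trans_le l3)
    have hnk := hεb hb
    have hper : Function.Periodic γ T := hp
    have him := hper.image_Icc hT (s0 - T / 2)
    rw [hfr, ← him] at hmem
    obtain ⟨y, hy, hye⟩ := hmem
    have hyIoo : y ∈ Ioo (s0 - δ2) (s0 + δ2) := by
      by_contra hcon
      exact hnk ⟨y, ⟨⟨hy.1, by linarith [hy.2]⟩, hcon⟩, hye⟩
    have hyn : ‖((y - s0, 0) : ℝ × ℝ)‖ < δ1 := by
      rw [sd_norm_lt]
      have : δ2 ≤ δ1 := min_le_left _ _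
      refine ⟨?_, by simpa using hδ1⟩
      rw [abs_lt]; constructor <;> simp <;> linarith [hyIoo.1, hyIoo.2]
    have := hinv x (y - s0, 0) (hx.trans_le l1) hyn
    have e : γ (s0 + (y - s0, (0:ℝ)).1) + (y - s0, (0:ℝ)).2 • n = γ y := by simp
    rw [e, hye, dist_self, mul_zero] at this
    have h2 : x - (y - s0, 0) = 0 := norm_le_zero_iff.mp this
    have h3 := congrArg Prod.snd h2
    simp at h3
    exact hx2 h3
  obtain ⟨r, hr, hrs⟩ := hsurj δ hδp
  have hset : ∀ (I : Set ℝ), Convex ℝ I → IsPreconnected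
      ((fun x : ℝ × ℝ => γ (s0 + x.1) + x.2 • n) '' (Metric.ball 0 δ ∩ (univ ×ˢ I))) :=
    fun I hI => (((convex_ball _ _).inter (convex_univ.prod hI)).isPreconnected).image _
      hΦc.continuousOn
  refine ⟨δ, L, r, hδp, min_le_right _ _, hL, hr, fun x y hx hy =>
    hinv x y (hx.trans_le l1) (hy.trans_le l1), hrs, ?_, ?_⟩
  · have := sd_conn_side (hset (Ioi 0) (convex_Ioi 0)) hΩ (by
      rintro _ ⟨x, ⟨hx, -, hx2⟩, rfl⟩
      exact hfro x (by simpa using hx) (ne_of_gt hx2))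
    rcases this with h | h
    · exact Or.inl fun x hx hx2 => h _ ⟨x, ⟨by simpa using hx, mem_univ _, hx2⟩, rfl⟩
    · exact Or.inr fun x hx hx2 => h _ ⟨x, ⟨by simpa using hx, mem_univ _, hx2⟩, rfl⟩
  · have := sd_conn_side (hset (Iio 0) (convex_Iio 0)) hΩ (by
      rintro _ ⟨x, ⟨hx, -, hx2⟩, rfl⟩
      exact hfro x (by simpa using hx) (ne_of_lt hx2))
    rcases this with h | h
    · exact Or.inl fun x hx hx2 => h _ ⟨x, ⟨by simpa using hx, mem_univ _, hx2⟩, rfl⟩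
    · exact Or.inr fun x hx hx2 => h _ ⟨x, ⟨by simpa using hx, mem_univ _, hx2⟩, rfl⟩

lemma sd_not_int {Ω : Set (ℝ × ℝ)} (hΩ : IsOpen Ω) (hbd : Bornology.IsBounded Ω)
    (hne : Ω.Nonempty) {γ : ℝ → ℝ × ℝ} {T : ℝ} (hT : 0 < T)
    (hp : ∀ s, γ (s + T) = γ s) (hi : InjOn γ (Ico 0 T)) (hγ : ContDiff ℝ 3 γ)
    (hfr : frontier Ω = range γ) (hv : ∀ s, deriv γ s ≠ 0) (s0 : ℝ) :
    γ s0 ∉ interior (closure Ω) := by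
  set Z := {s | γ s ∈ interior (closure Ω)} with hZ
  have hZo : IsOpen Z := isOpen_interior.preimage hγ.continuous
  have hZc : IsOpen Zᶜ := by
    rw [Metric.isOpen_iff]
    intro s0 hs0
    obtain ⟨δ, L, r, hδ, -, hL, hr, hinv, hsurj, hplus, hminus⟩ :=
      sd_loc2 hΩ hT hp hi hγ hfr s0 (hv s0) _ rfl 1 one_pos
    set n : ℝ × ℝ := (-(deriv γ s0).2, (deriv γ s0).1)
    have hside : ∃ σ : ℝ, σ ≠ 0 ∧ ∀ s, |s| < δ → ∀ t, 0 < t → t * |σ| < δ →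
        γ (s0 + s) + (t * σ) • n ∉ closure Ω := by
      rcases hplus with h1 | h1
      · rcases hminus with h2 | h2
        · exfalso
          apply hs0
          change γ s0 ∈ interior (closure Ω)
          rw [mem_interior_iff_mem_nhds]
          refine mem_of_superset (Metric.ball_mem_nhds _ hr) fun y hy => ?_
          obtain ⟨x, hx, rfl⟩ := hsurj y hy
          rcases lt_trichotomy x.2 0 with h | h | h
          · exact subset_closure (h2 x hx h)
          · rw [h, zero_smul, add_zero]
            apply frontier_subset_closure
            rw [hfr]; exact mem_range_self _
          · exact subset_closure (h1 x hx h)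
        · refine ⟨-1, by norm_num, fun s hs t ht htd => ?_⟩
          have := h2 (s, -t) (by rw [sd_norm_lt]; simp [abs_of_pos ht] at htd ⊢; exact ⟨hs, htd⟩)
            (by simpa using ht)
          simpa using this
      · refine ⟨1, by norm_num, fun s hs t ht htd => ?_⟩
        have := h1 (s, t) (by rw [sd_norm_lt]; simp [abs_of_pos ht] at htd ⊢; exact ⟨hs, htd⟩)
            (by simpa using ht)
        simpa using this
    obtain ⟨σ, hσ, hout⟩ := hside
    refine ⟨δ, hδ, fun s hs hsZ => ?_⟩
    have hs' : |s - s0| < δ := by simpa [Real.dist_eq] using hs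
    have hmem : γ s ∈ interior (closure Ω) := hsZ
    have hc : Continuous (fun t : ℝ => γ s + (t * σ) • n) := by fun_prop
    have ev1 : ∀ᶠ t : ℝ in 𝓝 0, γ s + (t * σ) • n ∈ interior (closure Ω) := by
      apply hc.continuousAt.eventually_mem
      apply isOpen_interior.mem_nhds
      simpa using hmem
    have ev2 : ∀ᶠ t : ℝ in 𝓝 0, t * |σ| < δ := by
      have hc2 : Continuous (fun t : ℝ => t * |σ|) := by fun_prop
      exact hc2.continuousAt.eventually_lt continuousAt_const (by simpa using hδ)
    have ev3 : ∀ᶠ t : ℝ in 𝓝[>] 0, 0 < t := self_mem_nhdsWithin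
    obtain ⟨t, ⟨ht1, ht2⟩, ht3⟩ :=
      (((ev1.and ev2).filter_mono nhdsWithin_le_nhds).and ev3).exists
    have := hout (s - s0) hs' t ht3 ht2
    rw [show s0 + (s - s0) = s by ring] at this
    exact this (interior_subset ht1)
  have hclop : IsClopen Z := ⟨⟨hZc⟩, hZo⟩
  intro hmem
  rcases isClopen_iff.mp hclop with h | h
  · have : s0 ∈ Z := hmem
    rw [h] at this; exact this
  · have hsub : closure Ω ⊆ interior (closure Ω) := by
      intro x hx
      rw [closure_eq_self_union_frontier, hfr] at hx
      rcases hx with hx | ⟨s, rfl⟩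
      · exact interior_maximal subset_closure hΩ hx
      · have : s ∈ Z := by rw [h]; exact mem_univ _
        exact this
    have hcl : IsClopen (closure Ω) := ⟨isClosed_closure, by
      rw [← subset_interior_iff_isOpen]; exact hsub⟩
    rcases isClopen_iff.mp hcl with h2 | h2
    · exact (hne.mono subset_closure).ne_empty h2
    · have := hbd.closure
      rw [h2] at this
      exact NormedSpace.unbounded_univ ℝ (ℝ × ℝ) this

structure SCurve (c c1 c2 : ℝ → ℝ × ℝ) (n : ℝ × ℝ) (δ d0 L : ℝ) : Prop where
  L1 : 1 ≤ L
  hd0 : 0 < d0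
  d1 : ∀ s, |s| < δ → HasDerivAt c (c1 s) s
  d2 : ∀ s, |s| < δ → HasDerivAt c1 (c2 s) s
  b11 : HB (Metric.ball 0 δ) (fun s => (c1 s).1) L
  b12 : HB (Metric.ball 0 δ) (fun s => (c1 s).2) L
  b21 : HB (Metric.ball 0 δ) (fun s => (c2 s).1) L
  b22 : HB (Metric.ball 0 δ) (fun s => (c2 s).2) L
  n1 : |n.1| ≤ L
  n2 : |n.2| ≤ L
  det : ∀ s, |s| < δ → d0 ≤ |(c1 s).1 * n.2 - (c1 s).2 * n.1|

structure SChart (Ω : Set (ℝ × ℝ)) (x0 : ℝ × ℝ) (c c1 c2 : ℝ → ℝ × ℝ) (n : ℝ × ℝ)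
    (δ r d0 L : ℝ) : Prop extends SCurve c c1 c2 n δ d0 L where
  hδ : 0 < δ
  hr : 0 < r
  c0 : c 0 = x0
  pos : ∀ s t, |s| < δ → 0 < t → t < δ → c s + t • n ∈ Ω
  zero : ∀ s, |s| < δ → c s ∈ frontier Ω
  neg : ∀ s t, |s| < δ → -δ < t → t ≤ 0 → c s + t • n ∉ Ω
  surj : ∀ x, dist x x0 < r → ∃ s t, |s| < δ ∧ |t| < δ ∧ x = c s + t • n
  inv : ∀ s t s' t', |s| < δ → |t| < δ → |s'| < δ → |t'| < δ →
    |s - s'| ≤ L * dist (c s + t • n) (c s' + t' • n) ∧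
    |t - t'| ≤ L * dist (c s + t • n) (c s' + t' • n)

lemma sd_sqrt_le {d C : ℝ} (h0 : 0 ≤ d) (h : d ≤ C ^ 2) (hC : 0 ≤ C) : d ≤ C * √d := by
  have h1 : √d ≤ C := by rw [Real.sqrt_le_left hC]; exact h
  calc d = √d * √d := (Real.mul_self_sqrt h0).symm
    _ ≤ C * √d := by gcongr

lemma sd_C1_HB {h : ℝ → ℝ} (hh : ContDiff ℝ 1 h) (s0 : ℝ) :
    ∃ L, 1 ≤ L ∧ HB (Metric.ball 0 1) (fun s => h (s0 + s)) L := by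
  have hc0 := hh.continuous
  have hc1 : Continuous (deriv h) := hh.continuous_deriv le_rfl
  obtain ⟨A, hA⟩ := (isCompact_Icc (a := s0 - 1) (b := s0 + 1)).exists_bound_of_continuousOn hc0.continuousOn
  obtain ⟨B, hB⟩ := (isCompact_Icc (a := s0 - 1) (b := s0 + 1)).exists_bound_of_continuousOn hc1.continuousOn
  have hA0 : 0 ≤ A := (norm_nonneg _).trans (hA s0 ⟨by linarith, by linarith⟩)
  have hB0 : 0 ≤ B := (norm_nonneg _).trans (hB s0 ⟨by linarith, by linarith⟩)
  refine ⟨A + 2 * B + 1, by linarith, (HB.of_bounds (c := A) (d := 2 * B) hA0 ?_ (by positivity) ?_).mono (by linarith)⟩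
  · intro s hs
    rw [mem_ball_zero_iff, Real.norm_eq_abs, abs_lt] at hs
    exact hA _ ⟨by linarith, by linarith⟩
  · intro s hs t ht
    rw [mem_ball_zero_iff, Real.norm_eq_abs, abs_lt] at hs ht
    have h1 := (convex_Icc (s0 - 1) (s0 + 1)).norm_image_sub_le_of_norm_deriv_le (f := h) (C := B)
      (fun x _ => (hh.differentiable one_ne_zero).differentiableAt) hB
      (x := s0 + t) (y := s0 + s) ⟨by linarith, by linarith⟩ ⟨by linarith, by linarith⟩
    have e : s0 + s - (s0 + t) = s - t := by ring
    rw [e] at h1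
    have h2 : |s - t| ≤ 2 := by rw [abs_le]; constructor <;> linarith
    have h3 := sd_sqrt_le (C := 2) (abs_nonneg (s - t)) (by linarith) (by norm_num)
    rw [Real.dist_eq]
    calc _ ≤ B * |s - t| := h1
      _ ≤ B * (2 * √|s - t|) := by gcongr
      _ = _ := by ring

lemma sd_chart_aux {Ω : Set (ℝ × ℝ)} (hΩ : IsOpen Ω) {x0 : ℝ × ℝ} {c c1 c2 : ℝ → ℝ × ℝ} {n : ℝ × ℝ}
    {δ r d0 L L' : ℝ} (hC : SCurve c c1 c2 n δ d0 L) (hδ : 0 < δ) (hr : 0 < r) (c0 : c 0 = x0)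
    (hcont : Continuous c)
    (hz : ∀ s, c s ∈ frontier Ω) (hni : x0 ∉ interior (closure Ω))
    (hinv : ∀ x y : ℝ × ℝ, ‖x‖ < δ → ‖y‖ < δ →
      ‖x - y‖ ≤ L' * dist (c x.1 + x.2 • n) (c y.1 + y.2 • n))
    (hsurj : ∀ y, dist y x0 < r → ∃ x : ℝ × ℝ, ‖x‖ < δ ∧ y = c x.1 + x.2 • n)
    (hplus : (∀ x : ℝ × ℝ, ‖x‖ < δ → 0 < x.2 → c x.1 + x.2 • n ∈ Ω) ∨
      (∀ x : ℝ × ℝ, ‖x‖ < δ → 0 < x.2 → c x.1 + x.2 • n ∉ closure Ω))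
    (hminus : (∀ x : ℝ × ℝ, ‖x‖ < δ → x.2 < 0 → c x.1 + x.2 • n ∈ Ω) ∨
      (∀ x : ℝ × ℝ, ‖x‖ < δ → x.2 < 0 → c x.1 + x.2 • n ∉ closure Ω)) :
    ∃ n' L'', SChart Ω x0 c c1 c2 n' δ r d0 L'' := by
  have hzn : ∀ s, c s ∉ Ω := fun s h => by
    have := hz s
    rw [hΩ.frontier_eq] at this
    exact this.2 h
  have hzc : ∀ s, c s ∈ closure Ω := fun s => frontier_subset_closure (hz s)
  have key : ∀ σ : ℝ, (σ = 1 ∨ σ = -1) →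
      (∀ x : ℝ × ℝ, ‖x‖ < δ → 0 < x.2 → c x.1 + x.2 • (σ • n) ∈ Ω) →
      (∀ x : ℝ × ℝ, ‖x‖ < δ → x.2 < 0 → c x.1 + x.2 • (σ • n) ∉ closure Ω) →
      ∃ n' L'', SChart Ω x0 c c1 c2 n' δ r d0 L'' := by
    intro σ hσ h1 h2
    have hσ1 : |σ| = 1 := by rcases hσ with rfl | rfl <;> simp
    have hσ2 : σ * σ = 1 := by rcases hσ with rfl | rfl <;> simp
    refine ⟨σ • n, max L L', ⟨⟨hC.L1.trans (le_max_left _ _), hC.hd0, hC.d1, hC.d2,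
      hC.b11.mono (le_max_left _ _), hC.b12.mono (le_max_left _ _), hC.b21.mono (le_max_left _ _),
      hC.b22.mono (le_max_left _ _), ?_, ?_, ?_⟩, hδ, hr, c0, ?_, ?_, ?_, ?_, ?_⟩⟩
    · simp only [Prod.smul_fst, smul_eq_mul, abs_mul, hσ1, one_mul]; exact hC.n1.trans (le_max_left _ _)
    · simp only [Prod.smul_snd, smul_eq_mul, abs_mul, hσ1, one_mul]; exact hC.n2.trans (le_max_left _ _)
    · intro s hs
      have : (c1 s).1 * (σ • n).2 - (c1 s).2 * (σ • n).1 = σ * ((c1 s).1 * n.2 - (c1 s).2 * n.1) := by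
        simp; ring
      rw [this, abs_mul, hσ1, one_mul]; exact hC.det s hs
    · intro s t hs ht ht'
      exact h1 (s, t) (by rw [sd_norm_lt]; exact ⟨hs, by rw [abs_of_pos ht]; exact ht'⟩) ht
    · intro s _; exact hz s
    · intro s t hs ht ht'
      rcases ht'.eq_or_lt with rfl | h
      · simpa using hzn s
      · intro hmem
        exact h2 (s, t) (by rw [sd_norm_lt]; exact ⟨hs, by rw [abs_of_neg h]; linarith⟩) h
          (subset_closure hmem)
    · intro x hx
      obtain ⟨y, hy, hy2⟩ := hsurj x hx
      rw [sd_norm_lt] at hy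
      refine ⟨y.1, σ * y.2, hy.1, by rw [abs_mul, hσ1, one_mul]; exact hy.2, ?_⟩
      rw [hy2, smul_smul]
      congr 2
      linear_combination (-y.2) * hσ2
    · intro s t s' t' hs ht hs' ht'
      have := hinv (s, t * σ) (s', t' * σ) (by rw [sd_norm_lt]; simp [abs_mul, hσ1, hs, ht])
        (by rw [sd_norm_lt]; simp [abs_mul, hσ1, hs', ht'])
      simp only [smul_smul]
      have h3 : L' * dist (c s + (t * σ) • n) (c s' + (t' * σ) • n) ≤
        max L L' * dist (c s + (t * σ) • n) (c s' + (t' * σ) • n) := by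
        gcongr; exact le_max_right _ _
      constructor
      · have h4 := norm_fst_le ((s, t * σ) - (s', t' * σ))
        simp only [Prod.fst_sub, Real.norm_eq_abs] at h4
        exact h4.trans (this.trans h3)
      · have h4 := norm_snd_le ((s, t * σ) - (s', t' * σ))
        simp only [Prod.snd_sub, Real.norm_eq_abs] at h4
        have e : t * σ - t' * σ = σ * (t - t') := by ring
        rw [e, abs_mul, hσ1, one_mul] at h4
        exact h4.trans (this.trans h3)
  rcases hplus with h1 | h1 <;> rcases hminus with h2 | h2
  · exfalso
    apply hni
    rw [mem_interior]
    refine ⟨Metric.ball x0 r, fun y hy => ?_, Metric.isOpen_ball, Metric.mem_ball_self hr⟩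
    obtain ⟨x, hx, rfl⟩ := hsurj y hy
    rcases lt_trichotomy x.2 0 with h | h | h
    · exact subset_closure (h2 x hx h)
    · rw [h]; simpa using hzc x.1
    · exact subset_closure (h1 x hx h)
  · exact key 1 (Or.inl rfl) (by simpa using h1) (by simpa using h2)
  · refine key (-1) (Or.inr rfl) (fun x hx h => ?_) (fun x hx h => ?_)
    · have := h2 (x.1, -x.2) (by rw [sd_norm_lt] at hx ⊢; simpa using hx) (by simpa using h)
      simpa using this
    · have := h1 (x.1, -x.2) (by rw [sd_norm_lt] at hx ⊢; simpa using hx) (by simpa using h)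
      simpa using this
  · exfalso
    have hx0 : x0 ∈ closure Ω := by rw [← c0]; exact hzc 0
    obtain ⟨y, hy, hy2⟩ := Metric.mem_closure_iff.mp hx0 r hr
    rw [dist_comm] at hy2
    obtain ⟨x, hx, rfl⟩ := hsurj y hy2
    rcases lt_trichotomy x.2 0 with h | h | h
    · exact h2 x hx h (subset_closure hy)
    · rw [h] at hy; exact hzn x.1 (by simpa using hy)
    · exact h1 x hx h (subset_closure hy)

lemma sd_chart {Ω : Set (ℝ × ℝ)} (hΩ : IsAnalyticJordanDomain Ω) (x0 : ℝ × ℝ) (hx0 : x0 ∈ frontier Ω) :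
    ∃ c c1 c2 n δ r d0 L, SChart Ω x0 c c1 c2 n δ r d0 L := by
  obtain ⟨ho, hbd, hconn, γ, T, hT, han, hp, hi, hv, hfr⟩ := hΩ
  have hγ : ContDiff ℝ 3 γ := han.contDiff
  rw [hfr] at hx0
  obtain ⟨s0, rfl⟩ := hx0
  have hγ1 : ContDiff ℝ 2 (deriv γ) := ((contDiff_succ_iff_deriv (n := 2)).mp hγ).2.2
  have hγ2 : ContDiff ℝ 1 (deriv (deriv γ)) := ((contDiff_succ_iff_deriv (n := 1)).mp hγ1).2.2
  obtain ⟨L1, hL1, hb1⟩ := sd_C1_HB (h := fun s => (deriv γ s).1) ((hγ1.of_le (by norm_num)).fst) s0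
  obtain ⟨L2, hL2, hb2⟩ := sd_C1_HB (h := fun s => (deriv γ s).2) ((hγ1.of_le (by norm_num)).snd) s0
  obtain ⟨L3, hL3, hb3⟩ := sd_C1_HB (h := fun s => (deriv (deriv γ) s).1) hγ2.fst s0
  obtain ⟨L4, hL4, hb4⟩ := sd_C1_HB (h := fun s => (deriv (deriv γ) s).2) hγ2.snd s0
  set v := deriv γ s0 with hvd
  set n : ℝ × ℝ := (-v.2, v.1) with hn
  have hdpos : 0 < v.1 ^ 2 + v.2 ^ 2 := by
    rcases eq_or_ne v.1 0 with h | h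
    · have : v.2 ≠ 0 := fun h' => hv s0 (by rw [← hvd]; exact Prod.ext h h')
      positivity
    · positivity
  set d0 := (v.1 ^ 2 + v.2 ^ 2) / 2 with hd0
  have hcd : Continuous (fun s => (deriv γ (s0 + s)).1 * n.2 - (deriv γ (s0 + s)).2 * n.1) := by
    have := hγ1.continuous
    fun_prop
  have hev : ∀ᶠ s in 𝓝 (0:ℝ), d0 < (deriv γ (s0 + s)).1 * n.2 - (deriv γ (s0 + s)).2 * n.1 := by
    apply hcd.continuousAt.eventually_const_lt
    simp only [add_zero, ← hvd, hn]
    rw [hd0]; nlinarith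
  obtain ⟨δ1, hδ1, hδ1'⟩ := Metric.eventually_nhds_iff.mp hev
  obtain ⟨δ, L5, r, hδ, hδ2, hL5, hr, hinv, hsurj, hplus, hminus⟩ :=
    sd_loc2 ho hT hp hi hγ hfr s0 (hv s0) n hn (min δ1 1) (lt_min hδ1 one_pos)
  have hsub : Metric.ball (0:ℝ) δ ⊆ Metric.ball 0 1 := Metric.ball_subset_ball (hδ2.trans (min_le_right _ _))
  set L := L1 + L2 + L3 + L4 + |n.1| + |n.2| with hL
  have ha1 := abs_nonneg n.1
  have ha2 := abs_nonneg n.2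
  have hC : SCurve (fun s => γ (s0 + s)) (fun s => deriv γ (s0 + s)) (fun s => deriv (deriv γ) (s0 + s)) n δ d0 L := by
    refine ⟨by linarith, by rw [hd0]; linarith, ?_, ?_, (hb1.subset hsub).mono (by linarith),
      (hb2.subset hsub).mono (by linarith), (hb3.subset hsub).mono (by linarith),
      (hb4.subset hsub).mono (by linarith), by linarith, by linarith, ?_⟩
    · intro s _
      have := ((hγ.differentiable (by norm_num)) (s0 + s)).hasDerivAt
      exact this.comp_const_add s0 s
    · intro s _
      have := ((hγ1.differentiable (by norm_num)) (s0 + s)).hasDerivAt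
      exact this.comp_const_add s0 s
    · intro s hs
      have := hδ1' (y := s) (by rw [Real.dist_eq, sub_zero]; exact hs.trans_le (hδ2.trans (min_le_left _ _)))
      exact this.le.trans (le_abs_self _)
  obtain ⟨n', L', h⟩ := sd_chart_aux ho hC hδ hr (by simp) (by have := hγ.continuous; fun_prop)
    (fun s => by rw [hfr]; exact mem_range_self _)
    (sd_not_int ho hbd hconn.nonempty hT hp hi hγ hfr hv s0) hinv hsurj hplus hminus
  exact ⟨_, _, _, _, _, _, _, _, h⟩

lemma sd_fr_alg {a b c D v1 v2 e1 e2 n1 n2 W : ℝ} (hW : v1 * n2 - v2 * n1 = W) (hW0 : W ≠ 0)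
    (hD : D ≠ 0) (hD2 : D ^ 2 = a * c - b ^ 2) (he1 : e1 = (b * v1 - a * v2) / D)
    (he2 : e2 = (c * v1 - b * v2) / D) :
    let Q := c * v1 ^ 2 - 2 * b * v1 * v2 + a * v2 ^ 2
    let β := (e1 * n2 - e2 * n1) / W
    let κ := (Q / D) / W
    let μ := Q / D ^ 2
    e1 = β * v1 + κ * n1 ∧ e2 = β * v2 + κ * n2 ∧ v1 ^ 2 + e1 ^ 2 = μ * a ∧
      v1 * v2 + e1 * e2 = μ * b ∧ v2 ^ 2 + e2 ^ 2 = μ * c ∧ v1 * e2 - v2 * e1 = Q / D := by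
  intro Q β κ μ
  have hq : v1 * e2 - v2 * e1 = Q / D := by
    rw [he1, he2]; simp only [Q]; field_simp; ring
  refine ⟨?_, ?_, ?_, ?_, ?_, hq⟩
  · simp only [β, κ]; rw [← hq]; field_simp; rw [← hW]; ring
  · simp only [β, κ]; rw [← hq]; field_simp; rw [← hW]; ring
  · simp only [μ, Q]; rw [he1, div_pow, eq_comm, div_mul_eq_mul_div, div_eq_iff (pow_ne_zero 2 hD), add_mul (v1 ^ 2),
      div_mul_cancel₀ _ (pow_ne_zero 2 hD), hD2]; ring
  · simp only [μ, Q]; rw [he1, he2, div_mul_div_comm, ← pow_two, eq_comm, div_mul_eq_mul_div, div_eq_iff (pow_ne_zero 2 hD), add_mul (v1 * v2),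
      div_mul_cancel₀ _ (pow_ne_zero 2 hD), hD2]; ring
  · simp only [μ, Q]; rw [he2, div_pow, eq_comm, div_mul_eq_mul_div, div_eq_iff (pow_ne_zero 2 hD), add_mul (v2 ^ 2),
      div_mul_cancel₀ _ (pow_ne_zero 2 hD), hD2]; ring

lemma sd_abs_mul {x y X Y : ℝ} (hx : |x| ≤ X) (hy : |y| ≤ Y) : |x * y| ≤ X * Y := by
  rw [abs_mul]; exact mul_le_mul hx hy (abs_nonneg _) ((abs_nonneg _).trans hx)

lemma sd_abs_sub {x y X Y : ℝ} (hx : |x| ≤ X) (hy : |y| ≤ Y) : |x - y| ≤ X + Y :=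
  (abs_sub _ _).trans (add_le_add hx hy)

lemma sd_abs_div {x y X Y : ℝ} (hx : |x| ≤ X) (hY : 0 < Y) (hy : Y ≤ |y|) : |x / y| ≤ X / Y := by
  rw [abs_div]; exact div_le_div₀ ((abs_nonneg _).trans hx) hx hY hy

set_option maxHeartbeats 800000 in
lemma sd_frame (Λ L d0 : ℝ) (hΛ : 1 ≤ Λ) (hL : 1 ≤ L) (hd0 : 0 < d0) :
    ∃ E d1 : ℝ, 1 ≤ E ∧ 0 < d1 ∧ ∀ a b c v1 v2 n1 n2 : ℝ, |a| ≤ Λ → |b| ≤ Λ → |c| ≤ Λ →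
      (∀ v w : ℝ, v ^ 2 + w ^ 2 ≤ a * v ^ 2 + 2 * b * v * w + c * w ^ 2) → 1 ≤ a * c - b ^ 2 →
      |v1| ≤ L → |v2| ≤ L → |n1| ≤ L → |n2| ≤ L → d0 ≤ |v1 * n2 - v2 * n1| →
      ∃ β κ μ : ℝ, |β| ≤ E ∧ κ ≤ E ∧ |μ| ≤ E ∧ d1 ≤ κ ∧
        v1 ^ 2 + (β * v1 + κ * n1) ^ 2 = μ * a ∧
        v1 * v2 + (β * v1 + κ * n1) * (β * v2 + κ * n2) = μ * b ∧
        v2 ^ 2 + (β * v2 + κ * n2) ^ 2 = μ * c ∧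
        d1 ≤ |v1 * (β * v2 + κ * n2) - v2 * (β * v1 + κ * n1)| := by
  set Q0 := d0 ^ 2 / (2 * L ^ 2) with hQ0
  have hQ0p : 0 < Q0 := by positivity
  set QM := Λ * (L * L) * 4 with hQM
  have hQM0 : 0 < QM := by positivity
  set eM := 2 * (Λ * L) with heM
  have heM0 : 0 < eM := by positivity
  refine ⟨1 + 2 * (eM * L) / d0 + QM / d0 + QM, min (Q0 / (2 * Λ) / (2 * (L * L))) (Q0 / (2 * Λ)), ?_, by positivity, ?_⟩
  · have : 0 ≤ 2 * (eM * L) / d0 + QM / d0 + QM := by positivity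
    linarith
  intro a b c v1 v2 n1 n2 ha hb hc hell hdet hv1 hv2 hn1 hn2 hd
  set W := v1 * n2 - v2 * n1 with hW
  have hW0 : W ≠ 0 := by
    intro h; rw [h, abs_zero] at hd; linarith
  set σ : ℝ := if 0 < W then 1 else -1 with hσ
  have hσW : σ * W = |W| := by
    rw [hσ]; split_ifs with h
    · rw [abs_of_pos h, one_mul]
    · rw [abs_of_nonpos (not_lt.mp h)]; ring
  have hσ2 : σ ^ 2 = 1 := by rw [hσ]; split_ifs <;> norm_num
  have hσ1 : |σ| = 1 := by rw [hσ]; split_ifs <;> norm_num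
  have hσ0 : σ ≠ 0 := by intro h; rw [h] at hσ2; norm_num at hσ2
  set d := √(a * c - b ^ 2) with hdd
  have hd2 : d ^ 2 = a * c - b ^ 2 := Real.sq_sqrt (by linarith)
  have hd1 : 1 ≤ d := by rw [hdd]; exact Real.one_le_sqrt.mpr hdet
  have hdM : d ≤ 2 * Λ := by
    have h1 : a * c ≤ Λ * Λ := (le_abs_self _).trans (sd_abs_mul ha hc)
    have := sq_nonneg b
    nlinarith only [hd2, h1, this, hd1, hΛ]
  have hD : σ * d ≠ 0 := mul_ne_zero hσ0 (by linarith)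
  have hDabs : |σ * d| = d := by rw [abs_mul, hσ1, one_mul, abs_of_pos (by linarith)]
  obtain ⟨h1, h2, h3, h4, h5, h6⟩ := sd_fr_alg (a := a) (b := b) (c := c) (D := σ * d) (v1 := v1)
    (v2 := v2) (n1 := n1) (n2 := n2) hW.symm hW0 hD (by rw [mul_pow, hσ2, one_mul, hd2]) rfl rfl
  set e1 := (b * v1 - a * v2) / (σ * d) with he1
  set e2 := (c * v1 - b * v2) / (σ * d) with he2
  set Q := c * v1 ^ 2 - 2 * b * v1 * v2 + a * v2 ^ 2 with hQ
  have hQl : Q0 ≤ Q := by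
    have h7 := hell (-v2) v1
    have h8 : v1 ^ 2 + v2 ^ 2 ≤ Q := by rw [hQ]; linarith
    refine le_trans ?_ h8
    rw [hQ0, div_le_iff₀ (by positivity)]
    have h9 : |W| ≤ |v1| * L + |v2| * L := by
      rw [hW]
      exact sd_abs_sub (sd_abs_mul le_rfl hn2) (sd_abs_mul le_rfl hn1)
    have h10 : d0 ^ 2 ≤ (|v1| * L + |v2| * L) ^ 2 := by
      gcongr; exact hd.trans h9
    refine h10.trans ?_
    have g0 : 0 ≤ L ^ 2 * (|v1| - |v2|) ^ 2 := by positivity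
    have g1 : (v1 ^ 2 + v2 ^ 2) * (2 * L ^ 2) - (|v1| * L + |v2| * L) ^ 2 = L ^ 2 * (|v1| - |v2|) ^ 2 := by
      linear_combination (-2 * L ^ 2) * sq_abs v1 + (-2 * L ^ 2) * sq_abs v2
    linarith
  have hQu : Q ≤ QM := by
    have g1 : |c * (v1 * v1)| ≤ Λ * (L * L) := sd_abs_mul hc (sd_abs_mul hv1 hv1)
    have g2 : |b * (v1 * v2)| ≤ Λ * (L * L) := sd_abs_mul hb (sd_abs_mul hv1 hv2)
    have g3 : |a * (v2 * v2)| ≤ Λ * (L * L) := sd_abs_mul ha (sd_abs_mul hv2 hv2)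
    have := abs_le.mp g1
    have := abs_le.mp g2
    have := abs_le.mp g3
    have e : Q = c * (v1 * v1) - 2 * (b * (v1 * v2)) + a * (v2 * v2) := by rw [hQ]; ring
    rw [e, hQM]; linarith
  have hQ0' : 0 < Q := hQ0p.trans_le hQl
  have hee1 : |e1| ≤ eM := by
    have := sd_abs_div (sd_abs_sub (sd_abs_mul hb hv1) (sd_abs_mul ha hv2)) one_pos (hDabs.symm ▸ hd1)
    rw [he1, heM]; linarith
  have hee2 : |e2| ≤ eM := by
    have := sd_abs_div (sd_abs_sub (sd_abs_mul hc hv1) (sd_abs_mul hb hv2)) one_pos (hDabs.symm ▸ hd1)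
    rw [he2, heM]; linarith
  have hβ : |(e1 * n2 - e2 * n1) / W| ≤ 2 * (eM * L) / d0 := by
    have := sd_abs_div (sd_abs_sub (sd_abs_mul hee1 hn2) (sd_abs_mul hee2 hn1)) hd0 hd
    refine this.trans (le_of_eq ?_); ring
  have hκe : Q / (σ * d) / W = Q / d / |W| := by
    rw [← hσW, div_div, div_div]; congr 1
    ring
  have hWM : |W| ≤ 2 * (L * L) := by
    have := sd_abs_sub (sd_abs_mul hv1 hn2) (sd_abs_mul hv2 hn1)
    rw [hW]; linarith
  have hWp : 0 < |W| := abs_pos.mpr hW0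
  have hdp : 0 < d := by linarith
  refine ⟨(e1 * n2 - e2 * n1) / W, Q / (σ * d) / W, Q / (σ * d) ^ 2, ?_, ?_, ?_, ?_, ?_⟩
  · refine hβ.trans ?_
    have : 0 ≤ QM / d0 + QM := by positivity
    linarith
  · rw [hκe]
    have g1 : Q / d / |W| ≤ QM / 1 / d0 := by gcongr
    have : 0 ≤ 2 * (eM * L) / d0 := by positivity
    rw [div_one] at g1
    linarith
  · rw [mul_pow, hσ2, one_mul, abs_of_pos (by positivity)]
    have g1 : Q / d ^ 2 ≤ QM / 1 ^ 2 := by gcongr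
    have : 0 ≤ 2 * (eM * L) / d0 + QM / d0 := by positivity
    norm_num at g1
    linarith
  · rw [hκe]
    refine (min_le_left _ _).trans ?_
    gcongr
  · rw [← h1, ← h2]
    refine ⟨h3, h4, h5, ?_⟩
    rw [h6, abs_div, hDabs, abs_of_pos hQ0']
    refine (min_le_right _ _).trans ?_
    gcongr

lemma sd_mkfr {Ω : Set (ℝ × ℝ)} {S : Set ℂ} {c c1 c2 : ℝ → ℝ × ℝ} {n : ℝ × ℝ} {δ d0 L : ℝ}
    (hC : SCurve c c1 c2 n δ d0 L) {s β κ E0 R E : ℝ} (hE0 : 1 ≤ E0) (hβ : |β| ≤ E0) (hκ : |κ| ≤ E0)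
    (hR : 0 < R)
    (hE : 4 * E0 * L ≤ E) (hs : |s| + 2 * E0 * R ≤ δ)
    (mc : ∀ z ∈ S ∩ Metric.ball 0 R, c (s + (z.re + β * z.im)) + (κ * z.im) • n ∈ closure Ω)
    (mi : ∀ z ∈ interior S ∩ Metric.ball 0 R, c (s + (z.re + β * z.im)) + (κ * z.im) • n ∈ Ω)
    (mf : S = sdUp → ∀ z : ℂ, z.im = 0 → ‖z‖ < R →
      c (s + (z.re + β * z.im)) + (κ * z.im) • n ∈ frontier Ω) :
    SFr Ω S (fun z => c (s + (z.re + β * z.im)) + (κ * z.im) • n)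
      (fun z => (c1 (s + (z.re + β * z.im))).1) (fun z => (c1 (s + (z.re + β * z.im))).2)
      (fun z => (c2 (s + (z.re + β * z.im))).1) (fun z => (c2 (s + (z.re + β * z.im))).2)
      β (κ * n.1) (κ * n.2) E R := by
  have hL := hC.L1
  have hlin : ∀ z w : ℂ, |(z.re + β * z.im) - (w.re + β * w.im)| ≤ 2 * E0 * dist z w := by
    intro z w
    have h1 := Complex.abs_re_le_norm (z - w)
    have h2 := Complex.abs_im_le_norm (z - w)
    rw [← dist_eq_norm] at h1 h2
    rw [Complex.sub_re] at h1; rw [Complex.sub_im] at h2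
    have e : (z.re + β * z.im) - (w.re + β * w.im) = (z.re - w.re) + β * (z.im - w.im) := by ring
    rw [e]
    have h3 := sd_abs_mul hβ h2
    have h4 := abs_add_le (z.re - w.re) (β * (z.im - w.im))
    have : 1 * dist z w ≤ E0 * dist z w := by gcongr
    linarith
  have hin : ∀ z : ℂ, ‖z‖ < R → |s + (z.re + β * z.im)| < δ := by
    intro z hz
    have h1 := hlin z 0
    simp only [Complex.zero_re, Complex.zero_im, mul_zero, add_zero, sub_zero, dist_zero_right] at h1
    have h2 := abs_add_le s (z.re + β * z.im)
    have : 2 * E0 * ‖z‖ < 2 * E0 * R := by gcongr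
    linarith
  have hmap : ∀ z ∈ S ∩ Metric.ball 0 R, s + (z.re + β * z.im) ∈ Metric.ball (0:ℝ) δ := by
    intro z hz
    rw [mem_ball_zero_iff, Real.norm_eq_abs]
    exact hin z (by simpa using hz.2)
  have hHB : ∀ h : ℝ → ℝ, HB (Metric.ball 0 δ) h L → HB (S ∩ Metric.ball 0 R) (fun z => h (s + (z.re + β * z.im))) E := by
    intro h hh
    refine (hh.comp (L := 2 * E0) (T' := S ∩ Metric.ball 0 R) (Ψ := fun z : ℂ => s + (z.re + β * z.im)) hmap (by linarith) ?_).mono ?_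
    · intro z _ w _
      rw [Real.dist_eq]
      have := hlin z w
      rwa [add_sub_add_left_eq_sub]
    · have : 0 ≤ E0 * L := by positivity
      linarith
  have hv0 := hC.b11.bd (x := s) (by
    have := hin 0 (by simpa using hR); simpa using this)
  have hv0' := hC.b12.bd (x := s) (by
    have := hin 0 (by simpa using hR); simpa using this)
  have hEE : E0 * L ≤ E := by
    have : 0 ≤ E0 * L := by positivity
    linarith
  have hE0L : E0 ≤ E0 * L := by nlinarith
  have hn1 := hC.n1
  have hn2 := hC.n2
  have hd : ∀ z : ℂ, ‖z‖ < R → HasDerivAt (fun σ => c (s + σ)) (c1 (s + (z.re + β * z.im))) (z.re + β * z.im) := by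
    intro z hz
    exact (hC.d1 _ (hin z hz)).comp_const_add s _
  have hd' : ∀ z : ℂ, ‖z‖ < R → HasDerivAt (fun σ => c1 (s + σ)) (c2 (s + (z.re + β * z.im))) (z.re + β * z.im) := by
    intro z hz
    exact (hC.d2 _ (hin z hz)).comp_const_add s _
  have himd : ∀ (k : ℝ) (z : ℂ), HasFDerivAt (fun z : ℂ => κ * z.im * k) (sdR 0 (κ * k)) z := by
    intro k z
    refine ((sdR 0 (κ * k)).hasFDerivAt (x := z)).congr_of_eventuallyEq (Eventually.of_forall fun w => ?_)
    simp [sdR_apply]; ring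
  refine ⟨by linarith, ?_, ?_, ?_, hHB _ hC.b11, hHB _ hC.b12, hHB _ hC.b21, hHB _ hC.b22,
    by linarith, ?_, ?_, ?_, ?_, ?_, mc, mi, mf⟩
  · intro z _ hz
    have h1 : HasDerivAt (fun σ => (c (s + σ)).1) _ _ := (hd z hz).fst
    have h2 : HasDerivAt (fun σ => (c (s + σ)).2) _ _ := (hd z hz).snd
    have g1 := (sd_curve_comp h1).add (himd n.1 z)
    have g2 := (sd_curve_comp h2).add (himd n.2 z)
    have g := g1.prodMk g2
    refine (g.congr_fderiv ?_)
    ext <;> simp [sdR_apply] <;> ring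
  · intro z _ hz
    have h1 : HasDerivAt (fun σ => (c1 (s + σ)).1) _ _ := (hd' z hz).fst
    exact sd_curve_comp h1
  · intro z _ hz
    have h1 : HasDerivAt (fun σ => (c1 (s + σ)).2) _ _ := (hd' z hz).snd
    exact sd_curve_comp h1
  · exact (sd_abs_mul hκ hn1).trans hEE
  · exact (sd_abs_mul hκ hn2).trans hEE
  · have h1 := sd_abs_mul hβ hv0
    have h2 := sd_abs_mul hκ hn1
    simp only [Complex.zero_re, Complex.zero_im, mul_zero, add_zero]
    refine (abs_add_le _ _).trans ?_
    have : 0 ≤ E0 * L := by positivity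
    linarith
  · have h1 := sd_abs_mul hβ hv0'
    have h2 := sd_abs_mul hκ hn2
    simp only [Complex.zero_re, Complex.zero_im, mul_zero, add_zero]
    refine (abs_add_le _ _).trans ?_
    have : 0 ≤ E0 * L := by positivity
    linarith
  · intro z hz w hw
    have hlip : ‖c (s + (z.re + β * z.im)) - c (s + (w.re + β * w.im))‖ ≤
        L * ‖(s + (z.re + β * z.im)) - (s + (w.re + β * w.im))‖ := by
      refine (convex_ball (0:ℝ) δ).norm_image_sub_le_of_norm_hasDerivWithin_le (f := c) (f' := c1)
        (fun x hx => (hC.d1 x (by simpa using hx)).hasDerivWithinAt) ?_ (hmap w hw) (hmap z hz)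
      intro x hx
      rw [Prod.norm_def, max_le_iff]
      exact ⟨hC.b11.bd hx, hC.b12.bd hx⟩
    rw [add_sub_add_left_eq_sub, Real.norm_eq_abs] at hlip
    have h1 := hlin z w
    have h2 : ‖n‖ ≤ L := by rw [Prod.norm_def, max_le_iff]; exact ⟨hn1, hn2⟩
    have h3 := Complex.abs_im_le_norm (z - w)
    rw [← dist_eq_norm, Complex.sub_im] at h3
    have h4 : |κ * (z.im - w.im)| * ‖n‖ ≤ E0 * dist z w * L := by
      have := sd_abs_mul hκ h3
      gcongr
    have e : c (s + (z.re + β * z.im)) + (κ * z.im) • n - (c (s + (w.re + β * w.im)) + (κ * w.im) • n) =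
      (c (s + (z.re + β * z.im)) - c (s + (w.re + β * w.im))) + (κ * (z.im - w.im)) • n := by
      rw [mul_sub, sub_smul]; abel
    rw [dist_eq_norm (_ + _), e]
    refine (norm_add_le _ _).trans ?_
    rw [norm_smul, Real.norm_eq_abs]
    have h5 : L * |(z.re + β * z.im) - (w.re + β * w.im)| ≤ L * (2 * E0 * dist z w) := by gcongr
    have h6 : 4 * E0 * L * dist z w ≤ E * dist z w := by gcongr
    have : 0 ≤ E0 * L * dist z w := by positivity
    nlinarith

def SEst (Ω : Set (ℝ × ℝ)) (a b c b1 b2 : ℝ × ℝ → ℝ) (η K : ℝ) (x y : ℝ × ℝ) (ρ : ℝ) : Prop :=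
  ∀ u p q r s t g B H G, SDat Ω u p q r s t → SBd Ω p q r s t g B H G →
    (∀ x ∈ closure Ω, g x = a x * r x + 2 * b x * s x + c x * t x + b1 x * p x + b2 x * q x) →
    |r x - r y| ≤ (η * H + K * (B + G)) * √ρ ∧ |s x - s y| ≤ (η * H + K * (B + G)) * √ρ ∧
    |t x - t y| ≤ (η * H + K * (B + G)) * √ρ

lemma SCoef.mono {Ω : Set (ℝ × ℝ)} {a b c b1 b2 : ℝ × ℝ → ℝ} {Λ Λ' : ℝ}
    (h : SCoef Ω a b c b1 b2 Λ) (hL : Λ ≤ Λ') : SCoef Ω a b c b1 b2 Λ' :=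
  ⟨h.ha.mono hL, h.hb.mono hL, h.hc.mono hL, h.hb1.mono hL, h.hb2.mono hL, h.ell, h.det⟩

lemma SEst.symm {Ω : Set (ℝ × ℝ)} {a b c b1 b2 : ℝ × ℝ → ℝ} {η K : ℝ} {x y : ℝ × ℝ} {ρ : ℝ}
    (h : SEst Ω a b c b1 b2 η K x y ρ) : SEst Ω a b c b1 b2 η K y x ρ := by
  intro u p q r s t g B H G h1 h2 h3
  obtain ⟨g1, g2, g3⟩ := h u p q r s t g B H G h1 h2 h3
  rw [abs_sub_comm] at g1 g2 g3
  exact ⟨g1, g2, g3⟩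

lemma SEst.trans {Ω : Set (ℝ × ℝ)} {a b c b1 b2 : ℝ × ℝ → ℝ} {η K : ℝ} {x y z : ℝ × ℝ} {ρ : ℝ}
    (h : SEst Ω a b c b1 b2 η K x y ρ) (h' : SEst Ω a b c b1 b2 η K y z ρ) :
    SEst Ω a b c b1 b2 (2 * η) (2 * K) x z ρ := by
  intro u p q r s t g B H G h1 h2 h3
  obtain ⟨g1, g2, g3⟩ := h u p q r s t g B H G h1 h2 h3
  obtain ⟨k1, k2, k3⟩ := h' u p q r s t g B H G h1 h2 h3
  have e : (2 * η * H + 2 * K * (B + G)) * √ρ = (η * H + K * (B + G)) * √ρ + (η * H + K * (B + G)) * √ρ := by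
    ring
  rw [e]
  exact ⟨(abs_sub_le _ _ _).trans (add_le_add g1 k1), (abs_sub_le _ _ _).trans (add_le_add g2 k2),
    (abs_sub_le _ _ _).trans (add_le_add g3 k3)⟩

lemma SEst.mono {Ω : Set (ℝ × ℝ)} {a b c b1 b2 : ℝ × ℝ → ℝ} {η K K' : ℝ} {x y : ℝ × ℝ} {ρ : ℝ}
    (h : SEst Ω a b c b1 b2 η K x y ρ) (hK : K ≤ K') :
    SEst Ω a b c b1 b2 η K' x y ρ := by
  intro u p q r s t g B H G h1 h2 h3
  obtain ⟨g1, g2, g3⟩ := h u p q r s t g B H G h1 h2 h3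
  have hBG : 0 ≤ B + G := add_nonneg h2.B0.le h2.hg.nonneg
  have e : (η * H + K * (B + G)) * √ρ ≤ (η * H + K' * (B + G)) * √ρ := by gcongr
  exact ⟨g1.trans e, g2.trans e, g3.trans e⟩

lemma sd_znorm {re im A B ρ : ℝ} (h1 : |re| ≤ A * ρ) (h2 : |im| ≤ B * ρ) :
    ‖(⟨re, im⟩ : ℂ)‖ ≤ (A + B) * ρ := by
  have := Complex.norm_le_abs_re_add_abs_im (⟨re, im⟩ : ℂ)
  simp only at this
  linarith

lemma sd_blow_curve (S : Set ℂ) (hS : S = univ ∨ S = sdUp) (Λ L d0 A T η : ℝ) (hΛ : 1 ≤ Λ) (hL : 1 ≤ L)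
    (hd0 : 0 < d0) (hA : 0 ≤ A) (hT : 0 < T) (hη : 0 < η) :
    ∃ R K, 0 < R ∧ 0 < K ∧ ∀ (Ω : Set (ℝ × ℝ)) (a b c b1 b2 : ℝ × ℝ → ℝ) (γ c1 c2 : ℝ → ℝ × ℝ) (n : ℝ × ℝ)
      (δ s ρ : ℝ), SCoef Ω a b c b1 b2 Λ → SCurve γ c1 c2 n δ d0 L → 0 < ρ → |s| + R * ρ ≤ δ →
      γ s ∈ closure Ω →
      (∀ σ τ, |σ - s| < R * ρ → |τ| < R * ρ → (0 ≤ τ ∨ S = univ) → γ σ + τ • n ∈ closure Ω) →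
      (∀ σ τ, |σ - s| < R * ρ → |τ| < R * ρ → (0 < τ ∨ S = univ) → γ σ + τ • n ∈ Ω) →
      (S = sdUp → ∀ σ, |σ - s| < R * ρ → γ σ ∈ frontier Ω) →
      ∀ σ τ, |σ - s| ≤ A * ρ → |τ| ≤ T * ρ → (0 ≤ τ ∨ S = univ) →
        SEst Ω a b c b1 b2 η K (γ σ + τ • n) (γ s) ρ := by
  obtain ⟨E0, d1, hE0, hd1, hfr⟩ := sd_frame Λ L d0 hΛ hL hd0
  have hET : 0 < T / d1 := by positivity
  obtain ⟨R, hR, hMR, K, hK, hblow⟩ := sd_blow S hS (max (4 * E0 * L) Λ) d1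
    ((A + E0 * (T / d1)) + T / d1) η (hΛ.trans (le_max_right _ _)) hd1 (by positivity) hη
  have hE0p : 0 < E0 := by linarith
  refine ⟨2 * E0 * R, K, by positivity, hK, ?_⟩
  intro Ω a b c b1 b2 γ c1 c2 n δ s ρ hco hC hρ hs hsc mc mi mf σ τ hσ hτ hτ0
  have hRρ : 0 < R * ρ := by positivity
  have hsδ : |s| < δ := by
    have : 0 < 2 * E0 * R * ρ := by positivity
    linarith
  have hsb : s ∈ Metric.ball (0:ℝ) δ := by simpa using hsδ
  obtain ⟨β, κ, μ, hβ, hκ, hμ, hκ1, f1, f2, f3, f4⟩ := hfr (a (γ s)) (b (γ s)) (c (γ s)) (c1 s).1 (c1 s).2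
    n.1 n.2 (hco.ha.bd hsc) (hco.hb.bd hsc) (hco.hc.bd hsc) (hco.ell _ hsc) (hco.det _ hsc)
    (hC.b11.bd hsb) (hC.b12.bd hsb) hC.n1 hC.n2 (hC.det s hsδ)
  have hκ0 : 0 < κ := hd1.trans_le hκ1
  have hκa : |κ| ≤ E0 := by rw [abs_of_pos hκ0]; exact hκ
  have hlin : ∀ z : ℂ, ‖z‖ < R * ρ → |s + (z.re + β * z.im) - s| < 2 * E0 * R * ρ ∧ |κ * z.im| < 2 * E0 * R * ρ := by
    intro z hz
    have h1 := Complex.abs_re_le_norm z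
    have h2 := Complex.abs_im_le_norm z
    have h3 := sd_abs_mul hβ h2
    have h4 := sd_abs_mul hκa h2
    have h5 := abs_add_le z.re (β * z.im)
    have h6 : E0 * ‖z‖ < E0 * (R * ρ) := by gcongr
    have h7 : 1 * (R * ρ) ≤ E0 * (R * ρ) := by gcongr
    rw [add_sub_cancel_left]
    constructor <;> linarith
  have hz0 : s + ((0:ℂ).re + β * (0:ℂ).im) = s := by simp
  have hF : SFr Ω S (fun z => γ (s + (z.re + β * z.im)) + (κ * z.im) • n)
      (fun z => (c1 (s + (z.re + β * z.im))).1) (fun z => (c1 (s + (z.re + β * z.im))).2)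
      (fun z => (c2 (s + (z.re + β * z.im))).1) (fun z => (c2 (s + (z.re + β * z.im))).2)
      β (κ * n.1) (κ * n.2) (max (4 * E0 * L) Λ) (R * ρ) := by
    refine sd_mkfr hC hE0 hβ hκa hRρ (le_max_left _ _) (by linarith) ?_ ?_ ?_
    · intro z hz
      obtain ⟨h1, h2⟩ := hlin z (by simpa using hz.2)
      refine mc _ _ h1 h2 ?_
      rcases hS with h | h
      · exact Or.inr h
      · left
        have : 0 ≤ z.im := by have := hz.1; rw [h] at this; exact this
        positivity
    · intro z hz
      obtain ⟨h1, h2⟩ := hlin z (by simpa using hz.2)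
      refine mi _ _ h1 h2 ?_
      rcases hS with h | h
      · exact Or.inr h
      · left
        have : 0 < z.im := by
          have := hz.1; rw [h, sdUp, Complex.interior_setOfPred_le_im] at this; exact this
        positivity
    · intro h z hz1 hz2
      obtain ⟨h1, -⟩ := hlin z hz2
      have := mf h _ h1
      rw [hz1] at this ⊢
      simpa using this
  intro u p q r s' t g B H G hD hB hg
  set w : ℂ := ⟨(σ - s) - β * (τ / κ), τ / κ⟩ with hw
  have hτκ : |τ / κ| ≤ T / d1 * ρ := by
    have := sd_abs_div hτ hd1 (hκ1.trans (le_abs_self κ))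
    rw [div_mul_eq_mul_div]; exact this
  have hwn : ‖w‖ ≤ ((A + E0 * (T / d1)) + T / d1) * ρ := by
    refine sd_znorm ?_ hτκ
    have := sd_abs_sub hσ (sd_abs_mul hβ hτκ)
    linarith
  have hwS : w ∈ S := by
    rcases hS with h | h
    · rw [h]; exact mem_univ _
    · rcases hτ0 with h' | h'
      · rw [h]; show 0 ≤ τ / κ; positivity
      · rw [h']; exact mem_univ _
  have key := hblow Ω u p q r s' t a b c b1 b2 g B H G hD (hco.mono (le_max_right _ _)) hB hg _ _ _ _ _ β _ _ μ ρ
    _ _ hρ hF (hμ.trans ?_) rfl rfl ?_ ?_ ?_ ?_ w hwS hwn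
  · have e1 : s + (w.re + β * w.im) = σ := by rw [hw]; simp
    have e2 : κ * w.im = τ := by rw [hw]; simp only; field_simp
    simp only [hz0, e1, e2] at key
    simpa using key
  · have : 1 * E0 ≤ L * E0 := by gcongr
    refine le_trans ?_ (le_max_left _ _)
    linarith
  · simp only [hz0]; simpa using f1
  · simp only [hz0]; simpa using f2
  · simp only [hz0]; simpa using f3
  · simp only [hz0]; simpa using f4

lemma sd_int_pt (Λ η : ℝ) (hΛ : 1 ≤ Λ) (hη : 0 < η) :
    ∃ R K, 0 < R ∧ 0 < K ∧ ∀ (Ω : Set (ℝ × ℝ)) (a b c b1 b2 : ℝ × ℝ → ℝ), SCoef Ω a b c b1 b2 Λ → ∀ x y ρ,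
      0 < ρ → Metric.ball x (R * ρ) ⊆ Ω → dist y x ≤ ρ → SEst Ω a b c b1 b2 η K y x ρ := by
  obtain ⟨R, K, hR, hK, h⟩ := sd_blow_curve univ (Or.inl rfl) Λ 1 1 1 1 η hΛ le_rfl one_pos (by norm_num) one_pos hη
  refine ⟨R, K, hR, hK, ?_⟩
  intro Ω a b c b1 b2 hco x y ρ hρ hb hy
  have hRρ : 0 < R * ρ := by positivity
  have hC : SCurve (fun σ => x + (σ, (0:ℝ))) (fun _ => ((1:ℝ), (0:ℝ))) (fun _ => ((0:ℝ), (0:ℝ))) ((0:ℝ), (1:ℝ)) (R * ρ) 1 1 := by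
    refine ⟨le_rfl, one_pos, ?_, ?_, ?_, ?_, ?_, ?_, by simp, by simp, by simp⟩
    · intro s _
      exact ((hasDerivAt_id s).prodMk (hasDerivAt_const s (0:ℝ))).const_add x
    · intro s _
      exact hasDerivAt_const _ _
    · exact (HB.const _).mono (by simp)
    · exact (HB.const _).mono (by simp)
    · exact (HB.const _).mono (by simp)
    · exact (HB.const _).mono (by simp)
  have hmem : ∀ σ τ : ℝ, |σ - 0| < R * ρ → |τ| < R * ρ → x + (σ, (0:ℝ)) + τ • ((0:ℝ), (1:ℝ)) ∈ Ω := by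
    intro σ τ h1 h2
    apply hb
    rw [Metric.mem_ball, dist_eq_norm]
    have e : x + (σ, (0:ℝ)) + τ • ((0:ℝ), (1:ℝ)) - x = (σ, τ) := by
      ext <;> simp
    rw [e, sd_norm_lt]
    exact ⟨by simpa using h1, h2⟩
  have hx : x ∈ Ω := hb (Metric.mem_ball_self hRρ)
  have key := h Ω a b c b1 b2 _ _ _ _ (R * ρ) 0 ρ hco hC hρ (by simp) (subset_closure (by simpa using hmem 0 0 (by simpa using hRρ) (by simpa using hRρ)))
    (fun σ τ h1 h2 _ => subset_closure (hmem σ τ h1 h2)) (fun σ τ h1 h2 _ => hmem σ τ h1 h2)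
    (fun h => by
      have h1 : (⟨0, -1⟩ : ℂ) ∈ sdUp := by rw [← h]; exact mem_univ _
      have h2 : (0:ℝ) ≤ -1 := h1
      norm_num at h2) (y.1 - x.1) (y.2 - x.2) ?_ ?_ (Or.inr rfl)
  · have e1 : x + (y.1 - x.1, (0:ℝ)) + (y.2 - x.2) • ((0:ℝ), (1:ℝ)) = y := by ext <;> simp
    have e2 : x + ((0:ℝ), (0:ℝ)) = x := by ext <;> simp
    simp only [e1, e2] at key
    exact key
  · have := norm_fst_le (y - x)
    rw [← dist_eq_norm] at this
    simp only [Prod.fst_sub, Real.norm_eq_abs] at this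
    simp only [sub_zero, one_mul]; linarith
  · have := norm_snd_le (y - x)
    rw [← dist_eq_norm] at this
    simp only [Prod.snd_sub, Real.norm_eq_abs] at this
    linarith

lemma SEst.refl {Ω : Set (ℝ × ℝ)} {a b c b1 b2 : ℝ × ℝ → ℝ} {η K : ℝ} {x : ℝ × ℝ} {ρ : ℝ}
    (hη : 0 ≤ η) (hK : 0 ≤ K) : SEst Ω a b c b1 b2 η K x x ρ := by
  intro u p q r s t g B H G h1 h2 h3
  have hBG : 0 ≤ B + G := add_nonneg h2.B0.le h2.hg.nonneg
  have := h2.H0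
  simp only [sub_self, abs_zero, and_self]
  positivity

lemma sd_loc_bdry {Ω : Set (ℝ × ℝ)} {a b c b1 b2 : ℝ × ℝ → ℝ} {Λ : ℝ} (hΛ : 1 ≤ Λ)
    (hco : SCoef Ω a b c b1 b2 Λ) {x0 : ℝ × ℝ} {γ c1 c2 : ℝ → ℝ × ℝ} {n : ℝ × ℝ} {δ r0 d0 L : ℝ}
    (hC : SChart Ω x0 γ c1 c2 n δ r0 d0 L) (η : ℝ) (hη : 0 < η) :
    ∃ ε K, 0 < ε ∧ 0 < K ∧ ∀ x ∈ Ω, ∀ y ∈ Ω, dist x x0 < ε → dist y x0 < ε →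
      SEst Ω a b c b1 b2 η K x y (dist x y) := by
  have hL := hC.L1
  obtain ⟨R1, K1, hR1, hK1, hint⟩ := sd_int_pt Λ η hΛ hη
  obtain ⟨R, K, hR, hK, hbl⟩ := sd_blow_curve sdUp (Or.inr rfl) Λ L d0 L (L * R1 + L) (η / 2) hΛ hL hC.hd0
    (by linarith) (by positivity) (by positivity)
  have hδ := hC.hδ
  have hr0 := hC.hr
  set ε := min (δ / (L + 2 * R)) (r0 / (1 + 2 * R1)) with hε
  have hε0 : 0 < ε := by positivity
  have hε1 : ε * (L + 2 * R) ≤ δ := by rw [← le_div_iff₀ (by positivity)]; exact min_le_left _ _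
  have hε2 : ε * (1 + 2 * R1) ≤ r0 := by rw [← le_div_iff₀ (by positivity)]; exact min_le_right _ _
  have hR1ε : 0 < R1 * ε := by positivity
  have hRε : 0 < R * ε := by positivity
  refine ⟨ε, max K1 (2 * K), hε0, lt_max_of_lt_left hK1, ?_⟩
  intro x hx y hy hxε hyε
  rcases eq_or_ne x y with rfl | hxy
  · exact SEst.refl hη.le (le_max_of_le_left hK1.le)
  have hρ : 0 < dist x y := dist_pos.mpr hxy
  set ρ := dist x y with hρd
  have hρε : ρ < 2 * ε := by
    have := dist_triangle_right x y x0
    linarith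
  have hrep : ∀ w, dist w x0 < r0 → ∃ s t, |s| < δ ∧ |t| < δ ∧ w = γ s + t • n ∧ (w ∈ Ω → 0 < t) := by
    intro w hw
    obtain ⟨s, t, hs, ht, e⟩ := hC.surj w hw
    refine ⟨s, t, hs, ht, e, fun h => ?_⟩
    by_contra hn
    rw [e] at h
    exact hC.neg s t hs (abs_lt.mp ht).1 (not_lt.mp hn) h
  obtain ⟨s, t, hs, ht, ex, hpx⟩ := hrep x (by linarith)
  obtain ⟨s', t', hs', ht', ey, hpy⟩ := hrep y (by linarith)
  have htp := hpx hx
  have htp' := hpy hy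
  obtain ⟨i1, i2⟩ := hC.inv s t s' t' hs ht hs' ht'
  rw [← ex, ← ey, ← hρd] at i1 i2
  by_cases hcase : L * (R1 * ρ) ≤ t
  · refine SEst.mono ((hint Ω a b c b1 b2 hco x y ρ hρ ?_ (by rw [dist_comm])).symm) (le_max_left _ _)
    intro w hw
    rw [Metric.mem_ball] at hw
    have hRρ : R1 * ρ < R1 * (2 * ε) := by gcongr
    obtain ⟨s1, t1, hs1, ht1, ew, -⟩ := hrep w (by
      have := dist_triangle w x x0
      linarith)
    have i3 := (hC.inv s t s1 t1 hs ht hs1 ht1).2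
    rw [← ex, ← ew, dist_comm] at i3
    have : L * dist w x < L * (R1 * ρ) := by gcongr
    have h3 := (abs_lt.mp (i3.trans_lt this)).2
    rw [ew]
    exact hC.pos s1 t1 hs1 (by linarith) (abs_lt.mp ht1).2
  · have hcase := (not_le.mp hcase).le
    have hsε : |s| ≤ L * ε := by
      have i3 := (hC.inv s t 0 0 hs ht (by simpa using hδ) (by simpa using hδ)).1
      rw [hC.c0, ← ex, zero_smul, add_zero, sub_zero] at i3
      have : L * dist x x0 ≤ L * ε := by gcongr
      linarith
    have hRρ : R * ρ < R * (2 * ε) := by gcongr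
    have hsR : |s| + R * ρ ≤ δ := by linarith
    have hsσ : ∀ σ, |σ - s| < R * ρ → |σ| < δ := by
      intro σ h
      have := abs_add_le (σ - s) s
      rw [sub_add_cancel] at this
      linarith
    have hRρδ : R * ρ ≤ δ := by linarith [abs_nonneg s]
    have key := hbl Ω a b c b1 b2 γ c1 c2 n δ s ρ hco hC.toSCurve hρ hsR
      (frontier_subset_closure (hC.zero s hs)) ?_ ?_ ?_
    · have kx := key s t (by simp; positivity) (by rw [abs_of_pos htp]; nlinarith) (Or.inl htp.le)
      have ky := key s' t' (by rw [abs_sub_comm]; exact i1) (by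
        rw [abs_of_pos htp']
        have := (abs_le.mp i2).1
        linarith) (Or.inl htp'.le)
      rw [← ex] at kx
      rw [← ey] at ky
      have := SEst.trans kx ky.symm
      rw [show 2 * (η / 2) = η by ring] at this
      exact this.mono (le_max_right _ _)
    · intro σ τ h1 h2 h3
      rcases h3 with h3 | h3
      · rcases h3.eq_or_lt with rfl | h3
        · simpa using frontier_subset_closure (hC.zero σ (hsσ σ h1))
        · exact subset_closure (hC.pos σ τ (hsσ σ h1) h3 ((abs_lt.mp h2).2.trans_le hRρδ))
      · exfalso
        have h1 : (⟨0, -1⟩ : ℂ) ∈ sdUp := by rw [h3]; exact mem_univ _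
        have h2 : (0:ℝ) ≤ -1 := h1
        norm_num at h2
    · intro σ τ h1 h2 h3
      rcases h3 with h3 | h3
      · exact hC.pos σ τ (hsσ σ h1) h3 ((abs_lt.mp h2).2.trans_le hRρδ)
      · exfalso
        have h1 : (⟨0, -1⟩ : ℂ) ∈ sdUp := by rw [h3]; exact mem_univ _
        have h2 : (0:ℝ) ≤ -1 := h1
        norm_num at h2
    · intro _ σ h1
      exact hC.zero σ (hsσ σ h1)

lemma sd_loc {Ω : Set (ℝ × ℝ)} (hΩ : IsAnalyticJordanDomain Ω) {a b c b1 b2 : ℝ × ℝ → ℝ} {Λ : ℝ} (hΛ : 1 ≤ Λ)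
    (hco : SCoef Ω a b c b1 b2 Λ) (η : ℝ) (hη : 0 < η) (x0 : ℝ × ℝ) (hx0 : x0 ∈ closure Ω) :
    ∃ ε K, 0 < ε ∧ 0 < K ∧ ∀ x ∈ Ω, ∀ y ∈ Ω, dist x x0 < ε → dist y x0 < ε →
      SEst Ω a b c b1 b2 η K x y (dist x y) := by
  by_cases h : x0 ∈ Ω
  · obtain ⟨R, K, hR, hK, hint⟩ := sd_int_pt Λ η hΛ hη
    obtain ⟨r, hr, hb⟩ := Metric.isOpen_iff.mp hΩ.1 x0 h
    refine ⟨r / (1 + 2 * R), K, by positivity, hK, ?_⟩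
    intro x hx y hy h1 h2
    rcases eq_or_ne x y with rfl | hxy
    · exact SEst.refl hη.le hK.le
    have hρ : 0 < dist x y := dist_pos.mpr hxy
    refine (hint Ω a b c b1 b2 hco x y _ hρ (fun w hw => hb ?_) (by rw [dist_comm])).symm
    rw [Metric.mem_ball] at hw ⊢
    set ε := r / (1 + 2 * R) with hε
    have e : ε * (1 + 2 * R) = r := by rw [hε]; field_simp
    have g1 := dist_triangle_right x y x0
    have g2 := dist_triangle w x x0
    have : R * dist x y ≤ R * (2 * ε) := by gcongr; linarith
    linarith
  · have hf : x0 ∈ frontier Ω := by rw [hΩ.1.frontier_eq]; exact ⟨hx0, h⟩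
    obtain ⟨γ, c1, c2, n, δ, r, d0, L, hC⟩ := sd_chart hΩ x0 hf
    exact sd_loc_bdry hΛ hco hC η hη

lemma sd_glob {Ω : Set (ℝ × ℝ)} (hc : IsCompact (closure Ω)) (P : ℝ → ℝ × ℝ → ℝ × ℝ → Prop)
    (hm : ∀ K K' x y, K ≤ K' → P K x y → P K' x y)
    (hl : ∀ x0 ∈ closure Ω, ∃ ε K : ℝ, 0 < ε ∧ 0 < K ∧ ∀ x ∈ Ω, ∀ y ∈ Ω, dist x x0 < ε → dist y x0 < ε → P K x y) :
    ∃ δ K : ℝ, 0 < δ ∧ 0 < K ∧ ∀ x ∈ Ω, ∀ y ∈ Ω, dist x y < δ → P K x y := by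
  have hl' : ∀ x0 : ℝ × ℝ, ∃ ε K : ℝ, 0 < ε ∧ 0 < K ∧ (x0 ∈ closure Ω → ∀ x ∈ Ω, ∀ y ∈ Ω, dist x x0 < ε → dist y x0 < ε → P K x y) := by
    intro x0
    by_cases h : x0 ∈ closure Ω
    · obtain ⟨ε, K, h1, h2, h3⟩ := hl x0 h
      exact ⟨ε, K, h1, h2, fun _ => h3⟩
    · exact ⟨1, 1, one_pos, one_pos, fun h' => absurd h' h⟩
  choose ε K hε hK hP using hl'
  obtain ⟨T, hT1, hT2⟩ := hc.elim_nhds_subcover (fun x => Metric.ball x (ε x / 2))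
    (fun x _ => Metric.ball_mem_nhds x (half_pos (hε x)))
  have hs0 : 0 ≤ ∑ x ∈ T, 2 / ε x := Finset.sum_nonneg fun x _ => (div_pos two_pos (hε x)).le
  have hk0 : 0 ≤ ∑ x ∈ T, K x := Finset.sum_nonneg fun x _ => (hK x).le
  refine ⟨1 / (1 + ∑ x ∈ T, 2 / ε x), 1 + ∑ x ∈ T, K x, by positivity, by positivity, ?_⟩
  intro x hx y hy hxy
  have := hT2 (subset_closure hx)
  simp only [mem_iUnion, exists_prop] at this
  obtain ⟨x0, hx0, hxx0⟩ := this
  rw [Metric.mem_ball] at hxx0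
  have h1 : 2 / ε x0 ≤ ∑ x ∈ T, 2 / ε x :=
    Finset.single_le_sum (f := fun x => 2 / ε x) (fun x _ => (div_pos two_pos (hε x)).le) hx0
  have h2 : K x0 ≤ ∑ x ∈ T, K x := Finset.single_le_sum (f := K) (fun x _ => (hK x).le) hx0
  have h3 : 1 / (1 + ∑ x ∈ T, 2 / ε x) ≤ ε x0 / 2 := by
    rw [div_le_iff₀ (by positivity)]
    have := hε x0
    calc (1:ℝ) = ε x0 / 2 * (2 / ε x0) := by field_simp
      _ ≤ _ := by gcongr; linarith
  have h4 : dist y x0 < ε x0 := by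
    have := dist_triangle_left y x0 x
    linarith
  have := hε x0
  exact hm _ _ _ _ (by linarith) (hP x0 (hT1 x0 hx0) x hx y hy (by linarith) h4)

lemma sd_glob_est {Ω : Set (ℝ × ℝ)} (hΩ : IsAnalyticJordanDomain Ω) {a b c b1 b2 : ℝ × ℝ → ℝ} {Λ : ℝ} (hΛ : 1 ≤ Λ)
    (hco : SCoef Ω a b c b1 b2 Λ) (η : ℝ) (hη : 0 < η) :
    ∃ K, 0 < K ∧ ∀ x ∈ Ω, ∀ y ∈ Ω, SEst Ω a b c b1 b2 η K x y (dist x y) := by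
  obtain ⟨δ, K, hδ, hK, h⟩ := sd_glob (Ω := Ω) hΩ.2.1.isCompact_closure
    (fun K x y => SEst Ω a b c b1 b2 η K x y (dist x y)) (fun K K' x y h h' => h'.mono h)
    (fun x0 hx0 => sd_loc hΩ hΛ hco η hη x0 hx0)
  refine ⟨max K (2 / √δ), lt_max_of_lt_left hK, fun x hx y hy => ?_⟩
  by_cases hd : dist x y < δ
  · exact (h x hx y hy hd).mono (le_max_left _ _)
  · have hd := not_lt.mp hd
    refine SEst.mono (K := 2 / √δ) ?_ (le_max_right _ _)
    intro u p q r s t g B H G h1 h2 h3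
    have hG := h2.hg.nonneg
    have hB := h2.B0
    have hH := h2.H0
    have hsδ : 0 < √δ := Real.sqrt_pos.mpr hδ
    have key : 2 * B ≤ (η * H + 2 / √δ * (B + G)) * √(dist x y) := by
      have h4 : √δ ≤ √(dist x y) := Real.sqrt_le_sqrt hd
      calc 2 * B = 2 / √δ * B * √δ := by field_simp
        _ ≤ (η * H + 2 / √δ * (B + G)) * √(dist x y) := by
          gcongr
          have : 2 / √δ * B ≤ 2 / √δ * (B + G) := by gcongr; linarith
          have : 0 ≤ η * H := by positivity
          linarith
    have hx' := subset_closure hx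
    have hy' := subset_closure hy
    refine ⟨?_, ?_, ?_⟩
    · have := sd_abs_sub (h2.br x hx') (h2.br y hy'); linarith
    · have := sd_abs_sub (h2.bs x hx') (h2.bs y hy'); linarith
    · have := sd_abs_sub (h2.bt x hx') (h2.bt y hy'); linarith

def SLip (Ω : Set (ℝ × ℝ)) (K : ℝ) (x y : ℝ × ℝ) : Prop :=
  ∀ (h h1 h2 : ℝ × ℝ → ℝ) (M : ℝ), 0 ≤ M → (∀ x ∈ Ω, HasFDerivAt h (sdE (h1 x) (h2 x)) x) →
    (∀ x ∈ Ω, |h1 x| ≤ M) → (∀ x ∈ Ω, |h2 x| ≤ M) → |h x - h y| ≤ K * M * dist x y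

lemma sdE_norm {r s M : ℝ} (hM : 0 ≤ M) (hr : |r| ≤ M) (hs : |s| ≤ M) : ‖sdE r s‖ ≤ 2 * M := by
  refine ContinuousLinearMap.opNorm_le_bound _ (by positivity) fun v => ?_
  rw [sdE_apply, Real.norm_eq_abs]
  have h1 : |v.1| ≤ ‖v‖ := norm_fst_le v
  have h2 : |v.2| ≤ ‖v‖ := norm_snd_le v
  have h3 := sd_abs_mul hr h1
  have h4 := sd_abs_mul hs h2
  have := abs_add_le (r * v.1) (s * v.2)
  linarith

lemma sd_lip_loc {Ω : Set (ℝ × ℝ)} (hΩ : IsAnalyticJordanDomain Ω) (x0 : ℝ × ℝ) (hx0 : x0 ∈ closure Ω) :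
    ∃ ε K, 0 < ε ∧ 0 < K ∧ ∀ x ∈ Ω, ∀ y ∈ Ω, dist x x0 < ε → dist y x0 < ε → SLip Ω K x y := by
  by_cases h : x0 ∈ Ω
  · obtain ⟨r, hr, hb⟩ := Metric.isOpen_iff.mp hΩ.1 x0 h
    refine ⟨r, 2, hr, two_pos, ?_⟩
    intro x hx y hy hxr hyr h h1 h2 M hM hd hh1 hh2
    have := (convex_ball x0 r).norm_image_sub_le_of_norm_hasFDerivWithin_le (f := h) (C := 2 * M)
      (fun z hz => (hd z (hb hz)).hasFDerivWithinAt)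
      (fun z hz => sdE_norm hM (hh1 z (hb hz)) (hh2 z (hb hz))) (x := y) (y := x) hyr hxr
    rw [dist_eq_norm]; exact this
  · have hf : x0 ∈ frontier Ω := by rw [hΩ.1.frontier_eq]; exact ⟨hx0, h⟩
    obtain ⟨γ, c1, c2, n, δ, r, d0, L, hC⟩ := sd_chart hΩ x0 hf
    have hL := hC.L1
    refine ⟨r, 4 * L * L, hC.hr, by positivity, ?_⟩
    intro x hx y hy hxr hyr h h1 h2 M hM hd hh1 hh2
    obtain ⟨s, t, hs, ht, ex⟩ := hC.surj x hxr
    obtain ⟨s', t', hs', ht', ey⟩ := hC.surj y hyr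
    have htp : 0 < t := by
      by_contra hn; rw [ex] at hx
      exact hC.neg s t hs (abs_lt.mp ht).1 (not_lt.mp hn) hx
    have htp' : 0 < t' := by
      by_contra hn; rw [ey] at hy
      exact hC.neg s' t' hs' (abs_lt.mp ht').1 (not_lt.mp hn) hy
    set Bx : Set (ℝ × ℝ) := Ioo (-δ) δ ×ˢ Ioo 0 δ with hBx
    have hconv : Convex ℝ Bx := (convex_Ioo _ _).prod (convex_Ioo _ _)
    have hder : ∀ z ∈ Bx, HasFDerivAt (fun z : ℝ × ℝ => h (γ z.1 + z.2 • n))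
        (sdE (h1 (γ z.1 + z.2 • n) * (c1 z.1).1 + h2 (γ z.1 + z.2 • n) * (c1 z.1).2)
          (h1 (γ z.1 + z.2 • n) * n.1 + h2 (γ z.1 + z.2 • n) * n.2)) z := by
      intro z hz
      have hz1 : |z.1| < δ := abs_lt.mpr hz.1
      have hm := hC.pos z.1 z.2 hz1 hz.2.1 hz.2.2
      have g1 : HasFDerivAt (fun z : ℝ × ℝ => γ z.1) _ z :=
        (hC.d1 z.1 hz1).hasFDerivAt.comp z (hasFDerivAt_fst (𝕜 := ℝ) (p := z))
      have g2 : HasFDerivAt (fun z : ℝ × ℝ => z.2 • n) _ z :=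
        (hasFDerivAt_snd (𝕜 := ℝ) (p := z)).smul_const n
      have g3 := (hd _ hm).comp z (g1.add g2)
      refine HasFDerivAt.congr_fderiv g3 ?_
      ext <;> simp [sdE_apply]
    have hbd : ∀ z ∈ Bx, ‖sdE (h1 (γ z.1 + z.2 • n) * (c1 z.1).1 + h2 (γ z.1 + z.2 • n) * (c1 z.1).2)
          (h1 (γ z.1 + z.2 • n) * n.1 + h2 (γ z.1 + z.2 • n) * n.2)‖ ≤ 2 * (2 * (M * L)) := by
      intro z hz
      have hz1 : |z.1| < δ := abs_lt.mpr hz.1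
      have hm := hC.pos z.1 z.2 hz1 hz.2.1 hz.2.2
      have hz1' : z.1 ∈ Metric.ball (0:ℝ) δ := by simpa using hz1
      have k1 := hh1 _ hm
      have k2 := hh2 _ hm
      refine sdE_norm (by positivity) ?_ ?_
      · have a1 := sd_abs_mul k1 (hC.b11.bd hz1')
        have a2 := sd_abs_mul k2 (hC.b12.bd hz1')
        refine (abs_add_le _ _).trans ?_
        linarith
      · have a1 := sd_abs_mul k1 hC.n1
        have a2 := sd_abs_mul k2 hC.n2
        refine (abs_add_le _ _).trans ?_
        linarith
    have key := hconv.norm_image_sub_le_of_norm_hasFDerivWithin_le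
      (fun z hz => (hder z hz).hasFDerivWithinAt) hbd (x := (s', t')) (y := (s, t))
      ⟨abs_lt.mp hs', htp', (abs_lt.mp ht').2⟩ ⟨abs_lt.mp hs, htp, (abs_lt.mp ht).2⟩
    simp only [← ex, ← ey, Real.norm_eq_abs] at key
    obtain ⟨i1, i2⟩ := hC.inv s t s' t' hs ht hs' ht'
    rw [← ex, ← ey] at i1 i2
    have i3 : ‖((s, t) : ℝ × ℝ) - (s', t')‖ ≤ L * dist x y := by
      rw [Prod.norm_def, max_le_iff]; exact ⟨i1, i2⟩
    calc _ ≤ _ := key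
      _ ≤ 2 * (2 * (M * L)) * (L * dist x y) := by gcongr
      _ = _ := by ring

lemma sd_lip {Ω : Set (ℝ × ℝ)} (hΩ : IsAnalyticJordanDomain Ω) :
    ∃ δ K, 0 < δ ∧ 0 < K ∧ ∀ x ∈ Ω, ∀ y ∈ Ω, dist x y < δ → SLip Ω K x y := by
  refine sd_glob hΩ.2.1.isCompact_closure (SLip Ω) ?_ (sd_lip_loc hΩ)
  intro K K' x y hK h h' h1 h2 M hM a1 a2 a3
  refine (h h' h1 h2 M hM a1 a2 a3).trans ?_
  gcongr

lemma sd_inner {Ω : Set (ℝ × ℝ)} (hΩ : IsAnalyticJordanDomain Ω) (δ : ℝ) (hδ : 0 < δ) :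
    ∃ κ, 0 < κ ∧ κ ≤ δ ∧ ∀ x ∈ Ω, ∃ x', Metric.ball x' κ ⊆ Ω ∧ dist x x' < δ := by
  have hg := sd_glob (Ω := Ω) hΩ.2.1.isCompact_closure
    (fun K x _ => 0 < K ∧ ∃ x', Metric.ball x' (1 / K) ⊆ Ω ∧ dist x x' < δ) ?_ ?_
  · obtain ⟨δ', K, hδ', hK, h⟩ := hg
    refine ⟨min (1 / K) δ, by positivity, min_le_right _ _, fun x hx => ?_⟩
    obtain ⟨-, x', h1, h2⟩ := h x hx x hx (by simpa)
    exact ⟨x', (Metric.ball_subset_ball (min_le_left _ _)).trans h1, h2⟩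
  · rintro K K' x _ hKK ⟨h, x', h1, h2⟩
    exact ⟨by linarith, x', (Metric.ball_subset_ball (by gcongr)).trans h1, h2⟩
  · intro x0 hx0
    obtain ⟨y, hy, hy2⟩ := Metric.mem_closure_iff.mp hx0 (δ / 2) (by positivity)
    obtain ⟨r, hr, hb⟩ := Metric.isOpen_iff.mp hΩ.1 y hy
    refine ⟨δ / 2, 1 / r, by positivity, by positivity, fun x _ _ _ hxx _ => ⟨by positivity, y, by simpa using hb, ?_⟩⟩
    have := dist_triangle x x0 y
    linarith

lemma sd_mvt {x : ℝ × ℝ} {κ : ℝ} {h h1 h2 : ℝ × ℝ → ℝ}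
    (hd : ∀ z ∈ Metric.ball x κ, HasFDerivAt h (sdE (h1 z) (h2 z)) z) {X v : ℝ × ℝ}
    (hX : X ∈ Metric.ball x κ) (hY : X + v ∈ Metric.ball x κ) :
    ∃ θ : ℝ, 0 ≤ θ ∧ θ ≤ 1 ∧ X + θ • v ∈ Metric.ball x κ ∧
      h (X + v) - h X = h1 (X + θ • v) * v.1 + h2 (X + θ • v) * v.2 := by
  obtain ⟨z, hz, e⟩ := domain_mvt (fun z hz => (hd z hz).hasFDerivWithinAt) (convex_ball x κ) hX hY
  have hzb := (convex_ball x κ).segment_subset hX hY hz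
  rw [segment_eq_image'] at hz
  obtain ⟨θ, hθ, rfl⟩ := hz
  simp only [add_sub_cancel_left] at hzb e
  refine ⟨θ, hθ.1, hθ.2, hzb, ?_⟩
  rw [e, sdE_apply]

lemma sd_inball {x : ℝ × ℝ} {ℓ κ α β : ℝ} (h : 4 * ℓ = κ) (hℓ : 0 < ℓ) (h1 : |α| ≤ 3) (h2 : |β| ≤ 3) :
    x + (α * ℓ, β * ℓ) ∈ Metric.ball x κ := by
  rw [Metric.mem_ball, dist_eq_norm, add_sub_cancel_left, sd_norm_lt]
  simp only [abs_mul, abs_of_pos hℓ]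
  constructor <;> nlinarith

lemma sd_interp_pt {x : ℝ × ℝ} {κ U D ℓ : ℝ} {u p q r s t : ℝ × ℝ → ℝ} (hℓ : 0 < ℓ) (hκ : 4 * ℓ = κ)
    (du : ∀ z ∈ Metric.ball x κ, HasFDerivAt u (sdE (p z) (q z)) z)
    (dp : ∀ z ∈ Metric.ball x κ, HasFDerivAt p (sdE (r z) (s z)) z)
    (dq : ∀ z ∈ Metric.ball x κ, HasFDerivAt q (sdE (s z) (t z)) z)
    (hu : ∀ z ∈ Metric.ball x κ, |u z| ≤ U)
    (or : ∀ z ∈ Metric.ball x κ, ∀ w ∈ Metric.ball x κ, |r z - r w| ≤ D)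
    (os : ∀ z ∈ Metric.ball x κ, ∀ w ∈ Metric.ball x κ, |s z - s w| ≤ D)
    (ot : ∀ z ∈ Metric.ball x κ, ∀ w ∈ Metric.ball x κ, |t z - t w| ≤ D) :
    |r x| ≤ 2 * D + 4 * U / ℓ ^ 2 ∧ |s x| ≤ 2 * D + 4 * U / ℓ ^ 2 ∧ |t x| ≤ 2 * D + 4 * U / ℓ ^ 2 := by
  have hx : x ∈ Metric.ball x κ := Metric.mem_ball_self (by linarith)
  have hD : 0 ≤ D := (abs_nonneg _).trans (or x hx x hx)
  have hU : 0 ≤ U := (abs_nonneg _).trans (hu x hx)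
  have sp : ∀ α : ℝ, |α| ≤ 2 → |α + 1| ≤ 3 → ∃ θ, 0 ≤ θ ∧ θ ≤ 1 ∧ |p (x + ((α + θ) * ℓ, 0 * ℓ))| * ℓ ≤ 2 * U := by
    intro α h1 h2
    have hX := sd_inball (x := x) hκ hℓ (α := α) (β := 0) (by linarith) (by norm_num)
    have hY := sd_inball (x := x) hκ hℓ (α := α + 1) (β := 0) h2 (by norm_num)
    have e : x + ((α + 1) * ℓ, 0 * ℓ) = x + (α * ℓ, 0 * ℓ) + (ℓ, 0) := by ext <;> simp; ring
    obtain ⟨θ, h3, h4, h5, h6⟩ := sd_mvt du hX (v := (ℓ, 0)) (by rw [← e]; exact hY)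
    refine ⟨θ, h3, h4, ?_⟩
    have e2 : x + (α * ℓ, 0 * ℓ) + θ • (ℓ, (0:ℝ)) = x + ((α + θ) * ℓ, 0 * ℓ) := by ext <;> simp; ring
    rw [e2, ← e] at h6
    simp only [mul_zero, add_zero] at h6
    have h7 := sd_abs_sub (hu _ hY) (hu _ hX)
    rw [h6, abs_mul, abs_of_pos hℓ] at h7
    linarith
  have sq : ∀ α β : ℝ, |α| ≤ 3 → |β| ≤ 2 → |β + 1| ≤ 3 → ∃ θ, 0 ≤ θ ∧ θ ≤ 1 ∧ |q (x + (α * ℓ, (β + θ) * ℓ))| * ℓ ≤ 2 * U := by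
    intro α β h0 h1 h2
    have hX := sd_inball (x := x) hκ hℓ (α := α) (β := β) h0 (by linarith)
    have hY := sd_inball (x := x) hκ hℓ (α := α) (β := β + 1) h0 h2
    have e : x + (α * ℓ, (β + 1) * ℓ) = x + (α * ℓ, β * ℓ) + (0, ℓ) := by ext <;> simp; ring
    obtain ⟨θ, h3, h4, h5, h6⟩ := sd_mvt du hX (v := (0, ℓ)) (by rw [← e]; exact hY)
    refine ⟨θ, h3, h4, ?_⟩
    have e2 : x + (α * ℓ, β * ℓ) + θ • ((0:ℝ), ℓ) = x + (α * ℓ, (β + θ) * ℓ) := by ext <;> simp; ring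
    rw [e2, ← e] at h6
    simp only [mul_zero, zero_add] at h6
    have h7 := sd_abs_sub (hu _ hY) (hu _ hX)
    rw [h6, abs_mul, abs_of_pos hℓ] at h7
    linarith
  have hℓ2 : 0 < ℓ ^ 2 := by positivity
  have fin : ∀ y : ℝ, |y| * ℓ * ℓ ≤ 4 * U → |y| ≤ 4 * U / ℓ ^ 2 := by
    intro y hy
    rw [le_div_iff₀ hℓ2]; linarith
  have hr : ∃ z ∈ Metric.ball x κ, |r z| ≤ 4 * U / ℓ ^ 2 := by
    obtain ⟨θ, a1, a2, a3⟩ := sp 0 (by norm_num) (by norm_num)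
    obtain ⟨θ', c1, c2, c3⟩ := sp 2 (by norm_num) (by norm_num)
    have hX := sd_inball (x := x) hκ hℓ (α := 0 + θ) (β := 0) (by rw [abs_le]; constructor <;> linarith) (by norm_num)
    have hY := sd_inball (x := x) hκ hℓ (α := 2 + θ') (β := 0) (by rw [abs_le]; constructor <;> linarith) (by norm_num)
    have e : x + ((2 + θ') * ℓ, 0 * ℓ) = x + ((0 + θ) * ℓ, 0 * ℓ) + ((2 + θ' - θ) * ℓ, 0) := by ext <;> simp; ring
    obtain ⟨τ, h3, h4, h5, h6⟩ := sd_mvt dp hX (v := ((2 + θ' - θ) * ℓ, 0)) (by rw [← e]; exact hY)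
    refine ⟨_, h5, fin _ ?_⟩
    rw [← e] at h6
    simp only [mul_zero, add_zero] at h6
    have h7 := abs_sub (p (x + ((2 + θ') * ℓ, 0 * ℓ))) (p (x + ((0 + θ) * ℓ, 0 * ℓ)))
    rw [h6, abs_mul, abs_of_pos (a := (2 + θ' - θ) * ℓ) (mul_pos (by linarith) hℓ)] at h7
    set ρ := |r (x + ((0 + θ) * ℓ, 0 * ℓ) + τ • ((2 + θ' - θ) * ℓ, 0))|
    have h8 : ρ * ((2 + θ' - θ) * ℓ) * ℓ ≤ 4 * U := by
      have := mul_le_mul_of_nonneg_right h7 hℓ.le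
      linarith
    have h9 : ρ * (1 * ℓ) * ℓ ≤ ρ * ((2 + θ' - θ) * ℓ) * ℓ := by
      gcongr
      linarith
    linarith
  have ht : ∃ z ∈ Metric.ball x κ, |t z| ≤ 4 * U / ℓ ^ 2 := by
    obtain ⟨θ, a1, a2, a3⟩ := sq 0 0 (by norm_num) (by norm_num) (by norm_num)
    obtain ⟨θ', c1, c2, c3⟩ := sq 0 2 (by norm_num) (by norm_num) (by norm_num)
    have hX := sd_inball (x := x) hκ hℓ (α := 0) (β := 0 + θ) (by norm_num) (by rw [abs_le]; constructor <;> linarith)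
    have hY := sd_inball (x := x) hκ hℓ (α := 0) (β := 2 + θ') (by norm_num) (by rw [abs_le]; constructor <;> linarith)
    have e : x + (0 * ℓ, (2 + θ') * ℓ) = x + (0 * ℓ, (0 + θ) * ℓ) + (0, (2 + θ' - θ) * ℓ) := by ext <;> simp; ring
    obtain ⟨τ, h3, h4, h5, h6⟩ := sd_mvt dq hX (v := (0, (2 + θ' - θ) * ℓ)) (by rw [← e]; exact hY)
    refine ⟨_, h5, fin _ ?_⟩
    rw [← e] at h6
    simp only [mul_zero, zero_add] at h6
    have h7 := abs_sub (q (x + (0 * ℓ, (2 + θ') * ℓ))) (q (x + (0 * ℓ, θ * ℓ)))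
    rw [zero_add] at a3
    rw [h6, abs_mul, abs_of_pos (a := (2 + θ' - θ) * ℓ) (mul_pos (by linarith) hℓ)] at h7
    simp only [zero_add] 
    set ρ := |t (x + (0 * ℓ, θ * ℓ) + τ • (0, (2 + θ' - θ) * ℓ))|
    have h8 : ρ * ((2 + θ' - θ) * ℓ) * ℓ ≤ 4 * U := by
      have := mul_le_mul_of_nonneg_right h7 hℓ.le
      linarith
    have h9 : ρ * (1 * ℓ) * ℓ ≤ ρ * ((2 + θ' - θ) * ℓ) * ℓ := by
      gcongr
      linarith
    linarith
  have htb : ∀ z ∈ Metric.ball x κ, |t z| ≤ D + 4 * U / ℓ ^ 2 := by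
    intro z hz
    obtain ⟨w, hw, h⟩ := ht
    have := abs_add_le (t z - t w) (t w)
    rw [sub_add_cancel] at this
    linarith [ot z hz w hw]
  have hs : ∃ z ∈ Metric.ball x κ, |s z| ≤ D + 4 * U / ℓ ^ 2 := by
    obtain ⟨θ, a1, a2, a3⟩ := sq 0 0 (by norm_num) (by norm_num) (by norm_num)
    obtain ⟨θ', c1, c2, c3⟩ := sq 2 0 (by norm_num) (by norm_num) (by norm_num)
    have hX := sd_inball (x := x) hκ hℓ (α := 0) (β := 0 + θ) (by norm_num) (by rw [abs_le]; constructor <;> linarith)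
    have hY := sd_inball (x := x) hκ hℓ (α := 2) (β := 0 + θ') (by norm_num) (by rw [abs_le]; constructor <;> linarith)
    have e : x + (2 * ℓ, (0 + θ') * ℓ) = x + (0 * ℓ, (0 + θ) * ℓ) + (2 * ℓ, (θ' - θ) * ℓ) := by ext <;> simp; ring
    obtain ⟨τ, h3, h4, h5, h6⟩ := sd_mvt dq hX (v := (2 * ℓ, (θ' - θ) * ℓ)) (by rw [← e]; exact hY)
    refine ⟨_, h5, ?_⟩
    rw [← e] at h6
    have h8 := htb _ h5
    set ρ := s (x + (0 * ℓ, (0 + θ) * ℓ) + τ • (2 * ℓ, (θ' - θ) * ℓ))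
    set ω := t (x + (0 * ℓ, (0 + θ) * ℓ) + τ • (2 * ℓ, (θ' - θ) * ℓ))
    simp only at h6
    have h9 : |(θ' - θ) * ℓ| ≤ 1 * ℓ := sd_abs_mul (by rw [abs_le]; constructor <;> linarith) (by rw [abs_of_pos hℓ])
    have h10 := sd_abs_mul h8 h9
    have h11 : ρ * (2 * ℓ) = (q (x + (2 * ℓ, (0 + θ') * ℓ)) - q (x + (0 * ℓ, (0 + θ) * ℓ))) - ω * ((θ' - θ) * ℓ) := by
      rw [h6]; ring
    have h12 : |ρ| * (2 * ℓ) ≤ (|q (x + (2 * ℓ, (0 + θ') * ℓ))| + |q (x + (0 * ℓ, (0 + θ) * ℓ))|) + (D + 4 * U / ℓ ^ 2) * (1 * ℓ) := by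
      have h13 := sd_abs_sub (abs_sub (q (x + (2 * ℓ, (0 + θ') * ℓ))) (q (x + (0 * ℓ, (0 + θ) * ℓ)))) h10
      rw [← h11, abs_mul, abs_of_pos (a := 2 * ℓ) (by positivity)] at h13
      exact h13
    have h14 := mul_le_mul_of_nonneg_right h12 hℓ.le
    have h15 : (D + 4 * U / ℓ ^ 2) * (1 * ℓ) * ℓ = D * ℓ ^ 2 + 4 * U := by field_simp
    have h16 : |ρ| * (2 * ℓ ^ 2) ≤ (D + 4 * U / ℓ ^ 2) * (2 * ℓ ^ 2) := by
      have h17 : (D + 4 * U / ℓ ^ 2) * (2 * ℓ ^ 2) = 2 * (D * ℓ ^ 2) + 8 * U := by field_simp; ring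
      have h18 : 0 ≤ D * ℓ ^ 2 := by positivity
      rw [h17]; linarith
    exact le_of_mul_le_mul_right h16 (by positivity)
  refine ⟨?_, ?_, ?_⟩
  · obtain ⟨w, hw, h⟩ := hr
    have := abs_add_le (r x - r w) (r w)
    rw [sub_add_cancel] at this
    linarith [or x hx w hw]
  · obtain ⟨w, hw, h⟩ := hs
    have := abs_add_le (s x - s w) (s w)
    rw [sub_add_cancel] at this
    linarith [os x hx w hw]
  · linarith [htb x hx]

lemma sd_interp_pt1 {x : ℝ × ℝ} {κ U N ℓ : ℝ} {u p q r s t : ℝ × ℝ → ℝ} (hℓ : 0 < ℓ) (hκ : 4 * ℓ = κ)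
    (du : ∀ z ∈ Metric.ball x κ, HasFDerivAt u (sdE (p z) (q z)) z)
    (dp : ∀ z ∈ Metric.ball x κ, HasFDerivAt p (sdE (r z) (s z)) z)
    (dq : ∀ z ∈ Metric.ball x κ, HasFDerivAt q (sdE (s z) (t z)) z)
    (hu : ∀ z ∈ Metric.ball x κ, |u z| ≤ U)
    (or : ∀ z ∈ Metric.ball x κ, |r z| ≤ N)
    (os : ∀ z ∈ Metric.ball x κ, |s z| ≤ N)
    (ot : ∀ z ∈ Metric.ball x κ, |t z| ≤ N) :
    |p x| ≤ 2 * U / ℓ + N * ℓ ∧ |q x| ≤ 2 * U / ℓ + N * ℓ := by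
  have hx : x ∈ Metric.ball x κ := Metric.mem_ball_self (by linarith)
  have hN : 0 ≤ N := (abs_nonneg _).trans (or x hx)
  have gen : ∀ (v : ℝ × ℝ) (i : ℝ → ℝ) (h : ℝ × ℝ → ℝ), x + v ∈ Metric.ball x κ →
    (∀ z, p z * v.1 + q z * v.2 = h z * ℓ) → (∀ θ : ℝ, 0 ≤ θ → θ ≤ 1 → x + θ • v ∈ Metric.ball x κ →
      |h (x + θ • v) - h x| ≤ N * ℓ) → |h x| ≤ 2 * U / ℓ + N * ℓ := by
    intro v i h hv he ho
    obtain ⟨θ, a1, a2, a3, a4⟩ := sd_mvt du hx hv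
    rw [he] at a4
    have h1 := sd_abs_sub (hu _ hv) (hu _ hx)
    rw [a4, abs_mul, abs_of_pos hℓ] at h1
    have h2 : |h (x + θ • v)| ≤ 2 * U / ℓ := by rw [le_div_iff₀ hℓ]; linarith
    have h3 := ho θ a1 a2 a3
    rw [abs_sub_comm] at h3
    have := abs_add_le (h x - h (x + θ • v)) (h (x + θ • v))
    rw [sub_add_cancel] at this
    linarith
  constructor
  · refine gen (ℓ, 0) id p ?_ (by simp) ?_
    · have := sd_inball (x := x) hκ hℓ (α := 1) (β := 0) (by norm_num) (by norm_num)
      simpa using this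
    · intro θ h1 h2 h3
      obtain ⟨τ, b1, b2, b3, b4⟩ := sd_mvt dp hx h3
      rw [b4]
      simp only [Prod.smul_mk, smul_eq_mul, mul_zero, add_zero]
      simp only [Prod.smul_mk, smul_eq_mul, mul_zero] at b3
      refine sd_abs_mul (or _ b3) ?_
      rw [abs_of_nonneg (by positivity)]; nlinarith
  · refine gen (0, ℓ) id q ?_ (by simp) ?_
    · have := sd_inball (x := x) hκ hℓ (α := 0) (β := 1) (by norm_num) (by norm_num)
      simpa using this
    · intro θ h1 h2 h3
      obtain ⟨τ, b1, b2, b3, b4⟩ := sd_mvt dq hx h3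
      rw [b4]
      simp only [Prod.smul_mk, smul_eq_mul, mul_zero, zero_add]
      simp only [Prod.smul_mk, smul_eq_mul, mul_zero] at b3
      refine sd_abs_mul (ot _ b3) ?_
      rw [abs_of_nonneg (by positivity)]; nlinarith

lemma sd_cl_abs {Ω : Set (ℝ × ℝ)} {g : ℝ × ℝ → ℝ} {c : ℝ} (hg : ContinuousOn g (closure Ω))
    (h : ∀ x ∈ Ω, |g x| ≤ c) : ∀ x ∈ closure Ω, |g x| ≤ c := by
  intro x hx
  have h1 : ContinuousWithinAt (fun y => |g y|) Ω x := ((hg x hx).mono subset_closure).abs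
  exact ContinuousWithinAt.closure_le hx h1 continuousWithinAt_const h

lemma sd_cl_hol {Ω : Set (ℝ × ℝ)} {g : ℝ × ℝ → ℝ} {c : ℝ} (hg : ContinuousOn g (closure Ω))
    (h : ∀ x ∈ Ω, ∀ y ∈ Ω, |g x - g y| ≤ c * √(dist x y)) :
    ∀ x ∈ closure Ω, ∀ y ∈ closure Ω, |g x - g y| ≤ c * √(dist x y) := by
  have h1 : ∀ x ∈ Ω, ∀ y ∈ closure Ω, |g x - g y| ≤ c * √(dist x y) := by
    intro x hx y hy
    have a1 : ContinuousWithinAt (fun y => |g x - g y|) Ω y :=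
      (continuousWithinAt_const.sub ((hg y hy).mono subset_closure)).abs
    have a2 : ContinuousWithinAt (fun y => c * √(dist x y)) Ω y := by
      apply Continuous.continuousWithinAt; fun_prop
    exact ContinuousWithinAt.closure_le hy a1 a2 (h x hx)
  intro x hx y hy
  have a1 : ContinuousWithinAt (fun x => |g x - g y|) Ω x :=
    (((hg x hx).mono subset_closure).sub continuousWithinAt_const).abs
  have a2 : ContinuousWithinAt (fun x => c * √(dist x y)) Ω x := by
    apply Continuous.continuousWithinAt; fun_prop
  exact ContinuousWithinAt.closure_le hx a1 a2 (fun z hz => h1 z hz y hy)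

lemma HB.closure {Ω : Set (ℝ × ℝ)} {g : ℝ × ℝ → ℝ} {c : ℝ} (hg : ContinuousOn g (closure Ω))
    (h : HB Ω g c) : HB (_root_.closure Ω) g c := by
  obtain ⟨α, β, h1, h2, h3, h4, h5⟩ := h
  exact ⟨α, β, h1, h2, h3, sd_cl_abs hg h4, sd_cl_hol hg h5⟩

lemma sd_interp {Ω : Set (ℝ × ℝ)} (hΩ : IsAnalyticJordanDomain Ω) (η : ℝ) (hη : 0 < η) :
    ∃ C, 0 < C ∧ ∀ u p q r s t U H, SDat Ω u p q r s t → 0 ≤ H → (∀ x ∈ Ω, |u x| ≤ U) →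
      (∀ x ∈ Ω, ∀ y ∈ Ω, |r x - r y| ≤ H * √(dist x y)) →
      (∀ x ∈ Ω, ∀ y ∈ Ω, |s x - s y| ≤ H * √(dist x y)) →
      (∀ x ∈ Ω, ∀ y ∈ Ω, |t x - t y| ≤ H * √(dist x y)) →
      ∀ x ∈ Ω, |r x| ≤ η * H + C * U ∧ |s x| ≤ η * H + C * U ∧ |t x| ≤ η * H + C * U := by
  obtain ⟨κ, hκ, hκδ, hin⟩ := sd_inner hΩ ((η / 3) ^ 2 / 2) (by positivity)
  set ℓ := κ / 4 with hℓ
  have hℓ0 : 0 < ℓ := by positivity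
  refine ⟨4 / ℓ ^ 2, by positivity, ?_⟩
  intro u p q r s t U H hD hH hu or os ot x hx
  obtain ⟨x', hb, hd⟩ := hin x hx
  have osc : ∀ f : ℝ × ℝ → ℝ, (∀ x ∈ Ω, ∀ y ∈ Ω, |f x - f y| ≤ H * √(dist x y)) →
      ∀ z ∈ Metric.ball x' κ, ∀ w ∈ Metric.ball x' κ, |f z - f w| ≤ H * (η / 3) := by
    intro f hf z hz w hw
    refine (hf z (hb hz) w (hb hw)).trans ?_
    gcongr
    rw [Real.sqrt_le_left (by positivity)]
    rw [Metric.mem_ball] at hz hw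
    have := dist_triangle_right z w x'
    linarith
  have osx : ∀ f : ℝ × ℝ → ℝ, (∀ x ∈ Ω, ∀ y ∈ Ω, |f x - f y| ≤ H * √(dist x y)) →
      |f x - f x'| ≤ H * (η / 3) := by
    intro f hf
    refine (hf x hx x' (hb (Metric.mem_ball_self hκ))).trans ?_
    gcongr
    rw [Real.sqrt_le_left (by positivity)]
    have : 0 < (η / 3) ^ 2 := by positivity
    linarith
  obtain ⟨h1, h2, h3⟩ := sd_interp_pt (x := x') (κ := κ) (ℓ := ℓ) (U := U) hℓ0 (by rw [hℓ]; ring)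
    (fun z hz => hD.du z (hb hz)) (fun z hz => hD.dp z (hb hz)) (fun z hz => hD.dq z (hb hz))
    (fun z hz => hu z (hb hz)) (osc r or) (osc s os) (osc t ot)
  have e : η * H + 4 / ℓ ^ 2 * U = (2 * (H * (η / 3)) + 4 * U / ℓ ^ 2) + H * (η / 3) := by ring
  rw [e]
  refine ⟨?_, ?_, ?_⟩
  · have := abs_add_le (r x - r x') (r x')
    rw [sub_add_cancel] at this
    linarith [osx r or]
  · have := abs_add_le (s x - s x') (s x')
    rw [sub_add_cancel] at this
    linarith [osx s os]
  · have := abs_add_le (t x - t x') (t x')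
    rw [sub_add_cancel] at this
    linarith [osx t ot]

structure SDat0 (Ω : Set (ℝ × ℝ)) (u p q r s t : ℝ × ℝ → ℝ) : Prop where
  cp : ContinuousOn p (closure Ω)
  cq : ContinuousOn q (closure Ω)
  du : ∀ x ∈ Ω, HasFDerivAt u (sdE (p x) (q x)) x
  dp : ∀ x ∈ Ω, HasFDerivAt p (sdE (r x) (s x)) x
  dq : ∀ x ∈ Ω, HasFDerivAt q (sdE (s x) (t x)) x

lemma SDat.to0 {Ω : Set (ℝ × ℝ)} {u p q r s t : ℝ × ℝ → ℝ} (h : SDat Ω u p q r s t) : SDat0 Ω u p q r s t :=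
  ⟨h.cp, h.cq, h.du, h.dp, h.dq⟩

lemma sd_interp1 {Ω : Set (ℝ × ℝ)} (hΩ : IsAnalyticJordanDomain Ω) :
    ∃ C, 0 < C ∧ ∀ u p q r s t U N, SDat0 Ω u p q r s t → 0 ≤ U → 0 ≤ N → (∀ x ∈ Ω, |u x| ≤ U) →
      (∀ x ∈ Ω, |r x| ≤ N) → (∀ x ∈ Ω, |s x| ≤ N) → (∀ x ∈ Ω, |t x| ≤ N) →
      HB (closure Ω) p (C * (U + N)) ∧ HB (closure Ω) q (C * (U + N)) := by
  obtain ⟨δ, K, hδ, hK, hlip⟩ := sd_lip hΩ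
  obtain ⟨κ, hκ, hκδ, hin⟩ := sd_inner hΩ δ hδ
  set ℓ := κ / 4 with hℓ
  have hℓ0 : 0 < ℓ := by positivity
  set C1 := 2 / ℓ + ℓ + K * δ with hC1
  have hC10 : 0 < C1 := by positivity
  have hsδ : 0 < √δ := Real.sqrt_pos.mpr hδ
  refine ⟨C1 + (K * √δ + 2 * C1 / √δ), by positivity, ?_⟩
  intro u p q r s t U N hD hU hN hu hr hs ht
  have gen : ∀ h h1 h2 : ℝ × ℝ → ℝ, ContinuousOn h (closure Ω) → (∀ x ∈ Ω, HasFDerivAt h (sdE (h1 x) (h2 x)) x) →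
      (∀ x ∈ Ω, |h1 x| ≤ N) → (∀ x ∈ Ω, |h2 x| ≤ N) → (∀ x', Metric.ball x' κ ⊆ Ω → |h x'| ≤ 2 * U / ℓ + N * ℓ) →
      HB (closure Ω) h ((C1 + (K * √δ + 2 * C1 / √δ)) * (U + N)) := by
    intro h h1 h2 hc hd hh1 hh2 hx'
    have hbd : ∀ x ∈ Ω, |h x| ≤ C1 * (U + N) := by
      intro x hx
      obtain ⟨x', hb, hdx⟩ := hin x hx
      have g1 := hlip x hx x' (hb (Metric.mem_ball_self hκ)) hdx h h1 h2 N hN hd hh1 hh2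
      have g2 := hx' x' hb
      have := abs_add_le (h x - h x') (h x')
      rw [sub_add_cancel] at this
      have g3 : K * N * dist x x' ≤ K * N * δ := by gcongr
      have e : C1 * (U + N) = (2 * U / ℓ + N * ℓ) + K * N * δ + (2 * N / ℓ + ℓ * U + K * δ * U) := by
        rw [hC1]; ring
      have : 0 ≤ 2 * N / ℓ + ℓ * U + K * δ * U := by positivity
      rw [e]; linarith
    refine HB.closure hc ?_
    rw [add_mul]
    refine HB.of_bounds (by positivity) hbd (by positivity) ?_
    intro x hx y hy
    have hUN : 0 ≤ U + N := by linarith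
    by_cases hxy : dist x y < δ
    · have g1 := hlip x hx y hy hxy h h1 h2 N hN hd hh1 hh2
      have g2 : dist x y ≤ √δ * √(dist x y) := sd_sqrt_le dist_nonneg (by rw [Real.sq_sqrt hδ.le]; exact hxy.le) hsδ.le
      calc _ ≤ K * N * dist x y := g1
        _ ≤ K * (U + N) * (√δ * √(dist x y)) := by gcongr; linarith
        _ = (K * √δ + 0) * (U + N) * √(dist x y) := by ring
        _ ≤ _ := by gcongr; positivity
    · have hxy := not_lt.mp hxy
      have g1 := sd_abs_sub (hbd x hx) (hbd y hy)
      have g2 : √δ ≤ √(dist x y) := Real.sqrt_le_sqrt hxy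
      calc _ ≤ 2 * C1 * (U + N) := by linarith
        _ = (0 + 2 * C1 / √δ) * (U + N) * √δ := by field_simp; ring
        _ ≤ _ := by gcongr; positivity
  have pt : ∀ x', Metric.ball x' κ ⊆ Ω → |p x'| ≤ 2 * U / ℓ + N * ℓ ∧ |q x'| ≤ 2 * U / ℓ + N * ℓ := by
    intro x' hb
    exact sd_interp_pt1 (κ := κ) hℓ0 (by rw [hℓ]; ring) (fun z hz => hD.du z (hb hz)) (fun z hz => hD.dp z (hb hz))
      (fun z hz => hD.dq z (hb hz)) (fun z hz => hu z (hb hz)) (fun z hz => hr z (hb hz))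
      (fun z hz => hs z (hb hz)) (fun z hz => ht z (hb hz))
  exact ⟨gen p r s hD.cp hD.dp hr hs (fun x' h => (pt x' h).1), gen q s t hD.cq hD.dq hs ht (fun x' h => (pt x' h).2)⟩

lemma sd_hess {Ω : Set (ℝ × ℝ)} (ho : IsOpen Ω) {u p q r s t : ℝ × ℝ → ℝ} {x : ℝ × ℝ} (hx : x ∈ Ω)
    (du : ∀ x ∈ Ω, HasFDerivAt u (sdE (p x) (q x)) x)
    (dp : ∀ x ∈ Ω, HasFDerivAt p (sdE (r x) (s x)) x)
    (dq : ∀ x ∈ Ω, HasFDerivAt q (sdE (s x) (t x)) x) (hm : IsLocalMax u x) :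
    p x = 0 ∧ q x = 0 ∧ ∀ v w : ℝ, r x * v ^ 2 + 2 * s x * v * w + t x * w ^ 2 ≤ 0 := by
  have h0 := hm.hasFDerivAt_eq_zero (du x hx)
  have hp : p x = 0 := by
    have := congrArg (fun T : ℝ × ℝ →L[ℝ] ℝ => T (1, 0)) h0
    simpa [sdE_apply] using this
  have hq : q x = 0 := by
    have := congrArg (fun T : ℝ × ℝ →L[ℝ] ℝ => T (0, 1)) h0
    simpa [sdE_apply] using this
  refine ⟨hp, hq, fun v w => ?_⟩
  by_contra hpos
  have hpos := not_le.mp hpos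
  set ℓ : ℝ → ℝ × ℝ := fun τ => x + τ • (v, w) with hℓ
  have hℓ0 : ℓ 0 = x := by simp [hℓ]
  have hℓd : ∀ τ, HasDerivAt ℓ (v, w) τ := by
    intro τ
    have := ((hasDerivAt_id τ).smul_const ((v, w) : ℝ × ℝ)).const_add x
    rw [one_smul] at this
    exact this
  have hℓc : Continuous ℓ := by rw [hℓ]; fun_prop
  have hev : ∀ᶠ τ in 𝓝 (0:ℝ), ℓ τ ∈ Ω :=
    hℓc.continuousAt.eventually_mem (by rw [hℓ0]; exact ho.mem_nhds hx)
  have hder : ∀ h h1 h2 : ℝ × ℝ → ℝ, (∀ x ∈ Ω, HasFDerivAt h (sdE (h1 x) (h2 x)) x) → ∀ τ, ℓ τ ∈ Ω →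
      HasDerivAt (fun τ => h (ℓ τ)) (h1 (ℓ τ) * v + h2 (ℓ τ) * w) τ := by
    intro h h1 h2 hh τ hτ
    have := (hh _ hτ).comp_hasDerivAt τ (hℓd τ)
    rwa [sdE_apply] at this
  have hd1 : ∀ᶠ τ in 𝓝 (0:ℝ), deriv (fun τ => u (ℓ τ)) τ = p (ℓ τ) * v + q (ℓ τ) * w := by
    filter_upwards [hev] with τ hτ
    exact (hder u p q du τ hτ).deriv
  have hx' : ℓ 0 ∈ Ω := by rw [hℓ0]; exact hx
  have hd2 : deriv (deriv (fun τ => u (ℓ τ))) 0 = r x * v ^ 2 + 2 * s x * v * w + t x * w ^ 2 := by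
    have e : deriv (fun τ => u (ℓ τ)) =ᶠ[𝓝 0] fun τ => p (ℓ τ) * v + q (ℓ τ) * w := hd1
    rw [e.deriv_eq]
    have := ((hder p r s dp 0 hx').mul_const v).add ((hder q s t dq 0 hx').mul_const w)
    rw [hℓ0] at this
    have e2 := this.deriv
    refine Eq.trans e2 ?_
    ring
  have hmin := isLocalMin_of_deriv_deriv_pos (f := fun τ => u (ℓ τ)) (x₀ := 0) (by rw [hd2]; exact hpos)
    (by rw [hd1.self_of_nhds, hℓ0, hp, hq]; ring) (hder u p q du 0 hx').continuousAt
  have hmax : IsLocalMax (fun τ => u (ℓ τ)) 0 := by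
    have : ∀ᶠ y in 𝓝 (ℓ 0), u y ≤ u x := by rw [hℓ0]; exact hm
    have := hℓc.continuousAt.eventually this
    filter_upwards [this] with τ hτ
    rw [hℓ0]; exact hτ
  have hconst : (fun τ => u (ℓ τ)) =ᶠ[𝓝 0] fun _ => u (ℓ 0) := by
    filter_upwards [hmin, hmax] with τ h1 h2
    exact le_antisymm h2 h1
  have h3 := hconst.deriv.deriv_eq
  simp only [deriv_const', deriv_const] at h3
  rw [hd2] at h3
  linarith

lemma SDat.neg {Ω : Set (ℝ × ℝ)} {u p q r s t : ℝ × ℝ → ℝ} (h : SDat Ω u p q r s t) :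
    SDat Ω (fun x => -u x) (fun x => -p x) (fun x => -q x) (fun x => -r x) (fun x => -s x) (fun x => -t x) := by
  have e : ∀ a b, sdE (-a) (-b) = -sdE a b := by
    intro a b; ext <;> simp [sdE_apply]
  refine ⟨h.cu.neg, h.cp.neg, h.cq.neg, h.cr.neg, h.cs.neg, h.ct.neg, ?_, ?_, ?_, ?_⟩
  · intro x hx; rw [e]; exact (h.du x hx).neg
  · intro x hx; rw [e]; exact (h.dp x hx).neg
  · intro x hx; rw [e]; exact (h.dq x hx).neg
  · intro x hx; rw [h.bu x hx, neg_zero]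

lemma sd_max_one {Ω : Set (ℝ × ℝ)} (hΩ : IsAnalyticJordanDomain Ω) {a b c b1 b2 : ℝ × ℝ → ℝ} {Λ : ℝ} (hΛ : 1 ≤ Λ)
    (hco : SCoef Ω a b c b1 b2 Λ) :
    ∃ C, 0 < C ∧ ∀ (u p q r s t g : ℝ × ℝ → ℝ) (G : ℝ), SDat Ω u p q r s t →
      (∀ x ∈ closure Ω, g x = a x * r x + 2 * b x * s x + c x * t x + b1 x * p x + b2 x * q x) → 0 < G →
      (∀ x ∈ closure Ω, |g x| ≤ G) → ∀ x ∈ closure Ω, u x ≤ C * G := by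
  have hcomp := hΩ.2.1.isCompact_closure
  obtain ⟨M, hM⟩ := hcomp.exists_bound_of_continuousOn (f := fun x : ℝ × ℝ => x.1) continuous_fst.continuousOn
  set α := Λ + 1 with hα
  refine ⟨2 * Real.exp (α * M) * Real.exp (α * M), by positivity, ?_⟩
  intro u p q r s t g G hD hg hG hgb x hx
  set c0 := 2 * Real.exp (α * M) * G with hc0
  have hc0p : 0 < c0 := by positivity
  set φ : ℝ × ℝ → ℝ := fun x => u x + c0 * Real.exp (α * x.1) with hφ
  have hφc : ContinuousOn φ (closure Ω) := by
    refine hD.cu.add (Continuous.continuousOn ?_); fun_prop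
  obtain ⟨y, hy, hmax⟩ := hcomp.exists_isMaxOn ⟨x, hx⟩ hφc
  have hexp : ∀ z ∈ closure Ω, Real.exp (α * z.1) ≤ Real.exp (α * M) := by
    intro z hz
    have := (abs_le.mp (hM z hz)).2
    have : 0 ≤ α := by linarith
    gcongr
  have hbnd : y ∉ Ω := by
    intro hyΩ
    have hed : ∀ (k : ℝ) (x : ℝ × ℝ), HasFDerivAt (fun x : ℝ × ℝ => k * Real.exp (α * x.1)) (sdE (k * α * Real.exp (α * x.1)) 0) x := by
      intro k x
      have h1 : HasFDerivAt (fun x : ℝ × ℝ => α * x.1) _ x := (hasFDerivAt_fst (𝕜 := ℝ) (p := x)).const_mul α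
      have h2 := h1.exp.const_mul k
      refine h2.congr_fderiv ?_
      ext <;> simp [sdE_apply]; ring
    have eadd : ∀ a b c d : ℝ, sdE (a + c) (b + d) = sdE a b + sdE c d := by
      intro a b c d; ext <;> simp [sdE_apply]
    have d1 : ∀ x ∈ Ω, HasFDerivAt φ (sdE (p x + c0 * α * Real.exp (α * x.1)) (q x)) x := by
      intro x hx
      have := (hD.du x hx).add (hed c0 x)
      rw [← eadd, add_zero] at this
      exact this
    have d2 : ∀ x ∈ Ω, HasFDerivAt (fun x : ℝ × ℝ => p x + c0 * α * Real.exp (α * x.1))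
        (sdE (r x + c0 * α * α * Real.exp (α * x.1)) (s x)) x := by
      intro x hx
      have := (hD.dp x hx).add (hed (c0 * α) x)
      rw [← eadd, add_zero] at this
      exact this
    have hlm : IsLocalMax φ y := hmax.isLocalMax (mem_of_superset (hΩ.1.mem_nhds hyΩ) subset_closure)
    obtain ⟨e1, e2, hh⟩ := sd_hess hΩ.1 hyΩ d1 d2 hD.dq hlm
    have ha1 : 1 ≤ a y := by have := hco.ell y hy 1 0; linarith
    set X := Real.exp (α * y.1) with hX
    have hXp : 0 < X := Real.exp_pos _
    have hdet := hco.det y hy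
    have k1 : a y * (r y + c0 * α * α * X) + 2 * b y * s y + c y * t y ≤ 0 := by
      have g1 := hh (a y) (b y)
      have g2 := hh 0 1
      have g3 : t y * (a y * c y - b y ^ 2) ≤ 0 := by nlinarith
      have g4 : a y * (a y * (r y + c0 * α * α * X) + 2 * b y * s y + c y * t y) =
        ((r y + c0 * α * α * X) * a y ^ 2 + 2 * s y * a y * b y + t y * b y ^ 2) + t y * (a y * c y - b y ^ 2) := by ring
      by_contra hn
      have := mul_pos (by linarith : 0 < a y) (not_le.mp hn)
      linarith
    have k2 : g y + c0 * X * (α * (a y * α + b1 y)) ≤ 0 := by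
      rw [hg y hy, e2]
      have : g y = g y := rfl
      have e3 : b1 y * (p y + c0 * α * X) = 0 := by rw [e1, mul_zero]
      linarith
    have k3 : 1 ≤ α * (a y * α + b1 y) := by
      have h1 := (abs_le.mp (hco.hb1.bd hy)).1
      have h2 : 1 ≤ a y * α + b1 y := by nlinarith
      nlinarith
    have k4 : 2 * G ≤ c0 * X := by
      rw [hc0, hX, mul_assoc, mul_assoc, mul_comm G, ← mul_assoc (Real.exp _), ← Real.exp_add]
      have h3 := (abs_le.mp (hM y hy)).1
      have : 1 ≤ Real.exp (α * M + α * y.1) := by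
        rw [Real.one_le_exp_iff]; nlinarith
      nlinarith
    have k5 := (abs_le.mp (hgb y hy)).1
    nlinarith
  have hyf : y ∈ frontier Ω := by rw [hΩ.1.frontier_eq]; exact ⟨hy, hbnd⟩
  have h1 : φ x ≤ φ y := hmax hx
  simp only [hφ, hD.bu y hyf] at h1
  have h2 := hexp y hy
  have h3 : 0 < c0 * Real.exp (α * x.1) := by positivity
  have h4 : c0 * Real.exp (α * y.1) ≤ c0 * Real.exp (α * M) := by gcongr
  have e : 2 * Real.exp (α * M) * Real.exp (α * M) * G = c0 * Real.exp (α * M) := by rw [hc0]; ring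
  rw [e]; linarith

lemma sd_max {Ω : Set (ℝ × ℝ)} (hΩ : IsAnalyticJordanDomain Ω) {a b c b1 b2 : ℝ × ℝ → ℝ} {Λ : ℝ} (hΛ : 1 ≤ Λ)
    (hco : SCoef Ω a b c b1 b2 Λ) :
    ∃ C, 0 < C ∧ ∀ (u p q r s t g : ℝ × ℝ → ℝ) (G : ℝ), SDat Ω u p q r s t →
      (∀ x ∈ closure Ω, g x = a x * r x + 2 * b x * s x + c x * t x + b1 x * p x + b2 x * q x) → 0 < G →
      (∀ x ∈ closure Ω, |g x| ≤ G) → ∀ x ∈ closure Ω, |u x| ≤ C * G := by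
  obtain ⟨C, hC, h⟩ := sd_max_one hΩ hΛ hco
  refine ⟨C, hC, ?_⟩
  intro u p q r s t g G hD hg hG hgb x hx
  have h1 := h u p q r s t g G hD hg hG hgb x hx
  have h2 := h _ _ _ _ _ _ (fun x => -g x) G hD.neg (fun x hx => by rw [hg x hx]; ring) hG
    (fun x hx => by rw [abs_neg]; exact hgb x hx) x hx
  rw [abs_le]; constructor <;> linarith

def SH (Ω : Set (ℝ × ℝ)) (r s t : ℝ × ℝ → ℝ) (H : ℝ) : Prop :=
  (∀ x ∈ Ω, ∀ y ∈ Ω, |r x - r y| ≤ H * √(dist x y)) ∧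
  (∀ x ∈ Ω, ∀ y ∈ Ω, |s x - s y| ≤ H * √(dist x y)) ∧
  (∀ x ∈ Ω, ∀ y ∈ Ω, |t x - t y| ≤ H * √(dist x y))

lemma sd_absorb {Ω : Set (ℝ × ℝ)} {r s t : ℝ × ℝ → ℝ} {H0 X : ℝ} (h0 : 0 ≤ H0) (hX : 0 ≤ X)
    (h : SH Ω r s t H0) (step : ∀ H, 0 ≤ H → SH Ω r s t H → SH Ω r s t (H / 2 + X)) :
    SH Ω r s t (2 * X) := by
  have hn : ∀ n : ℕ, SH Ω r s t (H0 / 2 ^ n + 2 * X) := by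
    intro n
    induction n with
    | zero =>
      obtain ⟨h1, h2, h3⟩ := h
      have e : H0 ≤ H0 / 2 ^ 0 + 2 * X := by rw [pow_zero, div_one]; linarith
      exact ⟨fun x hx y hy => (h1 x hx y hy).trans (by gcongr),
        fun x hx y hy => (h2 x hx y hy).trans (by gcongr), fun x hx y hy => (h3 x hx y hy).trans (by gcongr)⟩
    | succ n ih =>
      have := step _ (by positivity) ih
      have e : (H0 / 2 ^ n + 2 * X) / 2 + X = H0 / 2 ^ (n + 1) + 2 * X := by
        rw [pow_succ]; field_simp; ring
      rwa [e] at this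
  have lim : ∀ A d : ℝ, (∀ n : ℕ, A ≤ (H0 / 2 ^ n + 2 * X) * d) → A ≤ 2 * X * d := by
    intro A d hA
    have h1 : Tendsto (fun n : ℕ => (H0 / 2 ^ n + 2 * X) * d) atTop (𝓝 ((0 + 2 * X) * d)) := by
      refine Tendsto.mul_const _ (Tendsto.add_const _ ?_)
      exact Tendsto.div_atTop tendsto_const_nhds (tendsto_pow_atTop_atTop_of_one_lt (by norm_num))
    rw [zero_add] at h1
    exact ge_of_tendsto' h1 hA
  exact ⟨fun x hx y hy => lim _ _ fun n => (hn n).1 x hx y hy,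
    fun x hx y hy => lim _ _ fun n => (hn n).2.1 x hx y hy, fun x hx y hy => lim _ _ fun n => (hn n).2.2 x hx y hy⟩

lemma sd_schauder {Ω : Set (ℝ × ℝ)} (hΩ : IsAnalyticJordanDomain Ω) {a b c b1 b2 : ℝ × ℝ → ℝ} {Λ : ℝ} (hΛ : 1 ≤ Λ)
    (hco : SCoef Ω a b c b1 b2 Λ) :
    ∃ K, 0 < K ∧ ∀ (u p q r s t g : ℝ × ℝ → ℝ) (G H0 : ℝ), SDat Ω u p q r s t →
      (∀ x ∈ closure Ω, g x = a x * r x + 2 * b x * s x + c x * t x + b1 x * p x + b2 x * q x) → 0 < G →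
      HB (closure Ω) g G → 0 ≤ H0 → SH Ω r s t H0 →
      (∀ x ∈ Ω, |u x| ≤ K * G) ∧ HB Ω p (K * G) ∧ HB Ω q (K * G) ∧
      HB Ω r (K * G) ∧ HB Ω s (K * G) ∧ HB Ω t (K * G) := by
  obtain ⟨C0, hC0, hmax⟩ := sd_max hΩ hΛ hco
  obtain ⟨C1, hC1, hin1⟩ := sd_interp1 hΩ
  obtain ⟨Kg, hKg, hest⟩ := sd_glob_est hΩ hΛ hco (1 / 4) (by norm_num)
  set η1 := 1 / (4 * Kg * (C1 + 1)) with hη1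
  have hη0 : 0 < η1 := by positivity
  have hηe : Kg * (C1 + 1) * η1 = 1 / 4 := by rw [hη1]; field_simp
  obtain ⟨C2, hC2, hin⟩ := sd_interp hΩ η1 hη0
  set Y := Kg * (C1 * C0 + (C1 + 1) * C2 * C0 + 1) with hY
  have hY0 : 0 < Y := by positivity
  set Z := η1 * (2 * Y) + C2 * C0 with hZ
  have hZ0 : 0 < Z := by positivity
  refine ⟨C0 + C1 * (C0 + Z) + Z + 2 * Y, by positivity, ?_⟩
  intro u p q r s t g G H0 hD heq hG hg h0 hH0
  have hU := hmax u p q r s t g G hD heq hG (fun x hx => hg.bd hx)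
  have hU' : ∀ x ∈ Ω, |u x| ≤ C0 * G := fun x hx => hU x (subset_closure hx)
  have hfin : SH Ω r s t (2 * (Y * G)) := by
    refine sd_absorb h0 (by positivity) hH0 ?_
    intro H hH hSH
    have hN := hin u p q r s t (C0 * G) H hD hH hU' hSH.1 hSH.2.1 hSH.2.2
    set N := η1 * H + C2 * (C0 * G) with hNd
    have hN0 : 0 ≤ N := by positivity
    obtain ⟨hp, hq⟩ := hin1 u p q r s t (C0 * G) N hD.to0 (by positivity) hN0 hU' (fun x hx => (hN x hx).1)
      (fun x hx => (hN x hx).2.1) (fun x hx => (hN x hx).2.2)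
    set B := C1 * (C0 * G + N) + N with hB
    have hNB : N ≤ B := by rw [hB]; have : 0 ≤ C1 * (C0 * G + N) := by positivity
                           linarith
    have hbd : SBd Ω p q r s t g B H G := by
      refine ⟨by positivity, hH, hp.mono (by linarith), hq.mono (by linarith), ?_, ?_, ?_,
        sd_cl_hol hD.cr hSH.1, sd_cl_hol hD.cs hSH.2.1, sd_cl_hol hD.ct hSH.2.2, hg⟩
      · exact sd_cl_abs hD.cr fun x hx => (hN x hx).1.trans hNB
      · exact sd_cl_abs hD.cs fun x hx => (hN x hx).2.1.trans hNB
      · exact sd_cl_abs hD.ct fun x hx => (hN x hx).2.2.trans hNB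
    have e : 1 / 4 * H + Kg * (B + G) = H / 2 + Y * G := by
      have : Kg * (B + G) = (Kg * (C1 + 1) * η1) * H + Y * G := by rw [hB, hNd, hY]; ring
      rw [this, hηe]; ring
    refine ⟨fun x hx y hy => ?_, fun x hx y hy => ?_, fun x hx y hy => ?_⟩
    · have := (hest x hx y hy u p q r s t g B H G hD hbd heq).1
      rwa [e] at this
    · have := (hest x hx y hy u p q r s t g B H G hD hbd heq).2.1
      rwa [e] at this
    · have := (hest x hx y hy u p q r s t g B H G hD hbd heq).2.2
      rwa [e] at this
  have hN := hin u p q r s t (C0 * G) _ hD (by positivity) hU' hfin.1 hfin.2.1 hfin.2.2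
  have eN : η1 * (2 * (Y * G)) + C2 * (C0 * G) = Z * G := by rw [hZ]; ring
  rw [eN] at hN
  obtain ⟨hp, hq⟩ := hin1 u p q r s t (C0 * G) (Z * G) hD.to0 (by positivity) (by positivity) hU' (fun x hx => (hN x hx).1)
    (fun x hx => (hN x hx).2.1) (fun x hx => (hN x hx).2.2)
  have m1 : 0 ≤ C0 * G := by positivity
  have m2 : 0 ≤ C1 * (C0 * G + Z * G) := by positivity
  have m3 : 0 ≤ Z * G := by positivity
  have m4 : 0 ≤ Y * G := by positivity
  have eK : (C0 + C1 * (C0 + Z) + Z + 2 * Y) * G = C0 * G + C1 * (C0 * G + Z * G) + Z * G + 2 * (Y * G) := by ring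
  rw [eK]
  refine ⟨fun x hx => (hU' x hx).trans (by linarith), (hp.subset subset_closure).mono (by linarith),
    (hq.subset subset_closure).mono (by linarith), ?_, ?_, ?_⟩
  · exact (HB.of_bounds m3 (fun x hx => (hN x hx).1) (by positivity) hfin.1).mono (by linarith)
  · exact (HB.of_bounds m3 (fun x hx => (hN x hx).2.1) (by positivity) hfin.2.1).mono (by linarith)
  · exact (HB.of_bounds m3 (fun x hx => (hN x hx).2.2) (by positivity) hfin.2.2).mono (by linarith)

lemma sd_pd {g : ℝ × ℝ → ℝ} {x : ℝ × ℝ} (h : DifferentiableAt ℝ g x) :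
    pdx g x = fderiv ℝ g x (1, 0) ∧ pdy g x = fderiv ℝ g x (0, 1) ∧ HasFDerivAt g (sdE (pdx g x) (pdy g x)) x := by
  have h1 : pdx g x = fderiv ℝ g x (1, 0) := by
    have e : HasDerivAt (fun s : ℝ => (s, x.2)) ((1:ℝ), (0:ℝ)) x.1 := (hasDerivAt_id _).prodMk (hasDerivAt_const _ _)
    exact (HasFDerivAt.comp_hasDerivAt (l := g) x.1 (f := fun s : ℝ => (s, x.2)) h.hasFDerivAt e).deriv
  have h2 : pdy g x = fderiv ℝ g x (0, 1) := by
    have e : HasDerivAt (fun s : ℝ => (x.1, s)) ((0:ℝ), (1:ℝ)) x.2 := (hasDerivAt_const _ _).prodMk (hasDerivAt_id _)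
    exact (HasFDerivAt.comp_hasDerivAt (l := g) x.2 (f := fun s : ℝ => (x.1, s)) h.hasFDerivAt e).deriv
  refine ⟨h1, h2, ?_⟩
  refine h.hasFDerivAt.congr_fderiv ?_
  rw [h1, h2]
  ext <;> simp [sdE_apply]

lemma sd_link {Ω : Set (ℝ × ℝ)} (ho : IsOpen Ω) {f : ℝ × ℝ → ℝ} (hf : IsC2Half f Ω) :
    SDat0 Ω f (pdx f) (pdy f) (fxx f) (fxy f) (fyy f) := by
  obtain ⟨hc, c0, cp, cq, cr, cs, ct, -⟩ := hf
  have hat : ∀ x ∈ Ω, ContDiffAt ℝ 2 f x := fun x hx => hc.contDiffAt (ho.mem_nhds hx)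
  have hd : ∀ x ∈ Ω, DifferentiableAt ℝ f x := fun x hx => (hat x hx).differentiableAt (by norm_num)
  have hd2 : ∀ x ∈ Ω, DifferentiableAt ℝ (fderiv ℝ f) x := fun x hx =>
    ((hat x hx).fderiv_right (m := 1) (by norm_num)).differentiableAt (by norm_num)
  have key : ∀ x ∈ Ω, ∀ v : ℝ × ℝ, ∀ g : ℝ × ℝ → ℝ, (∀ y ∈ Ω, g y = fderiv ℝ f y v) →
      HasFDerivAt g ((fderiv ℝ (fderiv ℝ f) x).flip v) x := by
    intro x hx v g hg
    have h1 : HasFDerivAt (fun y => fderiv ℝ f y v) ((fderiv ℝ (fderiv ℝ f) x).flip v) x :=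
      ((ContinuousLinearMap.apply ℝ ℝ v).hasFDerivAt.comp x (hd2 x hx).hasFDerivAt).congr_fderiv (by ext <;> simp)
    refine h1.congr_of_eventuallyEq ?_
    filter_upwards [ho.mem_nhds hx] with y hy using hg y hy
  have kx := fun x hx => key x hx (1, 0) (pdx f) fun y hy => (sd_pd (hd y hy)).1
  have ky := fun x hx => key x hx (0, 1) (pdy f) fun y hy => (sd_pd (hd y hy)).2.1
  refine ⟨cp, cq, fun x hx => (sd_pd (hd x hx)).2.2, fun x hx => (sd_pd (kx x hx).differentiableAt).2.2,
    fun x hx => ?_⟩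
  have h3 := sd_pd (ky x hx).differentiableAt
  have e : pdx (pdy f) x = fxy f x := by
    rw [h3.1, (ky x hx).fderiv]
    rw [fxy, (sd_pd (kx x hx).differentiableAt).2.1, (kx x hx).fderiv]
    have := (hat x hx).isSymmSndFDerivAt (by simp)
    exact this (1, 0) (0, 1)
  have h4 := h3.2.2
  rwa [e] at h4

lemma sd_rp (u v : ℝ × ℝ) : ‖u - v‖ ^ ((1:ℝ) / 2) = √(dist u v) := by
  rw [Real.sqrt_eq_rpow, dist_eq_norm]

lemma sd_c0_nn (g : ℝ × ℝ → ℝ) (s : Set (ℝ × ℝ)) : 0 ≤ C0norm g s := by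
  refine Real.sSup_nonneg ?_
  rintro _ ⟨x, -, rfl⟩; exact abs_nonneg _

lemma sd_hs_nn (g : ℝ × ℝ → ℝ) (s : Set (ℝ × ℝ)) : 0 ≤ holderSemi g s := by
  refine Real.sSup_nonneg ?_
  rintro _ ⟨x, -, y, -, -, rfl⟩; positivity

lemma sd_c0_ge {Ω : Set (ℝ × ℝ)} (hb : Bornology.IsBounded Ω) {g : ℝ × ℝ → ℝ} (hg : ContinuousOn g (closure Ω)) :
    ∀ x ∈ Ω, |g x| ≤ C0norm g Ω := by
  intro x hx
  obtain ⟨M, hM⟩ := hb.isCompact_closure.exists_bound_of_continuousOn hg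
  refine le_csSup ⟨M, ?_⟩ ⟨x, hx, rfl⟩
  rintro _ ⟨y, hy, rfl⟩; exact hM y (subset_closure hy)

lemma sd_hs_ge {Ω : Set (ℝ × ℝ)} {g : ℝ × ℝ → ℝ} (hg : HolderHalfOn g Ω) :
    ∀ x ∈ Ω, ∀ y ∈ Ω, |g x - g y| ≤ holderSemi g Ω * √(dist x y) := by
  intro x hx y hy
  obtain ⟨C, hC⟩ := hg
  rcases eq_or_ne x y with rfl | hne
  · simp
  have hd : 0 < √(dist x y) := Real.sqrt_pos.mpr (dist_pos.mpr hne)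
  rw [← div_le_iff₀ hd]
  refine le_csSup ⟨C, ?_⟩ ⟨x, hx, y, hy, hne, by rw [sd_rp]⟩
  rintro _ ⟨u, hu, v, hv, huv, rfl⟩
  have hd : 0 < √(dist u v) := Real.sqrt_pos.mpr (dist_pos.mpr huv)
  have := hC u hu v hv
  rw [sd_rp] at *
  rwa [div_le_iff₀ hd]

lemma sd_norm_link {Ω : Set (ℝ × ℝ)} (hb : Bornology.IsBounded Ω) {f : ℝ × ℝ → ℝ} (hf : IsC2Half f Ω) :
    0 ≤ C2halfNorm f Ω ∧ (∀ x ∈ Ω, |f x| ≤ C2halfNorm f Ω) ∧ HB Ω (fxx f) (C2halfNorm f Ω) ∧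
    HB Ω (fxy f) (C2halfNorm f Ω) ∧ HB Ω (fyy f) (C2halfNorm f Ω) := by
  obtain ⟨hc, c0, cp, cq, cr, cs, ct, hr, hs, ht⟩ := hf
  have n0 := sd_c0_nn f Ω
  have n1 : 0 ≤ max (C0norm (pdx f) Ω) (C0norm (pdy f) Ω) := (sd_c0_nn _ _).trans (le_max_left _ _)
  have n2 : 0 ≤ max (C0norm (fxx f) Ω) (max (C0norm (fxy f) Ω) (C0norm (fyy f) Ω)) := (sd_c0_nn _ _).trans (le_max_left _ _)
  have n3 : 0 ≤ max (holderSemi (fxx f) Ω) (max (holderSemi (fxy f) Ω) (holderSemi (fyy f) Ω)) := (sd_hs_nn _ _).trans (le_max_left _ _)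
  unfold C2halfNorm C2norm
  refine ⟨by linarith, fun x hx => (sd_c0_ge hb c0 x hx).trans (by linarith), ?_, ?_, ?_⟩
  · refine (HB.of_bounds (sd_c0_nn _ _) (sd_c0_ge hb cr) (sd_hs_nn _ _) (sd_hs_ge hr)).mono ?_
    have a1 := le_max_left (C0norm (fxx f) Ω) (max (C0norm (fxy f) Ω) (C0norm (fyy f) Ω))
    have a2 := le_max_left (holderSemi (fxx f) Ω) (max (holderSemi (fxy f) Ω) (holderSemi (fyy f) Ω))
    linarith
  · refine (HB.of_bounds (sd_c0_nn _ _) (sd_c0_ge hb cs) (sd_hs_nn _ _) (sd_hs_ge hs)).mono ?_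
    have a1 := (le_max_left _ _).trans (le_max_right (C0norm (fxx f) Ω) (max (C0norm (fxy f) Ω) (C0norm (fyy f) Ω)))
    have a2 := (le_max_left _ _).trans (le_max_right (holderSemi (fxx f) Ω) (max (holderSemi (fxy f) Ω) (holderSemi (fyy f) Ω)))
    linarith
  · refine (HB.of_bounds (sd_c0_nn _ _) (sd_c0_ge hb ct) (sd_hs_nn _ _) (sd_hs_ge ht)).mono ?_
    have a1 := (le_max_right _ _).trans (le_max_right (C0norm (fxx f) Ω) (max (C0norm (fxy f) Ω) (C0norm (fyy f) Ω)))
    have a2 := (le_max_right _ _).trans (le_max_right (holderSemi (fxx f) Ω) (max (holderSemi (fxy f) Ω) (holderSemi (fyy f) Ω)))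
    linarith

lemma sd_c0_le {Ω : Set (ℝ × ℝ)} {g : ℝ × ℝ → ℝ} {M : ℝ} (h0 : 0 ≤ M) (h : ∀ x ∈ Ω, |g x| ≤ M) : C0norm g Ω ≤ M := by
  refine Real.sSup_le ?_ h0
  rintro _ ⟨x, hx, rfl⟩; exact h x hx

lemma sd_hs_le {Ω : Set (ℝ × ℝ)} {g : ℝ × ℝ → ℝ} {M : ℝ} (h : HB Ω g M) : holderSemi g Ω ≤ M := by
  refine Real.sSup_le ?_ h.nonneg
  rintro _ ⟨u, hu, v, hv, huv, rfl⟩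
  have hd : 0 < √(dist u v) := Real.sqrt_pos.mpr (dist_pos.mpr huv)
  rw [sd_rp, div_le_iff₀ hd]
  exact h.hol hu hv

lemma sd_norm_le {Ω : Set (ℝ × ℝ)} {f : ℝ × ℝ → ℝ} {M : ℝ} (h0 : ∀ x ∈ Ω, |f x| ≤ M) (hp : HB Ω (pdx f) M)
    (hq : HB Ω (pdy f) M) (hr : HB Ω (fxx f) M) (hs : HB Ω (fxy f) M) (ht : HB Ω (fyy f) M) :
    C2halfNorm f Ω ≤ 4 * M := by
  have hM := hp.nonneg
  have cc : ∀ {g : ℝ × ℝ → ℝ}, HB Ω g M → C0norm g Ω ≤ M := fun h => sd_c0_le hM fun x hx => h.bd hx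
  have a1 := sd_c0_le hM h0
  have a2 := max_le (cc hp) (cc hq)
  have a3 := max_le (cc hr) (max_le (cc hs) (cc ht))
  have a4 := max_le (sd_hs_le hr) (max_le (sd_hs_le hs) (sd_hs_le ht))
  unfold C2halfNorm C2norm
  linarith

def cv (x y : ℕ → ℝ) (n : ℕ) : ℝ := ∑ i ∈ Finset.range (n + 1), x i * y (n - i)

lemma cv_nn {x y : ℕ → ℝ} (hx : ∀ n, 0 ≤ x n) (hy : ∀ n, 0 ≤ y n) (n : ℕ) : 0 ≤ cv x y n :=
  Finset.sum_nonneg fun _ _ => mul_nonneg (hx _) (hy _)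

lemma cv_smul (c d : ℝ) (x y : ℕ → ℝ) (n : ℕ) : cv (fun k => c * x k) (fun k => d * y k) n = c * d * cv x y n := by
  unfold cv; rw [Finset.mul_sum]; exact Finset.sum_congr rfl fun i _ => by ring

lemma HB.smul {T : Set (ℝ × ℝ)} {g : ℝ × ℝ → ℝ} {c : ℝ} (h : HB T g c) (k : ℝ) : HB T (fun x => k * g x) (|k| * c) :=
  (HB.const k).mul h

lemma HB.conv {T : Set (ℝ × ℝ)} {F G : ℕ → ℝ × ℝ → ℝ} {x y : ℕ → ℝ}
    (hF : ∀ k, HB T (F k) (k.factorial * x k)) (hG : ∀ k, HB T (G k) (k.factorial * y k)) (n : ℕ) :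
    HB T (fun p => ∑ i ∈ Finset.range (n + 1), (n.choose i : ℝ) * F i p * G (n - i) p) (n.factorial * cv x y n) := by
  have h : ∀ i ∈ Finset.range (n + 1), HB T (fun p => (n.choose i : ℝ) * F i p * G (n - i) p)
      (n.factorial * (x i * y (n - i))) := by
    intro i hi
    have hi : i ≤ n := Nat.lt_succ_iff.mp (Finset.mem_range.mp hi)
    refine (((hF i).smul (n.choose i : ℝ)).mul (hG (n - i))).mono (le_of_eq ?_)
    rw [Nat.abs_cast]
    have := Nat.choose_mul_factorial_mul_factorial hi
    have : (n.choose i : ℝ) * i.factorial * (n - i).factorial = n.factorial := by exact_mod_cast this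
    rw [← this]; ring
  have := HB.sum (Finset.range (n + 1)) h
  rwa [← Finset.mul_sum] at this

structure SQ (T : Set (ℝ × ℝ)) (f : ℕ → ℝ × ℝ → ℝ) (e : ℕ → ℝ) : Prop where
  nn : ∀ k, 0 ≤ e k
  one : 1 ≤ e 0
  hp : ∀ k, HB T (pdx (f k)) (k.factorial * e k)
  hq : ∀ k, HB T (pdy (f k)) (k.factorial * e k)
  hr : ∀ k, HB T (fxx (f k)) (k.factorial * e k)
  hs : ∀ k, HB T (fxy (f k)) (k.factorial * e k)
  ht : ∀ k, HB T (fyy (f k)) (k.factorial * e k)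

namespace SQ
variable {T : Set (ℝ × ℝ)} {f : ℕ → ℝ × ℝ → ℝ} {e : ℕ → ℝ}

lemma nn2 (h : SQ T f e) (k : ℕ) : 0 ≤ cv e e k := cv_nn h.nn h.nn k

lemma delta (h : SQ T f e) (r : ℕ) : HB T (fun _ => if r = 0 then (1:ℝ) else 0) (r.factorial * cv e e r) := by
  rcases Nat.eq_zero_or_pos r with rfl | hr
  · refine (HB.const _).mono ?_
    simp [cv]
    nlinarith [h.one]
  · refine (HB.const _).mono ?_
    rw [if_neg hr.ne', abs_zero]
    exact mul_nonneg (by positivity) (h.nn2 r)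

lemma fy2 (h : SQ T f e) (r : ℕ) : HB T (fy2r f r) (r.factorial * (2 * cv e e r)) :=
  ((h.delta r).add (HB.conv h.hq h.hq r)).mono (le_of_eq (by ring))

lemma fx2 (h : SQ T f e) (r : ℕ) : HB T (fx2r f r) (r.factorial * (2 * cv e e r)) :=
  ((h.delta r).add (HB.conv h.hp h.hp r)).mono (le_of_eq (by ring))

lemma fxfy (h : SQ T f e) (r : ℕ) : HB T (fxfyr f r) (r.factorial * (1 * cv e e r)) :=
  (HB.conv h.hp h.hq r).mono (le_of_eq (by ring))

lemma gs (h : SQ T f e) (r : ℕ) : HB T (gradSqr f r) (r.factorial * (3 * cv e e r)) := by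
  refine (((h.delta r).add ((HB.conv h.hp h.hp r).add (HB.conv h.hq h.hq r))).mono (le_of_eq (by ring))).congr ?_
  intro p _
  rw [gradSqr, ← Finset.sum_add_distrib]
  congr 1
  exact Finset.sum_congr rfl fun i _ => by ring

lemma hd (h : SQ T f e) (r : ℕ) : HB T (hessDiscr f r) (r.factorial * (2 * cv e e r)) := by
  refine (((HB.conv h.hs h.hs r).sub (HB.conv h.hr h.ht r)).mono (le_of_eq (by ring))).congr ?_
  intro p _
  rw [hessDiscr, ← Finset.sum_sub_distrib]
  exact Finset.sum_congr rfl fun i _ => by ring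

lemma ks (h : SQ T f e) (n : ℕ) : HB T (Kseq f n) (n.factorial * (6 * cv (cv e e) (cv e e) n)) := by
  refine ((HB.conv h.gs h.hd n).neg).mono (le_of_eq ?_)
  rw [cv_smul]; ring

lemma hs3 (h : SQ T f e) (n : ℕ) : HB T (Hseq f n) (n.factorial * (3 * cv (cv e e) e n)) := by
  have e1 : ∀ k, HB T (fxx (f k)) (k.factorial * (1 * e k)) := fun k => by rw [one_mul]; exact h.hr k
  have e2 : ∀ k, HB T (fxy (f k)) (k.factorial * (1 * e k)) := fun k => by rw [one_mul]; exact h.hs k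
  have e3 : ∀ k, HB T (fyy (f k)) (k.factorial * (1 * e k)) := fun k => by rw [one_mul]; exact h.ht k
  refine (((((HB.conv h.fy2 e1 n).sub ((HB.conv h.fxfy e2 n).smul 2)).add (HB.conv h.fx2 e3 n)).smul (1 / 2)).mono
    (le_of_eq ?_)).congr ?_
  · rw [cv_smul, cv_smul, abs_of_pos (by norm_num : (0:ℝ) < 1 / 2), abs_of_pos (by norm_num : (0:ℝ) < 2)]; ring
  · intro p _
    rw [Hseq, Finset.mul_sum (Finset.range (n + 1)) _ (2:ℝ), ← Finset.sum_sub_distrib, ← Finset.sum_add_distrib]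
    congr 1
    exact Finset.sum_congr rfl fun i _ => by ring

lemma hop (h : SQ T f e) {r : ℕ} (hr : 1 ≤ r) (k : ℕ) :
    HB T (Hop f r (f k)) (r.factorial * k.factorial * (10 * (cv e e r * e k))) := by
  have h0 : e 0 * e r ≤ cv e e r := by
    refine (le_of_eq ?_).trans (Finset.single_le_sum (f := fun i => e i * e (r - i)) (fun i _ => mul_nonneg (h.nn _) (h.nn _))
      (Finset.mem_range.mpr (Nat.succ_pos r)))
    simp
  have hb : ∀ {A B C D : ℝ × ℝ → ℝ}, HB T A (Nat.factorial 0 * e 0) → HB T B (r.factorial * e r) →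
      HB T C (Nat.factorial 0 * e 0) → HB T D (r.factorial * e r) →
      HB T (fun p => A p * B p - C p * D p) (r.factorial * (2 * cv e e r)) := by
    intro A B C D hA hB hC hD
    refine ((hA.mul hB).sub (hC.mul hD)).mono ?_
    have : (r.factorial : ℝ) * (e 0 * e r) ≤ r.factorial * cv e e r := by gcongr
    simp only [Nat.factorial_zero, Nat.cast_one, one_mul]
    linarith
  have b1 := hb (h.ht 0) (h.hp r) (h.hs 0) (h.hq r)
  have b2 := hb (h.hr 0) (h.hq r) (h.hs 0) (h.hp r)
  have := (((((h.fy2 r).mul (h.hr k)).sub (((h.fxfy r).smul 2).mul (h.hs k))).add ((h.fx2 r).mul (h.ht k))).add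
    (b1.mul (h.hp k))).add (b2.mul (h.hq k))
  refine (this.mono (le_of_eq ?_)).congr ?_
  · rw [abs_of_pos (by norm_num : (0:ℝ) < 2)]; ring
  · intro p _
    rw [Hop, if_neg (by omega)]; ring

lemma rhs (h : SQ T f e) {L : ℝ} (hL : HB T (fun p => 1 / √(-Kseq f 0 p)) L) {m : ℕ} (hm : 1 ≤ m) :
    HB T (ellipticRHS f m) (10 * (m.factorial * ∑ r ∈ Finset.Icc 1 (m - 1), cv e e r * e (m - r)) +
      L * (6 * (m * ((m - 1).factorial * cv (cv e e) (cv e e) (m - 1))) +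
        36 * (1 / ((m:ℝ) + 1) * ((m + 1).factorial *
          ∑ r ∈ Finset.Icc 2 (m - 1), cv (cv e e) e r * cv (cv e e) e (m + 1 - r))))) := by
  have hch : ∀ {n r : ℕ}, r ≤ n → (n.choose r : ℝ) * (r.factorial * (n - r).factorial) = n.factorial := by
    intro n r hr
    have := Nat.choose_mul_factorial_mul_factorial hr
    rw [← mul_assoc]; exact_mod_cast this
  have s1 : HB T (fun p => ∑ r ∈ Finset.Icc 1 (m - 1), (m.choose r : ℝ) * Hop f r (f (m - r)) p)
      (∑ r ∈ Finset.Icc 1 (m - 1), m.factorial * (10 * (cv e e r * e (m - r)))) := by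
    refine HB.sum _ fun r hr => ?_
    rw [Finset.mem_Icc] at hr
    refine ((h.hop hr.1 (m - r)).smul (m.choose r : ℝ)).mono (le_of_eq ?_)
    rw [Nat.abs_cast, ← hch (show r ≤ m by omega)]; ring
  have s2 : HB T (fun p => ∑ r ∈ Finset.Icc 2 (m - 1), ((m + 1).choose r : ℝ) * Hseq f r p * Hseq f (m - r + 1) p)
      (∑ r ∈ Finset.Icc 2 (m - 1), (m + 1).factorial * (9 * (cv (cv e e) e r * cv (cv e e) e (m + 1 - r)))) := by
    refine HB.sum _ fun r hr => ?_
    rw [Finset.mem_Icc] at hr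
    rw [show m - r + 1 = m + 1 - r by omega]
    refine (((h.hs3 r).smul ((m + 1).choose r : ℝ)).mul (h.hs3 (m + 1 - r))).mono (le_of_eq ?_)
    rw [Nat.abs_cast, ← hch (show r ≤ m + 1 by omega)]; ring
  have s3 := (((h.ks (m - 1)).smul (-(m:ℝ))).sub (s2.smul (4 / ((m:ℝ) + 1)))).mul
    (hL.smul (1 / (2:ℝ) ^ (1 - (if m = 1 then 1 else 0) : ℕ)))
  have s4 := s1.neg.add s3
  refine (s4.mono ?_).congr ?_
  · simp only [← Finset.mul_sum]
    rw [abs_neg, Nat.abs_cast, abs_of_pos (by positivity : 0 < 4 / ((m:ℝ) + 1))]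
    have h2 : |1 / (2:ℝ) ^ (1 - (if m = 1 then 1 else 0) : ℕ)| ≤ 1 := by
      split_ifs <;> norm_num [abs_of_pos]
    have n4 := cv_nn h.nn2 h.nn2 (m - 1)
    have n3 := cv_nn h.nn2 h.nn
    have n6 : 0 ≤ ∑ r ∈ Finset.Icc 2 (m - 1), cv (cv e e) e r * cv (cv e e) e (m + 1 - r) :=
      Finset.sum_nonneg fun r _ => mul_nonneg (n3 _) (n3 _)
    have h3 : |1 / (2:ℝ) ^ (1 - (if m = 1 then 1 else 0) : ℕ)| * L ≤ L := by
      have := mul_le_mul_of_nonneg_right h2 hL.nonneg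
      rwa [one_mul] at this
    have h4 : 0 ≤ (m:ℝ) * ((m - 1).factorial * (6 * cv (cv e e) (cv e e) (m - 1))) + 4 / ((m:ℝ) + 1) * ((m + 1).factorial * (9 * ∑ r ∈ Finset.Icc 2 (m - 1), cv (cv e e) e r * cv (cv e e) e (m + 1 - r))) := by
      positivity
    have h5 := mul_le_mul_of_nonneg_left h3 h4
    refine (add_le_add_right h5 _).trans (le_of_eq ?_)
    ring
  · intro p _
    rw [ellipticRHS]
    congr 1
    rw [div_eq_mul_inv, mul_inv]
    simp only [one_div]
end SQ

def gpol {κ : Type*} (t : Finset κ) (w : κ → ℕ) (c : κ → ℝ) : Polynomial ℝ := ∑ x ∈ t, Polynomial.monomial (w x) (c x)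

lemma gpol_mul {κ ι : Type*} (t : Finset κ) (w : κ → ℕ) (c : κ → ℝ) (t' : Finset ι) (w' : ι → ℕ) (c' : ι → ℝ) :
    gpol t w c * gpol t' w' c' = gpol (t ×ˢ t') (fun x => w x.1 + w' x.2) (fun x => c x.1 * c' x.2) := by
  unfold gpol
  rw [Finset.sum_mul_sum, Finset.sum_product]
  simp only [Polynomial.monomial_mul_monomial]

lemma gpol_coeff {κ : Type*} (t : Finset κ) (w : κ → ℕ) (c : κ → ℝ) (N : ℕ) :
    (gpol t w c).coeff N = ∑ x ∈ t.filter (fun x => w x = N), c x := by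
  unfold gpol
  rw [Polynomial.finsetSum_coeff, Finset.sum_filter]
  simp only [Polynomial.coeff_monomial]

def gp (e : ℕ → ℝ) (m : ℕ) : Polynomial ℝ := gpol (Finset.range m) id e

lemma gp_coeff (e : ℕ → ℝ) {m k : ℕ} (hk : k < m) : (gp e m).coeff k = e k := by
  rw [gp, gpol_coeff]
  have : (Finset.range m).filter (fun x => id x = k) = {k} := by
    ext x; simp [hk]
  rw [this, Finset.sum_singleton]

lemma pol_mul_coeff (P Q : Polynomial ℝ) (n : ℕ) : (P * Q).coeff n = cv P.coeff Q.coeff n := by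
  rw [Polynomial.coeff_mul, Finset.Nat.sum_antidiagonal_eq_sum_range_succ_mk]; rfl

lemma cv_congr {x y x' y' : ℕ → ℝ} {n : ℕ} (hx : ∀ k ≤ n, x k = x' k) (hy : ∀ k ≤ n, y k = y' k) : cv x y n = cv x' y' n := by
  refine Finset.sum_congr rfl fun i hi => ?_
  rw [hx i (Nat.lt_succ_iff.mp (Finset.mem_range.mp hi)), hy _ (Nat.sub_le _ _)]

lemma gp_nn {e : ℕ → ℝ} (he : ∀ k, 0 ≤ e k) (m k : ℕ) : 0 ≤ (gp e m).coeff k := by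
  rw [gp, gpol_coeff]; exact Finset.sum_nonneg fun _ _ => he _

lemma gp2 (e : ℕ → ℝ) {m k : ℕ} (hk : k < m) : (gp e m * gp e m).coeff k = cv e e k := by
  rw [pol_mul_coeff]
  exact cv_congr (fun j hj => gp_coeff e (by omega)) (fun j hj => gp_coeff e (by omega))

lemma gp3 (e : ℕ → ℝ) {m k : ℕ} (hk : k < m) : (gp e m * gp e m * gp e m).coeff k = cv (cv e e) e k := by
  rw [pol_mul_coeff]
  exact cv_congr (fun j hj => gp2 e (by omega)) (fun j hj => gp_coeff e (by omega))

lemma gp2_nn {e : ℕ → ℝ} (he : ∀ k, 0 ≤ e k) (m k : ℕ) : 0 ≤ (gp e m * gp e m).coeff k := by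
  rw [pol_mul_coeff]; exact cv_nn (gp_nn he m) (gp_nn he m) k

lemma gp3_nn {e : ℕ → ℝ} (he : ∀ k, 0 ≤ e k) (m k : ℕ) : 0 ≤ (gp e m * gp e m * gp e m).coeff k := by
  rw [pol_mul_coeff]; exact cv_nn (gp2_nn he m) (gp_nn he m) k

lemma multi3 (e : ℕ → ℝ) (m : ℕ) :
    multinom3Sum (fun k => k.factorial * e k) m = m.factorial * (gp e m * gp e m * gp e m).coeff m := by
  rw [mul_assoc, gp, gpol_mul, gpol_mul, gpol_coeff, Finset.mul_sum, multinom3Sum]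
  refine Finset.sum_congr (Finset.filter_congr fun x _ => by simp only [id, add_assoc]) fun x _ => ?_
  field_simp

lemma multi4 (e : ℕ → ℝ) (m : ℕ) :
    multinom4Sum (fun k => k.factorial * e k) m =
      (m - 1).factorial * (gp e m * gp e m * (gp e m * gp e m)).coeff (m - 1) := by
  rw [mul_assoc, gp, gpol_mul, gpol_mul, gpol_mul, gpol_coeff, Finset.mul_sum, multinom4Sum]
  refine Finset.sum_congr (Finset.filter_congr fun x _ => by simp only [id, add_assoc]) fun x _ => ?_
  field_simp

lemma multi6 (e : ℕ → ℝ) (m : ℕ) :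
    multinom6Sum (fun k => k.factorial * e k) m =
      (m + 1).factorial * (gp e m * gp e m * gp e m * (gp e m * gp e m * gp e m)).coeff (m + 1) := by
  rw [mul_assoc, mul_assoc, mul_assoc, gp, gpol_mul, gpol_mul, gpol_mul, gpol_mul, gpol_mul, gpol_coeff, Finset.mul_sum, multinom6Sum]
  refine Finset.sum_congr (Finset.filter_congr fun x _ => by simp only [id, add_assoc]) fun x _ => ?_
  field_simp

lemma sub_cv {x y : ℕ → ℝ} (hx : ∀ n, 0 ≤ x n) (hy : ∀ n, 0 ≤ y n) {x' y' : ℕ → ℝ} {a b n : ℕ} (hb : b ≤ n)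
    (h : ∀ r, a ≤ r → r ≤ b → x r = x' r ∧ y (n - r) = y' (n - r)) :
    ∑ r ∈ Finset.Icc a b, x' r * y' (n - r) ≤ cv x y n := by
  calc _ = ∑ r ∈ Finset.Icc a b, x r * y (n - r) := by
        refine Finset.sum_congr rfl fun r hr => ?_
        rw [Finset.mem_Icc] at hr
        rw [(h r hr.1 hr.2).1, (h r hr.1 hr.2).2]
    _ ≤ _ := by
        refine Finset.sum_le_sum_of_subset_of_nonneg ?_ fun i _ _ => mul_nonneg (hx _) (hy _)
        intro r hr
        rw [Finset.mem_Icc] at hr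
        rw [Finset.mem_range]; omega

lemma SQ.rhs2 {T : Set (ℝ × ℝ)} {f : ℕ → ℝ × ℝ → ℝ} {e : ℕ → ℝ} (h : SQ T f e) {L : ℝ}
    (hL : HB T (fun p => 1 / √(-Kseq f 0 p)) L) {m : ℕ} (hm : 1 ≤ m) :
    HB T (ellipticRHS f m) ((10 + 36 * L) * (multinom3Sum (fun k => k.factorial * e k) m +
      m * multinom4Sum (fun k => k.factorial * e k) m +
      1 / ((m:ℝ) + 1) * multinom6Sum (fun k => k.factorial * e k) m)) := by
  refine (h.rhs hL hm).mono ?_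
  have hL0 := hL.nonneg
  have a3 : m.factorial * ∑ r ∈ Finset.Icc 1 (m - 1), cv e e r * e (m - r) ≤ multinom3Sum (fun k => k.factorial * e k) m := by
    rw [multi3, pol_mul_coeff]
    gcongr
    exact sub_cv (gp2_nn h.nn m) (gp_nn h.nn m) (by omega) fun r h1 h2 => ⟨gp2 e (by omega), gp_coeff e (by omega)⟩
  have a4 : (m - 1).factorial * cv (cv e e) (cv e e) (m - 1) = multinom4Sum (fun k => k.factorial * e k) m := by
    rw [multi4, pol_mul_coeff]
    congr 1
    exact cv_congr (fun k hk => (gp2 e (by omega)).symm) (fun k hk => (gp2 e (by omega)).symm)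
  have a6 : (m + 1).factorial * ∑ r ∈ Finset.Icc 2 (m - 1), cv (cv e e) e r * cv (cv e e) e (m + 1 - r) ≤
      multinom6Sum (fun k => k.factorial * e k) m := by
    rw [multi6, pol_mul_coeff]
    gcongr
    exact sub_cv (gp3_nn h.nn m) (gp3_nn h.nn m) (by omega) fun r h1 h2 => ⟨gp3 e (by omega), gp3 e (by omega)⟩
  have p3 : 0 ≤ multinom3Sum (fun k => k.factorial * e k) m := by
    rw [multi3]; exact mul_nonneg (by positivity) (gp3_nn h.nn m m)
  have p4 : 0 ≤ multinom4Sum (fun k => k.factorial * e k) m := by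
    rw [← a4]; exact mul_nonneg (by positivity) (cv_nn h.nn2 h.nn2 _)
  have p6 : 0 ≤ multinom6Sum (fun k => k.factorial * e k) m := by
    rw [multi6, pol_mul_coeff]; exact mul_nonneg (by positivity) (cv_nn (gp3_nn h.nn m) (gp3_nn h.nn m) _)
  rw [a4]
  set M3 := multinom3Sum (fun k => k.factorial * e k) m
  set M4 := multinom4Sum (fun k => k.factorial * e k) m
  set M6 := multinom6Sum (fun k => k.factorial * e k) m
  have b6 := mul_le_mul_of_nonneg_left a6 (by positivity : 0 ≤ 1 / ((m:ℝ) + 1))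
  have q6 : 0 ≤ 1 / ((m:ℝ) + 1) * M6 := by positivity
  have q4 : 0 ≤ (m:ℝ) * M4 := by positivity
  have b7 := mul_le_mul_of_nonneg_left b6 (by positivity : 0 ≤ 36 * L)
  have c1 : 0 ≤ L * M3 := by positivity
  have c2 : 0 ≤ L * ((m:ℝ) * M4) := by positivity
  linarith

lemma multi_scale {b : ℕ → ℝ} (hb : ∀ k, 0 ≤ b k) {κ : ℝ} (hκ : 1 ≤ κ) (m : ℕ) :
    multinom3Sum (fun k => κ * b k) m + m * multinom4Sum (fun k => κ * b k) m + 1 / ((m:ℝ) + 1) * multinom6Sum (fun k => κ * b k) m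
    ≤ κ ^ 6 * (multinom3Sum b m + m * multinom4Sum b m + 1 / ((m:ℝ) + 1) * multinom6Sum b m) := by
  have e3 : multinom3Sum (fun k => κ * b k) m = κ ^ 3 * multinom3Sum b m := by
    rw [multinom3Sum, multinom3Sum, Finset.mul_sum]; exact Finset.sum_congr rfl fun x _ => by ring
  have e4 : multinom4Sum (fun k => κ * b k) m = κ ^ 4 * multinom4Sum b m := by
    rw [multinom4Sum, multinom4Sum, Finset.mul_sum]; exact Finset.sum_congr rfl fun x _ => by ring
  have e6 : multinom6Sum (fun k => κ * b k) m = κ ^ 6 * multinom6Sum b m := by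
    rw [multinom6Sum, multinom6Sum, Finset.mul_sum]; exact Finset.sum_congr rfl fun x _ => by ring
  have p3 : 0 ≤ multinom3Sum b m := Finset.sum_nonneg fun x _ => by
    have := hb x.1; have := hb x.2.1; have := hb x.2.2; positivity
  have p4 : 0 ≤ multinom4Sum b m := Finset.sum_nonneg fun x _ => by
    have := hb x.1; have := hb x.2.1; have := hb x.2.2.1; have := hb x.2.2.2; positivity
  rw [e3, e4, e6]
  have k3 : κ ^ 3 ≤ κ ^ 6 := pow_le_pow_right₀ hκ (by norm_num)
  have k4 : κ ^ 4 ≤ κ ^ 6 := pow_le_pow_right₀ hκ (by norm_num)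
  have q3 := mul_le_mul_of_nonneg_right k3 p3
  have q4 := mul_le_mul_of_nonneg_right k4 (by positivity : 0 ≤ (m:ℝ) * multinom4Sum b m)
  linarith

lemma HB.inv_sqrt {T : Set (ℝ × ℝ)} {g : ℝ × ℝ → ℝ} {c δ : ℝ} (h : HB T g c) (hδ : 0 < δ) (hg : ∀ x ∈ T, δ ≤ g x) :
    HB T (fun x => 1 / √(g x)) (1 / √δ + c / (δ * √δ)) := by
  have hs : 0 < √δ := Real.sqrt_pos.mpr hδ
  have hc := h.nonneg
  have hb : ∀ x ∈ T, √δ ≤ √(g x) := fun x hx => Real.sqrt_le_sqrt (hg x hx)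
  refine HB.of_bounds (by positivity) ?_ (by positivity) ?_
  · intro x hx
    rw [abs_of_nonneg (by positivity)]
    exact one_div_le_one_div_of_le hs (hb x hx)
  · intro x hx y hy
    have hx1 := hb x hx
    have hy1 := hb y hy
    have px : 0 < √(g x) := hs.trans_le hx1
    have py : 0 < √(g y) := hs.trans_le hy1
    have sx := Real.sq_sqrt (hδ.le.trans (hg x hx))
    have sy := Real.sq_sqrt (hδ.le.trans (hg y hy))
    have e : 1 / √(g x) - 1 / √(g y) = (g y - g x) / (√(g x) * √(g y) * (√(g x) + √(g y))) := by
      rw [← sx, ← sy]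
      simp only [Real.sqrt_sq px.le, Real.sqrt_sq py.le]
      field_simp; ring
    rw [e, abs_div, abs_of_pos (by positivity : 0 < √(g x) * √(g y) * (√(g x) + √(g y))), abs_sub_comm, div_le_iff₀ (by positivity)]
    have hh := h.hol hx hy
    have d1 : δ * √δ ≤ √(g x) * √(g y) * (√(g x) + √(g y)) := by
      have : δ = √δ * √δ := (Real.mul_self_sqrt hδ.le).symm
      calc δ * √δ = √δ * √δ * √δ := by rw [← this]
        _ ≤ √(g x) * √(g y) * (√(g x) + √(g y)) := by gcongr; linarith
    calc _ ≤ c * √(dist x y) := hh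
      _ = c / (δ * √δ) * √(dist x y) * (δ * √δ) := by field_simp
      _ ≤ _ := by gcongr

lemma sd_disc {p q r s t : ℝ} (h1 : r * t - s ^ 2 ≠ 0) (h2 : (1 + q ^ 2) * r - 2 * p * q * s + (1 + p ^ 2) * t = 0) :
    0 < s ^ 2 - r * t := by
  rcases lt_or_gt_of_ne h1 with h | h
  · linarith
  · exfalso
    have e : r ^ 2 + (q * r - p * s) ^ 2 + p ^ 2 * (r * t - s ^ 2) + r * t = 0 := by
      have : r * ((1 + q ^ 2) * r - 2 * p * q * s + (1 + p ^ 2) * t) = 0 := by rw [h2, mul_zero]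
      linarith
    have a1 : 0 ≤ p ^ 2 * (r * t - s ^ 2) := by positivity
    have a2 := sq_nonneg s
    have a3 := sq_nonneg r
    have a4 := sq_nonneg (q * r - p * s)
    linarith

lemma K0_eq (f : ℕ → ℝ × ℝ → ℝ) (x : ℝ × ℝ) : -Kseq f 0 x =
    (1 + pdx (f 0) x ^ 2 + pdy (f 0) x ^ 2) * (fxy (f 0) x ^ 2 - fxx (f 0) x * fyy (f 0) x) := by
  simp [Kseq, gradSqr, hessDiscr]; ring

lemma sd_main (Ω : Set (ℝ × ℝ)) (hΩ : IsAnalyticJordanDomain Ω) (f : ℕ → ℝ × ℝ → ℝ)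
    (hf : ∀ k, IsC2Half (f k) Ω)
    (hflat : ∀ p ∈ closure Ω, fxx (f 0) p * fyy (f 0) p - (fxy (f 0) p) ^ 2 ≠ 0)
    (hmin : ∀ p ∈ closure Ω,
      (1 + (pdy (f 0) p) ^ 2) * fxx (f 0) p - 2 * pdx (f 0) p * pdy (f 0) p * fxy (f 0) p
        + (1 + (pdx (f 0) p) ^ 2) * fyy (f 0) p = 0)
    (hbd : ∀ m : ℕ, 1 ≤ m → ∀ p ∈ frontier Ω, f m p = 0)
    (heq : ∀ m : ℕ, 1 ≤ m → ∀ p ∈ Ω, Hop f 0 (f m) p = ellipticRHS f m p) :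
    ∃ C : ℝ, 0 < C ∧ ∀ m : ℕ, 1 ≤ m → C2halfNorm (f m) Ω ≤ C *
        (multinom3Sum (fun k => C2halfNorm (f k) Ω) m + (m : ℝ) * multinom4Sum (fun k => C2halfNorm (f k) Ω) m
          + 1 / ((m : ℝ) + 1) * multinom6Sum (fun k => C2halfNorm (f k) Ω) m) := by
  have hcomp := hΩ.2.1.isCompact_closure
  obtain ⟨x0, hx0⟩ := hΩ.2.2.1.nonempty
  set N : ℕ → ℝ := fun k => C2halfNorm (f k) Ω with hN
  have nl := fun k => sd_norm_link hΩ.2.1 (hf k)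
  have hN0 : ∀ k, 0 ≤ N k := fun k => (nl k).1
  have hNp : 0 < N 0 := by
    refine lt_of_le_of_ne (hN0 0) fun h => hflat x0 (subset_closure hx0) ?_
    have e1 := (nl 0).2.2.1.bd hx0
    have e2 := (nl 0).2.2.2.1.bd hx0
    change |_| ≤ N 0 at e1 e2
    rw [← h, abs_nonpos_iff] at e1 e2
    rw [e1, e2]; ring
  obtain ⟨C1, hC1, hin1⟩ := sd_interp1 hΩ
  set κ := 1 + 2 * C1 + 1 / N 0 with hκ
  have hκp : 0 < 1 / N 0 := by positivity
  have hκ1 : 1 ≤ κ := by linarith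
  set e : ℕ → ℝ := fun k => κ * N k / k.factorial with he
  have hfe : ∀ k : ℕ, (k.factorial : ℝ) * e k = κ * N k := by
    intro k; rw [he]; field_simp
  have hle : ∀ k, N k ≤ κ * N k := fun k => le_mul_of_one_le_left (hN0 k) hκ1
  have hSQ : SQ (closure Ω) f e := by
    have hpq := fun k => hin1 (f k) _ _ _ _ _ (N k) (N k) (sd_link hΩ.1 (hf k)) (hN0 k) (hN0 k) (nl k).2.1
      (fun x hx => (nl k).2.2.1.bd hx) (fun x hx => (nl k).2.2.2.1.bd hx) (fun x hx => (nl k).2.2.2.2.bd hx)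
    have hb : ∀ k, C1 * (N k + N k) ≤ κ * N k := by
      intro k
      have : 2 * C1 ≤ κ := by linarith
      have := mul_le_mul_of_nonneg_right this (hN0 k)
      linarith
    refine ⟨fun k => ?_, ?_, fun k => ?_, fun k => ?_, fun k => ?_, fun k => ?_, fun k => ?_⟩
    · have := hN0 k
      simp only [he]; positivity
    · simp only [he, Nat.factorial_zero, Nat.cast_one, div_one]
      have : 1 / N 0 ≤ κ := by linarith
      have := mul_le_mul_of_nonneg_right this (hN0 0)
      rwa [one_div_mul_cancel hNp.ne'] at this
    all_goals rw [hfe k]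
    · exact (hpq k).1.mono (hb k)
    · exact (hpq k).2.mono (hb k)
    · exact ((nl k).2.2.1.closure (hf k).2.2.2.2.1).mono (hle k)
    · exact ((nl k).2.2.2.1.closure (hf k).2.2.2.2.2.1).mono (hle k)
    · exact ((nl k).2.2.2.2.closure (hf k).2.2.2.2.2.2.1).mono (hle k)
  obtain ⟨L, hL⟩ : ∃ L, HB (closure Ω) (fun p => 1 / √(-Kseq f 0 p)) L := by
    have hK := (hSQ.ks 0).neg
    obtain ⟨y, hy, hmn⟩ := hcomp.exists_isMinOn ⟨x0, subset_closure hx0⟩ hK.cont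
    refine ⟨_, hK.inv_sqrt (δ := -Kseq f 0 y) ?_ fun x hx => hmn hx⟩
    rw [K0_eq]
    exact mul_pos (by positivity) (sd_disc (hflat y hy) (hmin y hy))
  have hL0 := hL.nonneg
  set a := fy2r f 0 with ha
  set b := fun p => -fxfyr f 0 p with hb
  set c := fx2r f 0 with hc
  set b1 := fun p => 2 * (fyy (f 0) p * pdx (f 0) p - fxy (f 0) p * pdy (f 0) p) with hb1
  set b2 := fun p => 2 * (fxx (f 0) p * pdy (f 0) p - fxy (f 0) p * pdx (f 0) p) with hb2
  set E := e 0 with hE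
  have hE1 : 1 ≤ E := hSQ.one
  have hEE : E * E ≤ 4 * (E * E) := by nlinarith
  have aeq : ∀ x, a x = 1 + pdy (f 0) x ^ 2 := fun x => by simp [ha, fy2r]; ring
  have ceq : ∀ x, c x = 1 + pdx (f 0) x ^ 2 := fun x => by simp [hc, fx2r]; ring
  have beq : ∀ x, b x = -(pdx (f 0) x * pdy (f 0) x) := fun x => by simp [hb, fxfyr]
  have hco : SCoef Ω a b c b1 b2 (4 * (E * E)) := by
    have c0 : cv e e 0 = E * E := by simp [cv, hE]
    have b0 : ∀ {A B C D : ℝ × ℝ → ℝ}, HB (closure Ω) A (Nat.factorial 0 * e 0) → HB (closure Ω) B (Nat.factorial 0 * e 0) →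
        HB (closure Ω) C (Nat.factorial 0 * e 0) → HB (closure Ω) D (Nat.factorial 0 * e 0) →
        HB (closure Ω) (fun p => 2 * (A p * B p - C p * D p)) (4 * (E * E)) := by
      intro A B C D hA hB hC hD
      refine (((hA.mul hB).sub (hC.mul hD)).smul 2).mono (le_of_eq ?_)
      simp only [Nat.factorial_zero, Nat.cast_one, one_mul, ← hE]
      rw [abs_of_pos (by norm_num : (0:ℝ) < 2)]; ring
    refine ⟨(hSQ.fy2 0).mono ?_, (hSQ.fxfy 0).neg.mono ?_, (hSQ.fx2 0).mono ?_,
      b0 (hSQ.ht 0) (hSQ.hp 0) (hSQ.hs 0) (hSQ.hq 0), b0 (hSQ.hr 0) (hSQ.hq 0) (hSQ.hs 0) (hSQ.hp 0), ?_, ?_⟩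
    · rw [c0, Nat.factorial_zero, Nat.cast_one]; linarith [mul_self_nonneg E]
    · rw [c0, Nat.factorial_zero, Nat.cast_one]; linarith [mul_self_nonneg E]
    · rw [c0, Nat.factorial_zero, Nat.cast_one]; linarith [mul_self_nonneg E]
    · intro x _ v w
      rw [aeq, beq, ceq]
      have := sq_nonneg (pdy (f 0) x * v - pdx (f 0) x * w)
      linarith
    · intro x _
      rw [aeq, beq, ceq]
      have h1 := sq_nonneg (pdy (f 0) x)
      have h2 := sq_nonneg (pdx (f 0) x)
      linarith
  obtain ⟨K, hK, hsch⟩ := sd_schauder hΩ (by linarith [mul_le_mul hE1 hE1 zero_le_one (by linarith)] : 1 ≤ 4 * (E * E)) hco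
  refine ⟨4 * K * ((10 + 36 * L) * κ ^ 6), by positivity, fun m hm => ?_⟩
  set S := multinom3Sum N m + (m : ℝ) * multinom4Sum N m + 1 / ((m : ℝ) + 1) * multinom6Sum N m with hS
  set X := (10 + 36 * L) * κ ^ 6 * S with hX
  have hrhs : HB Ω (ellipticRHS f m) X := by
    refine ((hSQ.rhs2 hL hm).subset subset_closure).mono ?_
    have e1 : (fun k : ℕ => (k.factorial : ℝ) * e k) = fun k => κ * N k := funext hfe
    rw [e1, hX, mul_assoc]
    have := multi_scale hN0 hκ1 m
    gcongr
  have hX0 := hrhs.nonneg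
  obtain ⟨-, cu, cp, cq, cr, cs, ct, -⟩ := hf m
  have hl := sd_link hΩ.1 (hf m)
  have hD : SDat Ω (f m) (pdx (f m)) (pdy (f m)) (fxx (f m)) (fxy (f m)) (fyy (f m)) :=
    ⟨cu, cp, cq, cr, cs, ct, hl.du, hl.dp, hl.dq, hbd m hm⟩
  set g : ℝ × ℝ → ℝ := fun x => a x * fxx (f m) x + 2 * b x * fxy (f m) x + c x * fyy (f m) x + b1 x * pdx (f m) x
    + b2 x * pdy (f m) x with hg
  have gc : ContinuousOn g (closure Ω) :=
    ((((hco.ha.cont.mul cr).add ((continuousOn_const.mul hco.hb.cont).mul cs)).add (hco.hc.cont.mul ct)).add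
      (hco.hb1.cont.mul cp)).add (hco.hb2.cont.mul cq)
  have gH : HB (closure Ω) g X := by
    refine HB.closure gc (hrhs.congr fun x hx => ?_)
    rw [← heq m hm x hx, Hop, if_pos rfl, hg]
    simp only [ha, hb, hc, hb1, hb2, pow_one]
    ring
  have fin : ∀ ε, 0 < ε → N m ≤ 4 * (K * (X + ε)) := by
    intro ε hε
    obtain ⟨h0, h1, h2, h3, h4, h5⟩ := hsch (f m) _ _ _ _ _ g (X + ε) (N m) hD (fun x _ => rfl) (by positivity)
      (gH.mono (by linarith)) (hN0 m)
      ⟨fun x hx y hy => (nl m).2.2.1.hol hx hy, fun x hx y hy => (nl m).2.2.2.1.hol hx hy,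
        fun x hx y hy => (nl m).2.2.2.2.hol hx hy⟩
    exact sd_norm_le h0 h1 h2 h3 h4 h5
  change N m ≤ _
  refine le_of_forall_pos_le_add fun ε hε => ?_
  have := fin (ε / (4 * K)) (by positivity)
  have e1 : 4 * (K * (X + ε / (4 * K))) = 4 * K * ((10 + 36 * L) * κ ^ 6) * S + ε := by
    rw [hX]; field_simp
  linarith

theorem stmt_14 (Ω : Set (ℝ × ℝ)) (hΩ : IsAnalyticJordanDomain Ω)
    (f : ℕ → ℝ × ℝ → ℝ)
    (hf0 : IsC2Half (f 0) Ω)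
    (hflat : ∀ p ∈ closure Ω, fxx (f 0) p * fyy (f 0) p - (fxy (f 0) p) ^ 2 ≠ 0)
    (hmin : ∀ p ∈ closure Ω,
      (1 + (pdy (f 0) p) ^ 2) * fxx (f 0) p
        - 2 * pdx (f 0) p * pdy (f 0) p * fxy (f 0) p
        + (1 + (pdx (f 0) p) ^ 2) * fyy (f 0) p = 0)
    (hseq : ∀ m : ℕ, 1 ≤ m → IsC2Half (f m) Ω ∧ (∀ p ∈ frontier Ω, f m p = 0) ∧
      ∀ p ∈ Ω, Hop f 0 (f m) p = ellipticRHS f m p) :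
    ∃ C : ℝ, 0 < C ∧ ∀ m : ℕ, 1 ≤ m →
      C2halfNorm (f m) Ω ≤ C *
        (multinom3Sum (fun k => C2halfNorm (f k) Ω) m
          + (m : ℝ) * multinom4Sum (fun k => C2halfNorm (f k) Ω) m
          + 1 / ((m : ℝ) + 1) * multinom6Sum (fun k => C2halfNorm (f k) Ω) m) := by
  refine sd_main Ω hΩ f (fun k => ?_) hflat hmin (fun m hm => (hseq m hm).2.1) (fun m hm => (hseq m hm).2.2)
  rcases Nat.eq_zero_or_pos k with rfl | hk
  · exact hf0
  · exact (hseq k hk).1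

end
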